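/- arXiv:1907.08545 — 4 statements merged into one kernel-verified Lean document; each statement's English description precedes it below -/
import Mathlib

section
/- Let P ⊆ ℂ[x_1, …, x_n] be a prime ideal generated by polynomials with real coefficients, let X = {z ∈ ℂ^n : p(z) = 0 for all p ∈ P}, and let d = max{|S| : S ⊆ [n] and P ∩ ℂ[x_i : i ∈ S] = {0}} be the rank of the algebraic matroid of X. Assume 1 ≤ d ≤ n−1 and that X is positively hyperbolic of codimension n−d. Then the algebraic matroid of X is a positroid: there exists a real d × n matrix B of rank d, all of whose d × d minors are nonnegative, such that for every S ⊆ [n], the columns of B indexed by S are linearly independent if and only if P ∩ ℂ[x_i : i ∈ S] = {0}. -/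
open Matrix

/-- All maximal (`c × c`) minors of a `c × n` real matrix are positive. -/
def AllMinorsPos {c n : ℕ} (A : Matrix (Fin c) (Fin n) ℝ) : Prop :=
  ∀ s : Fin c → Fin n, StrictMono s → 0 < (A.submatrix id s).det

/-- All maximal (`c × c`) minors of a `c × n` real matrix are nonnegative. -/
def AllMinorsNonneg {c n : ℕ} (A : Matrix (Fin c) (Fin n) ℝ) : Prop :=
  ∀ s : Fin c → Fin n, StrictMono s → 0 ≤ (A.submatrix id s).det

/-- A `c`-dimensional linear subspace of `ℝⁿ` is positive if it is the row space of a real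
`c × n` matrix of rank `c` all of whose `c × c` minors are positive. -/
def IsPositiveSubspace {n : ℕ} (c : ℕ) (L : Submodule ℝ (Fin n → ℝ)) : Prop :=
  ∃ A : Matrix (Fin c) (Fin n) ℝ, A.rank = c ∧
    L = Submodule.span ℝ (Set.range fun i => A i) ∧ AllMinorsPos A

/-- A `c`-dimensional linear subspace of `ℝⁿ` is nonnegative if it is the row space of a real
`c × n` matrix of rank `c` all of whose `c × c` minors are nonnegative. -/
def IsNonnegSubspace {n : ℕ} (c : ℕ) (L : Submodule ℝ (Fin n → ℝ)) : Prop :=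
  ∃ A : Matrix (Fin c) (Fin n) ℝ, A.rank = c ∧
    L = Submodule.span ℝ (Set.range fun i => A i) ∧ AllMinorsNonneg A

/-- Coordinatewise imaginary part of a point of `ℂⁿ`. -/
def imPart {n : ℕ} (x : Fin n → ℂ) : Fin n → ℝ := fun i => (x i).im

/-- A subset of `ℂⁿ` is positively hyperbolic of codimension `c` if the imaginary part of any
of its points does not lie in `L \ {0}` for any positive `c`-dimensional subspace `L ⊆ ℝⁿ`. -/
def PosHyperbolic {n : ℕ} (c : ℕ) (X : Set (Fin n → ℂ)) : Prop :=
  ∀ L : Submodule ℝ (Fin n → ℝ), IsPositiveSubspace c L →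
    ∀ x ∈ X, ¬ (imPart x ∈ L ∧ imPart x ≠ 0)

/-- A set `S` of coordinates is independent in the algebraic matroid of `V(P)` if no nonzero
polynomial of `P` involves only variables from `S`. -/
def AlgIndep {n : ℕ} (P : Ideal (MvPolynomial (Fin n) ℂ)) (S : Set (Fin n)) : Prop :=
  ∀ p ∈ P, (↑p.vars : Set (Fin n)) ⊆ S → p = 0


theorem exists_integral_primitive_element {C R K : Type} [Field C] [CommRing R] [IsDomain R]
    [Field K] [CharZero K] [Algebra C R] [Algebra C K] [Algebra R K] [IsScalarTower C R K]
    [FaithfulSMul R K] [Algebra.IsAlgebraic R K] {ι : Type} [Finite ι] (x : ι → K)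
    (hx : IntermediateField.adjoin C (Set.range x) = ⊤) :
    ∃ u : K, IsIntegral R u ∧
      ∀ z : K, ∃ D : R, D ≠ 0 ∧ ∃ G : Polynomial R, algebraMap R K D * z = Polynomial.aeval u G := by
  classical
  let k := FractionRing R
  let _ : Algebra k K := FractionRing.liftAlgebra R K
  have : IsScalarTower R k K := FractionRing.isScalarTower_liftAlgebra R K
  have : IsScalarTower C k K := IsScalarTower.of_algebraMap_eq fun c => by
    rw [IsScalarTower.algebraMap_apply C R K, IsScalarTower.algebraMap_apply C R k,
      ← IsScalarTower.algebraMap_apply R k K]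
  have : Algebra.IsAlgebraic k K := (IsFractionRing.comap_isAlgebraic_iff (A := R) (K := k)).1 inferInstance
  have : CharZero k := (algebraMap k K).charZero_iff (algebraMap k K).injective |>.2 inferInstance
  have htop : IntermediateField.adjoin k (Set.range x) = ⊤ := by
    rw [eq_top_iff]
    intro z _
    have hz : z ∈ IntermediateField.adjoin C (Set.range x) := hx ▸ trivial
    have hle : IntermediateField.adjoin C (Set.range x) ≤
        (IntermediateField.adjoin k (Set.range x)).restrictScalars C :=
      IntermediateField.adjoin_le_iff.2 (IntermediateField.subset_adjoin k _)
    exact hle hz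
  have : FiniteDimensional k K := by
    have h1 : FiniteDimensional k (IntermediateField.adjoin k (Set.range x)) :=
      IntermediateField.finiteDimensional_adjoin fun z _ => Algebra.IsIntegral.isIntegral z
    rw [htop] at h1
    exact IntermediateField.topEquiv.toLinearEquiv.finiteDimensional
  obtain ⟨v, hv⟩ := Field.exists_primitive_element k K
  obtain ⟨r, hr, hrv⟩ :=
    IsAlgebraic.exists_integral_multiple (Algebra.IsAlgebraic.isAlgebraic (R := R) v)
  refine ⟨r • v, hrv, fun z => ?_⟩
  have hrK : algebraMap R k r ≠ 0 := by simpa using hr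
  have hu : Algebra.adjoin k {r • v} = ⊤ := by
    rw [← IntermediateField.adjoin_simple_toSubalgebra_of_isAlgebraic (Algebra.IsAlgebraic.isAlgebraic _)]
    have : IntermediateField.adjoin k {r • v} = ⊤ := by
      rw [eq_top_iff, ← hv, IntermediateField.adjoin_simple_le_iff]
      rw [← algebraMap_smul k r v]
      have h2 := (IntermediateField.adjoin k {algebraMap R k r • v}).smul_mem (x := (algebraMap R k r)⁻¹)
        (IntermediateField.mem_adjoin_simple_self k (algebraMap R k r • v))
      rwa [smul_smul, inv_mul_cancel₀ hrK, one_smul] at h2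
    rw [this]; rfl
  have hz : z ∈ Algebra.adjoin k {r • v} := hu ▸ trivial
  rw [Algebra.adjoin_singleton_eq_range_aeval] at hz
  obtain ⟨g, rfl⟩ := hz
  obtain ⟨b, hbM, hb⟩ := IsLocalization.integerNormalization_spec (nonZeroDivisors R) g
  refine ⟨b, nonZeroDivisors.ne_zero hbM,
    IsLocalization.integerNormalization (nonZeroDivisors R) g, ?_⟩
  rw [← Polynomial.aeval_map_algebraMap k, hb, ← algebraMap_smul k b g, map_smul,
    algebraMap_smul]
  exact (Algebra.smul_def _ _).symm

theorem exists_common_denominator {R K : Type} [CommRing R] [IsDomain R] [Field K] [Algebra R K]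
    {u : K} {ι : Type} [Fintype ι] (x : ι → K)
    (h : ∀ z : K, ∃ D : R, D ≠ 0 ∧ ∃ G : Polynomial R,
      algebraMap R K D * z = Polynomial.aeval u G) :
    ∃ D : R, D ≠ 0 ∧ ∃ G : ι → Polynomial R,
      ∀ i, algebraMap R K D * x i = Polynomial.aeval u (G i) := by
  classical
  choose D hD G hG using h
  refine ⟨∏ i, D (x i), Finset.prod_ne_zero_iff.2 fun i _ => hD _,
    fun i => Polynomial.C (∏ j ∈ Finset.univ.erase i, D (x j)) * G (x i), fun i => ?_⟩
  rw [map_mul, Polynomial.aeval_C, ← hG, ← mul_assoc, ← map_mul,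
    Finset.prod_erase_mul _ _ (Finset.mem_univ i)]

theorem exists_homogenization {C R σ : Type} [CommRing C] [CommRing R] [Algebra C R]
    (D : R) (G : σ → R) (p : MvPolynomial σ C) :
    ∃ (N : ℕ) (H : R), ∀ (E : Type) [Field E] [Algebra C E] (θ : R →+* E),
      θ.comp (algebraMap C R) = algebraMap C E → θ D ≠ 0 →
      θ H = θ D ^ N * MvPolynomial.aeval (fun j => θ (G j) / θ D) p := by
  induction p using MvPolynomial.induction_on with
  | C a =>
    refine ⟨0, algebraMap C R a, fun E _ _ θ hθ _ => ?_⟩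
    simp [← hθ]
  | add p q hp hq =>
    obtain ⟨N, H, hH⟩ := hp
    obtain ⟨N', H', hH'⟩ := hq
    refine ⟨N + N', H * D ^ N' + H' * D ^ N, fun E _ _ θ hθ hD => ?_⟩
    simp only [map_add, map_mul, map_pow, hH E θ hθ hD, hH' E θ hθ hD]
    ring
  | mul_X p i hp =>
    obtain ⟨N, H, hH⟩ := hp
    refine ⟨N + 1, H * G i, fun E _ _ θ hθ hD => ?_⟩
    simp only [map_mul, hH E θ hθ hD, MvPolynomial.aeval_X]
    field_simp
    ring

theorem exists_bezout_minpoly {R K : Type} [CommRing R] [IsDomain R] [IsIntegrallyClosed R]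
    [Field K] [Algebra R K] [FaithfulSMul R K] {u : K} (hu : IsIntegral R u)
    (h : ∀ z : K, ∃ D : R, D ≠ 0 ∧ ∃ G : Polynomial R,
      algebraMap R K D * z = Polynomial.aeval u G)
    (H : Polynomial R) (hH : Polynomial.aeval u H ≠ 0) :
    ∃ D : R, D ≠ 0 ∧ ∃ A B : Polynomial R,
      A * H + B * minpoly R u = Polynomial.C D := by
  obtain ⟨D, hD, G, hG⟩ := h (Polynomial.aeval u H)⁻¹
  have h0 : Polynomial.aeval u (Polynomial.C D - G * H) = 0 := by
    rw [map_sub, map_mul, ← hG, Polynomial.aeval_C]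
    field_simp
    simp
  obtain ⟨B, hB⟩ := minpoly.isIntegrallyClosed_dvd hu h0
  exact ⟨D, hD, G, B, by rw [mul_comm B, ← hB]; ring⟩

theorem aeval_derivative_minpoly_ne_zero {R K : Type} [CommRing R] [IsDomain R] [CharZero R]
    [IsIntegrallyClosed R] [Field K] [Algebra R K] [FaithfulSMul R K] {u : K}
    (hu : IsIntegral R u) : Polynomial.aeval u (minpoly R u).derivative ≠ 0 := by
  intro h
  have hpos := minpoly.natDegree_pos hu
  have hne : (minpoly R u).derivative ≠ 0 := fun h0 =>
    hpos.ne' (Polynomial.derivative_eq_zero.1 h0)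
  have := minpoly.IsIntegrallyClosed.degree_le_of_ne_zero hne h
  exact absurd (Polynomial.degree_derivative_lt (minpoly.ne_zero hu)) (not_lt.2 this)

theorem contDiff_eval_eval {d : ℕ} (H : Polynomial (MvPolynomial (Fin d) ℂ)) :
    ContDiff ℂ 1 fun q : (Fin d → ℂ) × ℂ => H.eval₂ (MvPolynomial.eval q.1) q.2 := by
  have hM : ∀ p : MvPolynomial (Fin d) ℂ,
      ContDiff ℂ 1 fun q : (Fin d → ℂ) × ℂ => MvPolynomial.eval q.1 p := by
    intro p
    induction p using MvPolynomial.induction_on with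
    | C a => simpa using contDiff_const
    | add p q hp hq => simpa using hp.add hq
    | mul_X p i hp =>
      simp only [map_mul, MvPolynomial.eval_X]
      exact hp.mul (by fun_prop)
  induction H using Polynomial.induction_on' with
  | add p q hp hq => simpa [Polynomial.eval₂_add] using hp.add hq
  | monomial k a =>
    simp only [Polynomial.eval₂_monomial]
    exact (hM a).mul (by fun_prop)

theorem IsTranscendenceBasis.isAlgebraic_mvPolynomial {C K ι : Type} [Field C] [Field K]
    [Algebra C K] {s : ι → K} (hs : IsTranscendenceBasis C s)
    [Algebra (MvPolynomial ι C) K]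
    (h : algebraMap (MvPolynomial ι C) K = (MvPolynomial.aeval s : _ →ₐ[C] K).toRingHom) :
    Algebra.IsAlgebraic (MvPolynomial ι C) K := by
  have h1 := hs.isAlgebraic
  refine (Algebra.isAlgebraic_ringHom_iff_of_comp_eq hs.1.aevalEquiv (RingEquiv.refl K) ?_).1 h1
  rw [h]
  ext z
  · simp
  · simp

open Topology Filter in
/-- Over a generic point `s₀`, the variety with generic point `x` has a local holomorphic section
of the map given by a transcendence basis. -/
theorem exists_local_section {n d : ℕ} {K : Type} [Field K] [Algebra ℂ K] (x : Fin n → K)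
    (hx : IntermediateField.adjoin ℂ (Set.range x) = ⊤) (l : Fin d → MvPolynomial (Fin n) ℂ)
    (hl : IsTranscendenceBasis ℂ fun i => MvPolynomial.aeval x (l i))
    (Q : MvPolynomial (Fin n) ℂ) (hQ : MvPolynomial.aeval x Q ≠ 0) :
    ∃ D : MvPolynomial (Fin d) ℂ, D ≠ 0 ∧ ∀ s₀ : Fin d → ℂ, MvPolynomial.eval s₀ D ≠ 0 →
      ∃ φ : (Fin d → ℂ) → (Fin n → ℂ), DifferentiableAt ℂ φ s₀ ∧
        MvPolynomial.eval (φ s₀) Q ≠ 0 ∧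
        ∀ᶠ s in 𝓝 s₀, (∀ p : MvPolynomial (Fin n) ℂ, MvPolynomial.aeval x p = 0 →
          MvPolynomial.eval (φ s) p = 0) ∧ ∀ i, MvPolynomial.eval (φ s) (l i) = s i := by
  let R := MvPolynomial (Fin d) ℂ
  let ev : R →ₐ[ℂ] K := MvPolynomial.aeval fun i => MvPolynomial.aeval x (l i)
  let _ : Algebra R K := ev.toRingHom.toAlgebra
  have hRK : algebraMap R K = ev.toRingHom := rfl
  have : IsScalarTower ℂ R K := IsScalarTower.of_algebraMap_eq fun c => (ev.commutes c).symm
  have : FaithfulSMul R K := (faithfulSMul_iff_algebraMap_injective R K).2 hl.1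
  have : Algebra.IsAlgebraic R K := hl.isAlgebraic_mvPolynomial rfl
  have : CharZero K := charZero_of_injective_algebraMap (algebraMap ℂ K).injective
  obtain ⟨u, hu, hden⟩ := exists_integral_primitive_element (R := R) x hx
  obtain ⟨D₀, hD₀, G, hG⟩ := exists_common_denominator x hden
  have hDK : algebraMap R K D₀ ≠ 0 := by simpa using hD₀
  obtain ⟨D₁, hD₁, A₁, B₁, hAB₁⟩ :=
    exists_bezout_minpoly hu hden _ (aeval_derivative_minpoly_ne_zero hu)
  let θ₁ : Polynomial R →+* K := (Polynomial.aeval u : Polynomial R →ₐ[R] K).toRingHom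
  have hθ₁ : θ₁.comp (algebraMap ℂ (Polynomial R)) = algebraMap ℂ K := by
    ext c
    simp [θ₁]
  have hθD : θ₁ (Polynomial.C D₀) = algebraMap R K D₀ := by simp [θ₁]
  have hθx : (fun j => θ₁ (G j) / θ₁ (Polynomial.C D₀)) = x := by
    ext j
    rw [hθD, div_eq_iff hDK, mul_comm, hG]
    rfl
  obtain ⟨NQ, HQ, hHQ⟩ := exists_homogenization (Polynomial.C D₀) G Q
  have hQ' : Polynomial.aeval u HQ ≠ 0 := by
    have := hHQ K θ₁ hθ₁ (by rwa [hθD])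
    rw [hθx, hθD] at this
    change θ₁ HQ ≠ 0
    rw [this]
    exact mul_ne_zero (pow_ne_zero _ hDK) hQ
  obtain ⟨D₂, hD₂, A₂, B₂, hAB₂⟩ := exists_bezout_minpoly hu hden _ hQ'
  refine ⟨D₀ * D₁ * D₂, mul_ne_zero (mul_ne_zero hD₀ hD₁) hD₂, fun s₀ hs₀ => ?_⟩
  simp only [map_mul, mul_ne_zero_iff] at hs₀
  obtain ⟨⟨h0, h1⟩, h2⟩ := hs₀
  let F := minpoly R u
  let θ (s : Fin d → ℂ) (v : ℂ) : Polynomial R →+* ℂ :=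
    Polynomial.eval₂RingHom (MvPolynomial.eval s) v
  have hθ : ∀ s v, (θ s v).comp (algebraMap ℂ (Polynomial R)) = algebraMap ℂ ℂ := by
    intro s v
    ext c
    simp [θ, R, IsScalarTower.algebraMap_apply ℂ R (Polynomial R), MvPolynomial.algebraMap_eq]
  have hθC : ∀ s v (r : R), θ s v (Polynomial.C r) = MvPolynomial.eval s r := by
    intro s v r
    simp [θ]
  have hrel : ∀ s v, θ s v F = 0 → MvPolynomial.eval s D₀ ≠ 0 →
      ∀ (p : MvPolynomial (Fin n) ℂ) (r : R), MvPolynomial.aeval x p = algebraMap R K r →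
      MvPolynomial.eval (fun j => θ s v (G j) / MvPolynomial.eval s D₀) p
        = MvPolynomial.eval s r := by
    intro s v hF hD p r hpr
    obtain ⟨N, H, hH⟩ := exists_homogenization (Polynomial.C D₀) G p
    have e1 := hH K θ₁ hθ₁ (by rwa [hθD])
    rw [hθx, hθD, hpr] at e1
    have e2 : Polynomial.aeval u (H - Polynomial.C (D₀ ^ N * r)) = 0 := by
      rw [map_sub, Polynomial.aeval_C, map_mul, map_pow, ← e1]
      exact sub_self _
    obtain ⟨B, hB⟩ := minpoly.isIntegrallyClosed_dvd hu e2
    have e3 := congrArg (θ s v) hB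
    rw [map_sub, hθC, map_mul (θ s v), show θ s v (minpoly R u) = 0 from hF, zero_mul, sub_eq_zero,
      hH ℂ (θ s v) (hθ s v) (by rwa [hθC]), hθC, map_mul, map_pow] at e3
    exact mul_left_cancel₀ (pow_ne_zero N hD) e3
  obtain ⟨u₀, hu₀⟩ : ∃ u₀, θ s₀ u₀ F = 0 := by
    have hm : (F.map (MvPolynomial.eval s₀)).Monic := (minpoly.monic hu).map _
    have hdeg : (F.map (MvPolynomial.eval s₀)).degree ≠ 0 := by
      rw [(minpoly.monic hu).degree_map]
      exact (minpoly.degree_pos hu).ne'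
    obtain ⟨u₀, h⟩ := IsAlgClosed.exists_root _ hdeg
    exact ⟨u₀, by simpa [θ, Polynomial.eval_map, Polynomial.IsRoot] using h⟩
  have hF' : θ s₀ u₀ F.derivative ≠ 0 := by
    intro h
    have := congrArg (θ s₀ u₀) hAB₁
    rw [map_add, map_mul, map_mul, hθC] at this
    rw [show θ s₀ u₀ (minpoly R u) = 0 from hu₀, show θ s₀ u₀ (minpoly R u).derivative = 0 from h,
      mul_zero, mul_zero, add_zero] at this
    exact h1 this.symm
  have hQ₀ : MvPolynomial.eval (fun j => θ s₀ u₀ (G j) / MvPolynomial.eval s₀ D₀) Q ≠ 0 := by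
    intro h
    have e := hHQ ℂ (θ s₀ u₀) (hθ _ _) (by rwa [hθC])
    rw [hθC] at e
    have e' : θ s₀ u₀ HQ = 0 := by
      rw [e]; exact mul_eq_zero_of_right _ h
    have := congrArg (θ s₀ u₀) hAB₂
    rw [map_add, map_mul, map_mul, hθC, e', show θ s₀ u₀ (minpoly R u) = 0 from hu₀,
      mul_zero, mul_zero, add_zero] at this
    exact h2 this.symm
  let f : (Fin d → ℂ) × ℂ → ℂ := fun q => θ q.1 q.2 F
  have hf : HasStrictFDerivAt f (fderiv ℂ f (s₀, u₀)) (s₀, u₀) :=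
    (contDiff_eval_eval F).contDiffAt.hasStrictFDerivAt one_ne_zero
  have hinv : (fderiv ℂ f (s₀, u₀) ∘L .inr ℂ (Fin d → ℂ) ℂ).IsInvertible := by
    have hd : HasDerivAt (fun v : ℂ => f (s₀, v))
        ((fderiv ℂ f (s₀, u₀) ∘L .inr ℂ (Fin d → ℂ) ℂ) 1) u₀ := by
      have := hf.hasFDerivAt.comp_hasDerivAt u₀
        ((hasDerivAt_const u₀ s₀).prodMk (hasDerivAt_id u₀))
      exact this
    have hd' : HasDerivAt (fun v : ℂ => f (s₀, v)) (θ s₀ u₀ F.derivative) u₀ := by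
      have := (F.map (MvPolynomial.eval s₀)).hasDerivAt u₀
      rw [Polynomial.derivative_map] at this
      simpa [f, θ, Polynomial.eval_map] using this
    have hne : (fderiv ℂ f (s₀, u₀) ∘L .inr ℂ (Fin d → ℂ) ℂ) 1 ≠ 0 := by
      rw [hd.unique hd']; exact hF'
    refine ⟨ContinuousLinearEquiv.unitsEquivAut ℂ (Units.mk0 _ hne), ?_⟩
    ext
    simp
  let ψ := hf.implicitFunctionOfProdDomain hinv
  have hψ₀ : ψ s₀ = u₀ :=
    (hf.eventually_apply_eq_iff_implicitFunctionOfProdDomain hinv).self_of_nhds.1 rfl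
  have hψd : DifferentiableAt ℂ ψ s₀ :=
    (hf.hasStrictFDerivAt_implicitFunctionOfProdDomain hinv).hasFDerivAt.differentiableAt
  have hD₀d : ContDiff ℂ 1 fun s : Fin d → ℂ => MvPolynomial.eval s D₀ := by
    have := (contDiff_eval_eval (Polynomial.C D₀)).comp
      (contDiff_id.prodMk (contDiff_const (c := (0 : ℂ))))
    simpa [Function.comp_def] using this
  refine ⟨fun s j => θ s (ψ s) (G j) / MvPolynomial.eval s D₀, ?_, ?_, ?_⟩
  · rw [differentiableAt_pi]
    intro j
    have hG' : DifferentiableAt ℂ (fun q : (Fin d → ℂ) × ℂ => θ q.1 q.2 (G j)) (s₀, ψ s₀) :=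
      (contDiff_eval_eval (G j)).differentiable one_ne_zero (s₀, ψ s₀)
    have hnum : DifferentiableAt ℂ (fun s => θ s (ψ s) (G j)) s₀ :=
      DifferentiableAt.comp (f := fun s => (s, ψ s)) s₀ hG' (differentiableAt_id.prodMk hψd)
    have hdenom : DifferentiableAt ℂ (fun s : Fin d → ℂ => MvPolynomial.eval s D₀) s₀ :=
      hD₀d.differentiable one_ne_zero s₀
    have := hnum.mul (hdenom.fun_inv h0)
    exact this
  · simpa [hψ₀] using hQ₀
  · have hD₀ev : ∀ᶠ s in 𝓝 s₀, MvPolynomial.eval s D₀ ≠ 0 :=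
      hD₀d.continuous.continuousAt.eventually_ne h0
    filter_upwards [hD₀ev, hf.eventually_apply_implicitFunctionOfProdDomain hinv] with s hs hs'
    have hs'' : θ s (ψ s) F = 0 := hs'.trans hu₀
    refine ⟨fun p hp => ?_, fun i => ?_⟩
    · simpa using hrel s (ψ s) hs'' hs p 0 (by simpa using hp)
    · simpa using hrel s (ψ s) hs'' hs (l i) (MvPolynomial.X i)
        (MvPolynomial.aeval_X (fun i => MvPolynomial.aeval x (l i)) i).symm
theorem eq_zero_of_vecMul_eq_zero_of_det_submatrix_ne_zero {c n : ℕ}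
    {M : Matrix (Fin c) (Fin n) ℝ} {s : Fin c → Fin n} (hs : (M.submatrix id s).det ≠ 0)
    {a : Fin c → ℝ} (ha : a ᵥ* M = 0) : a = 0 := by
  refine Matrix.eq_zero_of_vecMul_eq_zero hs ?_
  ext j
  exact congrFun ha (s j)

namespace AllMinorsPos

variable {c n : ℕ} {A : Matrix (Fin c) (Fin n) ℝ}

theorem mul_diagonal (hA : AllMinorsPos A) {r : Fin n → ℝ} (hr : ∀ j, 0 < r j) :
    AllMinorsPos (A * diagonal r) := by
  intro s hs
  have : (A * diagonal r).submatrix id s = A.submatrix id s * diagonal (r ∘ s) := by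
    ext i j
    simp [Matrix.mul_diagonal]
  rw [this, det_mul, det_diagonal]
  exact mul_pos (hA s hs) (Finset.prod_pos fun i _ => hr _)

theorem eq_zero_of_vecMul_eq_zero (hA : AllMinorsPos A) (hcn : c ≤ n) {a : Fin c → ℝ}
    (ha : a ᵥ* A = 0) : a = 0 :=
  eq_zero_of_vecMul_eq_zero_of_det_submatrix_ne_zero
    (hA _ (Fin.strictMono_castLE hcn)).ne' ha

theorem rank_eq (hA : AllMinorsPos A) (hcn : c ≤ n) : A.rank = c := by
  have h : LinearIndependent ℝ A.row := by
    rw [← Matrix.vecMul_injective_iff]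
    intro a b hab
    rw [← sub_eq_zero]
    refine hA.eq_zero_of_vecMul_eq_zero hcn ?_
    rw [Matrix.sub_vecMul]
    exact sub_eq_zero.2 hab
  simpa using h.rank_matrix

theorem isPositiveSubspace (hA : AllMinorsPos A) (hcn : c ≤ n) :
    IsPositiveSubspace c (Submodule.span ℝ (Set.range fun i => A i)) :=
  ⟨A, hA.rank_eq hcn, rfl, hA⟩

end AllMinorsPos

theorem vecMul_mem_span_rows {c n : ℕ} (a : Fin c → ℝ) (A : Matrix (Fin c) (Fin n) ℝ) :
    a ᵥ* A ∈ Submodule.span ℝ (Set.range fun i => A i) := by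
  rw [Matrix.vecMul_eq_sum]
  exact Submodule.sum_mem _ fun i _ =>
    Submodule.smul_mem _ _ (Submodule.subset_span ⟨i, rfl⟩)

theorem allMinorsPos_vandermonde (c n : ℕ) :
    AllMinorsPos (Matrix.of fun (i : Fin c) (j : Fin n) => (j : ℝ) ^ (i : ℕ)) := by
  intro s hs
  have : (Matrix.of fun (i : Fin c) (j : Fin n) => (j : ℝ) ^ (i : ℕ)).submatrix id s
      = (vandermonde fun k => ((s k : ℕ) : ℝ))ᵀ := by
    ext i j
    simp [vandermonde]
  rw [this, det_transpose, det_vandermonde]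
  refine Finset.prod_pos fun i _ => Finset.prod_pos fun j hj => ?_
  rw [sub_pos, Nat.cast_lt, Fin.val_fin_lt]
  exact hs (Finset.mem_Ioi.1 hj)

/-- The row space of `J` is a complement of the row space of every positive column scaling
of `A`. -/
def TransverseToScalings {c d n : ℕ} (J : Matrix (Fin d) (Fin n) ℝ)
    (A : Matrix (Fin c) (Fin n) ℝ) : Prop :=
  ∀ r : Fin n → ℝ, (∀ j, 0 < r j) → ∀ (w : Fin d → ℝ) (a : Fin c → ℝ),
    w ᵥ* J = a ᵥ* (A * diagonal r) → w = 0 ∧ a = 0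

theorem TransverseToScalings.det_ne_zero {c d n : ℕ} {J : Matrix (Fin d) (Fin n) ℝ}
    {A : Matrix (Fin c) (Fin n) ℝ} (h : TransverseToScalings J A) (τ : Fin d ⊕ Fin c ≃ Fin n)
    {r : Fin n → ℝ} (hr : ∀ j, 0 < r j) :
    ((fromRows J (A * diagonal r)).submatrix id τ).det ≠ 0 := by
  intro h0
  obtain ⟨v, hv, hv0⟩ := Matrix.exists_vecMul_eq_zero_iff.2 h0
  refine hv ?_
  have h1 : v ᵥ* fromRows J (A * diagonal r) = 0 := by
    ext j
    obtain ⟨k, rfl⟩ := τ.surjective j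
    exact congrFun hv0 k
  rw [Matrix.vecMul_fromRows] at h1
  have h2 := h r hr (v ∘ Sum.inl) (-(v ∘ Sum.inr)) (by
    rw [Matrix.neg_vecMul]; exact eq_neg_of_add_eq_zero_left h1)
  ext (i | i)
  · exact congrFun h2.1 i
  · simpa using congrFun h2.2 i

theorem exists_sign_of_continuous_of_ne_zero {n : ℕ} {g : (Fin n → ℝ) → ℝ} (hg : Continuous g)
    (h0 : ∀ r : Fin n → ℝ, (∀ j, 0 < r j) → g r ≠ 0) :
    ∃ ε : ℝ, (ε = 1 ∨ ε = -1) ∧ ∀ r : Fin n → ℝ, (∀ j, 0 ≤ r j) → 0 ≤ ε * g r := by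
  have hconv : Convex ℝ {r : Fin n → ℝ | ∀ j, 0 < r j} := by
    intro x hx y hy a b ha hb hab j
    simp only [Pi.add_apply, Pi.smul_apply, smul_eq_mul]
    rcases ha.eq_or_lt with rfl | ha'
    · have : b = 1 := by linarith
      simpa [this] using hy j
    · exact add_pos_of_pos_of_nonneg (mul_pos ha' (hx j)) (mul_nonneg hb (hy j).le)
  have hiv := hconv.isPreconnected
  have key : ∀ ε : ℝ, (0 < ε * g 1) → ∀ r : Fin n → ℝ, (∀ j, 0 < r j) → 0 < ε * g r := by
    intro ε h1 r hr
    by_contra hneg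
    obtain ⟨r', hr', hr0⟩ := hiv.intermediate_value (f := fun r => ε * g r) (a := r) (b := 1)
      hr (fun j => one_pos) (hg.const_mul ε).continuousOn ⟨not_lt.1 hneg, h1.le⟩
    rcases mul_eq_zero.1 hr0 with h | h
    · simp [h] at h1
    · exact h0 r' hr' h
  obtain ⟨ε, hε, hpos⟩ : ∃ ε : ℝ, (ε = 1 ∨ ε = -1) ∧ 0 < ε * g 1 := by
    rcases lt_or_gt_of_ne (h0 1 fun j => one_pos) with h | h
    · exact ⟨-1, Or.inr rfl, by linarith⟩
    · exact ⟨1, Or.inl rfl, by linarith⟩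
  refine ⟨ε, hε, fun r hr => ?_⟩
  have hc : Continuous fun t : ℝ => ε * g (r + t • 1) := by fun_prop
  have ht := (hc.tendsto 0).mono_left (nhdsWithin_le_nhds (s := Set.Ioi 0))
  simp only [zero_smul, add_zero] at ht
  refine ge_of_tendsto ht ?_
  filter_upwards [self_mem_nhdsWithin] with t ht
  refine (key ε hpos _ fun j => ?_).le
  simpa using add_pos_of_nonneg_of_pos (hr j) ht

theorem exists_strictMono_complement {c d n : ℕ} (hn : d + c = n) {s : Fin d → Fin n}
    (hs : StrictMono s) :
    ∃ s' : Fin c → Fin n, StrictMono s' ∧ ∃ π : Fin d ⊕ Fin c ≃ Fin n,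
      (∀ i, π (Sum.inl i) = s i) ∧ ∀ i, π (Sum.inr i) = s' i := by
  classical
  have hcard : (Finset.univ.image s)ᶜ.card = c := by
    rw [Finset.card_compl, Finset.card_image_of_injective _ hs.injective]
    simp
    omega
  let s' := (Finset.univ.image s)ᶜ.orderEmbOfFin hcard
  refine ⟨s', s'.strictMono, ?_⟩
  have hinj : Function.Injective (Sum.elim s s') := by
    refine hs.injective.sumElim s'.injective fun i j hij => ?_
    have := (Finset.univ.image s)ᶜ.orderEmbOfFin_mem hcard j
    rw [Finset.mem_compl] at this
    exact this (Finset.mem_image.2 ⟨i, Finset.mem_univ _, hij⟩)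
  have hbij : Function.Bijective (Sum.elim s s') :=
    (Fintype.bijective_iff_injective_and_card _).2 ⟨hinj, by simpa using hn⟩
  exact ⟨Equiv.ofBijective _ hbij, fun _ => rfl, fun _ => rfl⟩

theorem TransverseToScalings.exists_sign {c d n : ℕ} (hn : d + c = n)
    {J J₀ : Matrix (Fin d) (Fin n) ℝ} {A : Matrix (Fin c) (Fin n) ℝ} (hA : AllMinorsPos A)
    (hJ : TransverseToScalings J A) (hJ₀ : TransverseToScalings J₀ A) :
    ∃ ε : ℝ, (ε = 1 ∨ ε = -1) ∧ ∀ s : Fin d → Fin n, StrictMono s →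
      0 ≤ ε * ((J.submatrix id s).det * (J₀.submatrix id s).det) := by
  let τ : Fin d ⊕ Fin c ≃ Fin n := finSumFinEquiv.trans (finCongr hn)
  let f (J : Matrix (Fin d) (Fin n) ℝ) (τ : Fin d ⊕ Fin c ≃ Fin n) (r : Fin n → ℝ) : ℝ :=
    ((fromRows J (A * diagonal r)).submatrix id τ).det
  have hf : ∀ J, Continuous (f J τ) := by
    intro J
    refine Continuous.matrix_det ?_
    refine continuous_matrix fun i j => ?_
    rcases i with i | i
    · exact continuous_const
    · simp only [submatrix_apply, id, fromRows_apply_inr, Matrix.mul_diagonal]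
      fun_prop
  obtain ⟨ε, hε, h⟩ := exists_sign_of_continuous_of_ne_zero ((hf J).mul (hf J₀))
    fun r hr => mul_ne_zero (hJ.det_ne_zero τ hr) (hJ₀.det_ne_zero τ hr)
  refine ⟨ε, hε, fun s hs => ?_⟩
  obtain ⟨s', hs', π, hπl, hπr⟩ := exists_strictMono_complement hn hs
  have hperm : ∀ J r, f J π r = (Equiv.Perm.sign (π.trans τ.symm) : ℝ) * f J τ r := by
    intro J r
    rw [← det_permute']
    simp only [f, submatrix_submatrix]
    congr 2
    ext i
    simp
  let r : Fin n → ℝ := fun j => Sum.elim (fun _ => (0 : ℝ)) (fun _ => 1) (π.symm j)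
  have hr : ∀ j, 0 ≤ r j := by
    intro j
    rcases h : π.symm j with i | i <;> simp [r, h]
  have hdet : ∀ J, f J π r = (J.submatrix id s).det * (A.submatrix id s').det := by
    intro J
    have : (fromRows J (A * diagonal r)).submatrix id π
        = fromBlocks (J.submatrix id s) (J.submatrix id s') 0 (A.submatrix id s') := by
      have hl : ∀ i, π.symm (s i) = Sum.inl i := fun i => by simp [← hπl]
      have hr : ∀ i, π.symm (s' i) = Sum.inr i := fun i => by simp [← hπr]
      ext (i | i) (j | j) <;> simp [hπl, hπr, r, hl, hr, Matrix.mul_diagonal]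
    simp only [f]
    rw [this, det_fromBlocks_zero₂₁]
  have hsq : ((Equiv.Perm.sign (π.trans τ.symm) : ℤ) : ℝ) * (Equiv.Perm.sign (π.trans τ.symm) : ℤ)
      = 1 := by
    rw [← Int.cast_mul, ← Units.val_mul, Int.units_mul_self]
    simp
  have hmul : f J π r * f J₀ π r = f J τ r * f J₀ τ r := by
    rw [hperm, hperm, mul_mul_mul_comm, hsq, one_mul]
  have h1 := h r hr
  simp only [Pi.mul_apply] at h1
  rw [← hmul, hdet, hdet] at h1
  have hpos := mul_pos (hA s' hs') (hA s' hs')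
  refine nonneg_of_mul_nonneg_left ?_ hpos
  linarith

theorem sum_alternating_choose_mul_pow {n k : ℕ} (hk : k + 1 < n) :
    ∑ j : Fin n, (-1 : ℝ) ^ (j : ℕ) * ((n - 1).choose j) * (j : ℝ) ^ k = 0 := by
  have h := congrFun (fwdDiff_iter_pow_eq_zero_of_lt (R := ℝ) (show k < n - 1 by omega)) 0
  rw [fwdDiff_iter_eq_sum_shift, show n - 1 + 1 = n by omega, Finset.sum_range] at h
  have h2 := congrArg (fun z => (-1 : ℝ) ^ (n - 1) * z) h
  simp only [Finset.mul_sum, Pi.zero_apply, mul_zero] at h2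
  rw [← h2]
  refine Finset.sum_congr rfl fun j _ => ?_
  have : (-1 : ℝ) ^ (n - 1) = (-1) ^ (n - 1 - j) * (-1) ^ (j : ℕ) := by
    rw [← pow_add]; congr 1; omega
  have h3 : (-1 : ℝ) ^ (n - 1 - j) * (-1) ^ (n - 1 - j) = 1 := by
    rw [← mul_pow]; simp
  rw [this]
  simp only [zsmul_eq_mul]
  push_cast
  simp only [zero_add, nsmul_eq_mul, mul_one]
  linear_combination (-(-1 : ℝ) ^ (j : ℕ) * ((n - 1).choose j) * (j : ℝ) ^ k) * h3

/-- A Vandermonde matrix with columns scaled by alternating binomial coefficients. -/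
def alternatingVandermonde (d n : ℕ) : Matrix (Fin d) (Fin n) ℝ :=
  Matrix.of fun i j => (j : ℝ) ^ (i : ℕ) * ((-1) ^ (j : ℕ) * ((n - 1).choose j))

theorem alternatingVandermonde_sign {d n : ℕ} {s : Fin d → Fin n} (hs : StrictMono s) :
    0 < (∏ i, (-1 : ℝ) ^ (s i : ℕ)) * ((alternatingVandermonde d n).submatrix id s).det := by
  have : (alternatingVandermonde d n).submatrix id s
      = ((Matrix.of fun (i : Fin d) (j : Fin n) => (j : ℝ) ^ (i : ℕ)).submatrix id s)
        * diagonal fun i => (-1) ^ (s i : ℕ) * ((n - 1).choose (s i) : ℝ) := by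
    ext i j
    simp [alternatingVandermonde, Matrix.mul_diagonal]
  rw [this, det_mul, det_diagonal, Finset.prod_mul_distrib]
  have h1 := allMinorsPos_vandermonde d n s hs
  have h2 : 0 < ∏ i, ((n - 1).choose (s i) : ℝ) :=
    Finset.prod_pos fun i _ => by
      exact_mod_cast Nat.choose_pos (by have := (s i).2; omega)
  have h3 : (∏ i, (-1 : ℝ) ^ (s i : ℕ)) * ∏ i, (-1 : ℝ) ^ (s i : ℕ) = 1 := by
    rw [← Finset.prod_mul_distrib]
    exact Finset.prod_eq_one fun i _ => by rw [← mul_pow]; simp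
  have h4 := mul_pos h1 h2
  rwa [mul_left_comm, ← mul_assoc _ _ (∏ i, ((n - 1).choose (s i) : ℝ)), h3, one_mul]

theorem alternatingVandermonde_transverse {c d n : ℕ} (hn : d + c = n) :
    TransverseToScalings (alternatingVandermonde d n)
      (Matrix.of fun (i : Fin c) (j : Fin n) => (j : ℝ) ^ (i : ℕ)) := by
  set A := (Matrix.of fun (i : Fin c) (j : Fin n) => (j : ℝ) ^ (i : ℕ)) with hAdef
  intro r hr w a h
  have horth : (w ᵥ* alternatingVandermonde d n) ⬝ᵥ (a ᵥ* A) = 0 := by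
    rw [← Matrix.mulVec_transpose A, Matrix.dotProduct_mulVec, Matrix.vecMul_vecMul]
    have : alternatingVandermonde d n * Aᵀ = 0 := by
      ext i k
      have := sum_alternating_choose_mul_pow (n := n) (k := i + k) (by omega)
      rw [Matrix.mul_apply, Matrix.zero_apply, ← this]
      refine Finset.sum_congr rfl fun j _ => ?_
      simp [hAdef, alternatingVandermonde, pow_add]
      ring
    simp [this]
  have haA : a ᵥ* A = 0 := by
    rw [h, ← Matrix.vecMul_vecMul] at horth
    simp only [dotProduct, Matrix.vecMul_diagonal] at horth
    have hz := (Finset.sum_eq_zero_iff_of_nonneg fun j _ => by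
      have := (hr j).le
      have := mul_self_nonneg ((a ᵥ* A) j)
      nlinarith).1 horth
    ext j
    have := hz j (Finset.mem_univ j)
    simpa [(hr j).ne'] using this
  have ha : a = 0 := (allMinorsPos_vandermonde c n).eq_zero_of_vecMul_eq_zero (by omega) haA
  refine ⟨?_, ha⟩
  subst ha
  rw [Matrix.zero_vecMul] at h
  refine eq_zero_of_vecMul_eq_zero_of_det_submatrix_ne_zero
    (s := Fin.castLE (by omega : d ≤ n)) ?_ h
  exact right_ne_zero_of_mul (alternatingVandermonde_sign (Fin.strictMono_castLE _)).ne'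
open Topology Filter in
theorem PosHyperbolic.eq_zero_of_hasDerivAt {c n : ℕ} (hcn : c ≤ n) {X : Set (Fin n → ℂ)}
    (hX : PosHyperbolic c X) {A : Matrix (Fin c) (Fin n) ℝ} (hA : AllMinorsPos A)
    {γ : ℝ → Fin n → ℂ} (hγ : ∀ᶠ t in 𝓝 0, γ t ∈ X) (h0 : imPart (γ 0) = 0) {a : Fin c → ℝ}
    (hv : HasDerivAt (fun t => imPart (γ t)) (a ᵥ* A) 0) : a ᵥ* A = 0 := by
  by_contra hne
  have ha : a ≠ 0 := by
    rintro rfl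
    exact hne (Matrix.zero_vecMul A)
  have haa : a ⬝ᵥ a ≠ 0 := by simpa using ha
  let u : ℝ → Fin n → ℝ := fun t => t⁻¹ • imPart (γ t)
  have hu : Tendsto u (𝓝[≠] 0) (𝓝 (a ᵥ* A)) := by
    have := hasDerivAt_iff_tendsto_slope.1 hv
    refine this.congr fun t => ?_
    simp [slope, u, h0]
  let B : ℝ → Matrix (Fin c) (Fin n) ℝ := fun t =>
    A + vecMulVec ((a ⬝ᵥ a)⁻¹ • a) (u t - a ᵥ* A)
  have hB : Tendsto B (𝓝[≠] 0) (𝓝 A) := by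
    have hc : Continuous fun v : Fin n → ℝ => A + vecMulVec ((a ⬝ᵥ a)⁻¹ • a) (v - a ᵥ* A) := by
      refine continuous_matrix fun i j => ?_
      simp only [Matrix.add_apply, vecMulVec_apply, Pi.sub_apply]
      fun_prop
    have h1 := (hc.tendsto (a ᵥ* A)).comp hu
    have h2 : A + vecMulVec ((a ⬝ᵥ a)⁻¹ • a) (a ᵥ* A - a ᵥ* A) = A := by
      ext i j
      simp [vecMulVec_apply]
    rwa [h2] at h1
  have hBpos : ∀ᶠ t in 𝓝[≠] 0, AllMinorsPos (B t) := by
    refine eventually_all.2 fun s => ?_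
    by_cases hs : StrictMono s
    · have hc : Continuous fun M : Matrix (Fin c) (Fin n) ℝ => (M.submatrix id s).det :=
        (continuous_id.matrix_submatrix id s).matrix_det
      filter_upwards [((hc.tendsto A).comp hB).eventually (lt_mem_nhds (hA s hs))] with t ht _
      exact ht
    · exact Eventually.of_forall fun t h => absurd h hs
  have hBu : ∀ t, a ᵥ* B t = u t := by
    intro t
    rw [Matrix.vecMul_add, vecMul_vecMulVec, dotProduct_smul, smul_eq_mul,
      inv_mul_cancel₀ haa, one_smul, add_sub_cancel]
  obtain ⟨t, htB, htu, htX, ht0⟩ := (hBpos.and ((hu.eventually_ne hne).and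
    ((hγ.filter_mono nhdsWithin_le_nhds).and self_mem_nhdsWithin))).exists
  have ht0 : t ≠ 0 := ht0
  have him : imPart (γ t) = t • u t := by
    simp [u, smul_smul, ht0]
  refine hX _ (htB.isPositiveSubspace hcn) _ htX ⟨?_, ?_⟩
  · rw [him, ← hBu]
    exact Submodule.smul_mem _ _ (vecMul_mem_span_rows a _)
  · rw [him]
    exact smul_ne_zero ht0 htu

/-- The coordinatewise imaginary part as a continuous real-linear map. -/
noncomputable def imPartCLM (n : ℕ) : (Fin n → ℂ) →L[ℝ] (Fin n → ℝ) :=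
  ContinuousLinearMap.pi fun i => Complex.imCLM.comp (ContinuousLinearMap.proj i)

open Topology Filter in
theorem PosHyperbolic.exists_real_jacobian {c d n : ℕ} (hcn : c ≤ n) {X : Set (Fin n → ℂ)}
    (hX : PosHyperbolic c X) {A₀ : Matrix (Fin c) (Fin n) ℝ} (hA₀ : AllMinorsPos A₀)
    {T : Matrix (Fin d) (Fin n) ℝ} (hT : ∀ y, T *ᵥ y = 0 → ∃ a, y = a ᵥ* A₀)
    {φ : (Fin d → ℂ) → Fin n → ℂ} {r₀ : Fin d → ℝ}
    (hφ : DifferentiableAt ℂ φ fun i => (r₀ i : ℂ))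
    (hφX : ∀ᶠ s in 𝓝 (fun i => (r₀ i : ℂ)), φ s ∈ X ∧ ∀ i, ∑ j, (T i j : ℂ) * φ s j = s i) :
    ∃ J : Matrix (Fin d) (Fin n) ℝ,
      (∀ (w : Fin d → ℝ) (j : Fin n),
        fderiv ℂ φ (fun i => (r₀ i : ℂ)) (fun i => (w i : ℂ)) j = ((w ᵥ* J) j : ℝ)) ∧
      (∀ w, T *ᵥ (w ᵥ* J) = w) ∧
      ∀ A : Matrix (Fin c) (Fin n) ℝ, AllMinorsPos A → ∀ (w : Fin d → ℝ) (a : Fin c → ℝ),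
        w ᵥ* J = a ᵥ* A → w = 0 ∧ a = 0 := by
  set s₀ : Fin d → ℂ := fun i => (r₀ i : ℂ) with hs₀
  set Φ := fderiv ℂ φ s₀ with hΦ
  let ofR (w : Fin d → ℝ) : Fin d → ℂ := fun i => (w i : ℂ)
  have hline : ∀ W : Fin d → ℂ, HasDerivAt (fun t : ℝ => s₀ + (t : ℂ) • W) W 0 := by
    intro W
    have := ((Complex.ofRealCLM.hasDerivAt (x := 0)).smul_const W).const_add s₀
    simpa using this
  have hderiv : ∀ W : Fin d → ℂ, HasDerivAt (fun t : ℝ => φ (s₀ + (t : ℂ) • W)) (Φ W) 0 := by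
    intro W
    have h1 : HasFDerivAt φ (Φ.restrictScalars ℝ) (s₀ + ((0 : ℝ) : ℂ) • W) := by
      simpa using hφ.hasFDerivAt.restrictScalars ℝ
    exact h1.comp_hasDerivAt (0 : ℝ) (hline W)
  have hnear : ∀ W : Fin d → ℂ, Tendsto (fun t : ℝ => s₀ + (t : ℂ) • W) (𝓝 0) (𝓝 s₀) := by
    intro W
    simpa using (hline W).continuousAt.tendsto
  have hreal : ∀ᶠ s in 𝓝 s₀, imPart s = 0 → imPart (φ s) = 0 := by
    filter_upwards [hφX] with s ⟨hsX, hs⟩ him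
    by_contra hne
    obtain ⟨a, ha⟩ := hT (imPart (φ s)) (by
      ext i
      have h1 := congrArg Complex.im (hs i)
      rw [Complex.im_sum] at h1
      simp only [Complex.im_ofReal_mul] at h1
      exact h1.trans (congrFun him i))
    exact hX _ (hA₀.isPositiveSubspace hcn) _ hsX ⟨ha ▸ vecMul_mem_span_rows a A₀, hne⟩
  have him : ∀ W : Fin d → ℂ,
      HasDerivAt (fun t : ℝ => imPart (φ (s₀ + (t : ℂ) • W))) (imPart (Φ W)) 0 := fun W =>
    (imPartCLM n).hasFDerivAt.comp_hasDerivAt (0 : ℝ) (hderiv W)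
  have hΦreal : ∀ w, imPart (Φ (ofR w)) = 0 := by
    intro w
    refine (him (ofR w)).unique ((hasDerivAt_const (0 : ℝ) (0 : Fin n → ℝ)).congr_of_eventuallyEq ?_)
    filter_upwards [(hnear (ofR w)).eventually hreal] with t ht
    refine ht ?_
    ext i
    simp [imPart, ofR, s₀]
  let J : Matrix (Fin d) (Fin n) ℝ := Matrix.of fun i j => (Φ (ofR (Pi.single i 1)) j).re
  have hJ : ∀ (w : Fin d → ℝ) (j : Fin n), Φ (ofR w) j = ((w ᵥ* J) j : ℝ) := by
    intro w j
    have h1 : ofR w = ∑ i, (w i : ℂ) • ofR (Pi.single i 1) := by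
      ext k
      simp [ofR, Finset.sum_apply, Pi.single_apply, apply_ite (Complex.ofReal)]
    have h2 : ∀ i, Φ (ofR (Pi.single i 1)) j = (J i j : ℂ) := fun i =>
      Complex.ext (by simp [J]) (by simpa [imPart] using congrFun (hΦreal (Pi.single i 1)) j)
    rw [h1, map_sum, Finset.sum_apply]
    simp [Matrix.vecMul, dotProduct, h2]
  have hTJ : ∀ w, T *ᵥ (w ᵥ* J) = w := by
    intro w
    ext i
    have h1 : HasDerivAt (fun t : ℝ => ∑ j, (T i j : ℂ) * φ (s₀ + (t : ℂ) • ofR w) j)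
        (∑ j, (T i j : ℂ) * Φ (ofR w) j) 0 :=
      HasDerivAt.fun_sum fun j _ => (hasDerivAt_pi.1 (hderiv (ofR w)) j).const_mul _
    have h2 : HasDerivAt (fun t : ℝ => ∑ j, (T i j : ℂ) * φ (s₀ + (t : ℂ) • ofR w) j)
        (ofR w i) 0 := by
      refine (hasDerivAt_pi.1 (hline (ofR w)) i).congr_of_eventuallyEq ?_
      filter_upwards [(hnear (ofR w)).eventually hφX] with t ht
      exact ht.2 i
    have h3 := h1.unique h2
    simp only [hJ, ofR] at h3
    exact_mod_cast h3
  refine ⟨J, hJ, hTJ, fun A hA w a hwa => ?_⟩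
  have hI : imPart (Φ (Complex.I • ofR w)) = a ᵥ* A := by
    rw [← hwa, map_smul]
    ext j
    simp [imPart, hJ]
  have hzero : a ᵥ* A = 0 := by
    have h1 := him (Complex.I • ofR w)
    rw [hI] at h1
    refine hX.eq_zero_of_hasDerivAt hcn hA
      (((hnear _).eventually hφX).mono fun t ht => ht.1) ?_ h1
    have h2 := hreal.self_of_nhds (by ext i; simp [imPart, s₀])
    simpa using h2
  refine ⟨?_, hA.eq_zero_of_vecMul_eq_zero hcn hzero⟩
  rw [← hTJ w, hwa, hzero, Matrix.mulVec_zero]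

/-- A prime ideal has a generic point in a field generated by its coordinates. -/
theorem Ideal.IsPrime.exists_generic_point {n : ℕ} {P : Ideal (MvPolynomial (Fin n) ℂ)}
    (hP : P.IsPrime) :
    ∃ (K : Type) (_ : Field K) (_ : Algebra ℂ K) (x : Fin n → K),
      IntermediateField.adjoin ℂ (Set.range x) = ⊤ ∧
      ∀ p, MvPolynomial.aeval x p = 0 ↔ p ∈ P := by
  let R := MvPolynomial (Fin n) ℂ ⧸ P
  let K := FractionRing R
  let ι : MvPolynomial (Fin n) ℂ →ₐ[ℂ] K := (Algebra.algHom ℂ R K).comp (Ideal.Quotient.mkₐ ℂ P)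
  let x : Fin n → K := fun i => ι (MvPolynomial.X i)
  have hx : MvPolynomial.aeval x = ι := (MvPolynomial.aeval_unique ι).symm
  refine ⟨K, inferInstance, inferInstance, x, ?_, fun p => ?_⟩
  · have hmem : ∀ r : R, algebraMap R K r ∈ IntermediateField.adjoin ℂ (Set.range x) := by
      intro r
      obtain ⟨p, rfl⟩ := Ideal.Quotient.mk_surjective r
      change ι p ∈ _
      rw [← hx]
      refine IntermediateField.algebra_adjoin_le_adjoin _ _ ?_
      rw [Algebra.adjoin_range_eq_range_aeval]
      exact ⟨p, rfl⟩
    rw [eq_top_iff]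
    intro z _
    obtain ⟨a, b, _, rfl⟩ := IsFractionRing.div_surjective (A := R) z
    exact div_mem (hmem a) (hmem b)
  · rw [hx]
    change algebraMap R K (Ideal.Quotient.mk P p) = 0 ↔ p ∈ P
    rw [IsFractionRing.to_map_eq_zero_iff, Ideal.Quotient.eq_zero_iff_mem]

theorem algIndep_iff_algebraicIndepOn {n : ℕ} {P : Ideal (MvPolynomial (Fin n) ℂ)} {K : Type}
    [Field K] [Algebra ℂ K] {x : Fin n → K} (hx : ∀ p, MvPolynomial.aeval x p = 0 ↔ p ∈ P)
    (S : Set (Fin n)) : AlgIndep P S ↔ AlgebraicIndepOn ℂ x S := by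
  change _ ↔ AlgebraicIndependent ℂ (x ∘ ((↑) : S → Fin n))
  rw [algebraicIndependent_comp_subtype]
  refine forall_congr' fun p => ?_
  rw [hx, MvPolynomial.mem_supported]
  tauto

theorem isTranscendenceBasis_of_maximal {n : ℕ} {K : Type} [Field K] [Algebra ℂ K]
    {x : Fin n → K} (hx : IntermediateField.adjoin ℂ (Set.range x) = ⊤) {S : Set (Fin n)}
    (hS : Maximal (AlgebraicIndepOn ℂ x) S) : IsTranscendenceBasis ℂ fun i : S => x i := by
  rw [hS.prop.isTranscendenceBasis_iff_isAlgebraic]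
  refine ⟨fun z => ?_⟩
  have hz : z ∈ IntermediateField.adjoin ℂ (Set.range x) := hx ▸ trivial
  induction hz using IntermediateField.adjoin_induction with
  | mem y hy =>
    obtain ⟨j, rfl⟩ := hy
    by_cases hj : j ∈ S
    · exact isAlgebraic_algebraMap (⟨x j, Algebra.subset_adjoin ⟨⟨j, hj⟩, rfl⟩⟩ :
        Algebra.adjoin ℂ (Set.range fun i : S => x i))
    · by_contra htr
      have himg : (Set.range fun i : S => x i) = x '' S := by
        ext; simp
      rw [himg] at htr
      have := (AlgebraicIndepOn.insert_iff hj).2 ⟨hS.prop, htr⟩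
      exact hj (hS.le_of_ge this (Set.subset_insert j S) (Set.mem_insert j S))
  | algebraMap a =>
    exact isAlgebraic_algebraMap (algebraMap ℂ (Algebra.adjoin ℂ (Set.range fun i : S => x i)) a)
  | add a b _ _ ha hb => exact ha.add hb
  | mul a b _ _ ha hb => exact ha.mul hb
  | inv a _ ha => exact ha.inv

theorem MvPolynomial.totalDegree_pderiv_lt {σ R : Type*} [CommSemiring R] {p : MvPolynomial σ R}
    {j : σ} (hp : pderiv j p ≠ 0) : (pderiv j p).totalDegree < p.totalDegree := by
  classical
  obtain ⟨m, hm, hmdeg⟩ := Finset.exists_mem_eq_sup (pderiv j p).support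
    (MvPolynomial.support_nonempty.2 hp) fun s => s.sum fun _ e => e
  rw [MvPolynomial.totalDegree, hmdeg]
  have hm' : m + Finsupp.single j 1 ∈ p.support := by
    rw [MvPolynomial.mem_support_iff, MvPolynomial.coeff_pderiv] at hm
    rw [MvPolynomial.mem_support_iff]
    exact left_ne_zero_of_mul hm
  have := MvPolynomial.le_totalDegree hm'
  rw [Finsupp.sum_add_index' (by simp) (by simp), Finsupp.sum_single_index rfl] at this
  omega

theorem MvPolynomial.vars_pderiv_subset {σ R : Type*} [CommSemiring R] (p : MvPolynomial σ R)
    (j : σ) : (pderiv j p).vars ⊆ p.vars := by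
  classical
  intro i hi
  rw [MvPolynomial.mem_vars_iff_mem_support] at hi ⊢
  obtain ⟨m, hm, him⟩ := hi
  refine ⟨m + Finsupp.single j 1, ?_, ?_⟩
  · rw [MvPolynomial.mem_support_iff, MvPolynomial.coeff_pderiv] at hm
    rw [MvPolynomial.mem_support_iff]
    exact left_ne_zero_of_mul hm
  · rw [Finsupp.mem_support_iff] at him ⊢
    simp only [Finsupp.add_apply]
    omega

theorem MvPolynomial.pderiv_ne_zero_of_mem_vars {σ R : Type*} [CommRing R] [IsDomain R]
    [CharZero R] {p : MvPolynomial σ R} {j : σ} (hj : j ∈ p.vars) : pderiv j p ≠ 0 := by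
  classical
  rw [MvPolynomial.mem_vars_iff_mem_support] at hj
  obtain ⟨m, hm, hjm⟩ := hj
  intro h
  have h1 := MvPolynomial.coeff_pderiv p (i := j) (m - Finsupp.single j 1)
  have hle : Finsupp.single j 1 ≤ m := by
    rw [Finsupp.single_le_iff, Nat.one_le_iff_ne_zero]
    exact Finsupp.mem_support_iff.1 hjm
  rw [h, MvPolynomial.coeff_zero, tsub_add_cancel_of_le hle, eq_comm, mul_eq_zero] at h1
  rcases h1 with h1 | h1
  · exact MvPolynomial.mem_support_iff.1 hm h1
  · exact Nat.cast_add_one_ne_zero _ h1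

theorem exists_mem_pderiv_notMem_of_not_algIndep {n : ℕ} {P : Ideal (MvPolynomial (Fin n) ℂ)}
    (hP : P.IsPrime) {S : Set (Fin n)} (hS : ¬ AlgIndep P S) :
    ∃ p ∈ P, p ≠ 0 ∧ (p.vars : Set (Fin n)) ⊆ S ∧ p.vars.Nonempty ∧
      ∀ j ∈ p.vars, MvPolynomial.pderiv j p ∉ P := by
  let N := {p : MvPolynomial (Fin n) ℂ | p ∈ P ∧ p ≠ 0 ∧ (p.vars : Set (Fin n)) ⊆ S}
  have hN : N.Nonempty := by
    simp only [AlgIndep] at hS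
    push Not at hS
    obtain ⟨p, hp, hpS, hp0⟩ := hS
    exact ⟨p, hp, hp0, hpS⟩
  obtain ⟨p, ⟨hp, hp0, hpS⟩, hmin⟩ :
      ∃ p ∈ N, ∀ q ∈ N, p.totalDegree ≤ q.totalDegree := by
    obtain ⟨p, hp, h⟩ := (measure MvPolynomial.totalDegree).wf.has_min N hN
    exact ⟨p, hp, fun q hq => not_lt.1 (h q hq)⟩
  refine ⟨p, hp, hp0, hpS, ?_, fun j hj hjP => ?_⟩
  · rw [Finset.nonempty_iff_ne_empty]
    intro hv
    obtain ⟨a, rfl⟩ : ∃ a, p = MvPolynomial.C a := by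
      have : p ∈ MvPolynomial.supported ℂ (∅ : Set (Fin n)) := by
        rw [MvPolynomial.mem_supported, hv]; simp
      rw [MvPolynomial.supported_empty, Algebra.mem_bot] at this
      obtain ⟨a, ha⟩ := this
      exact ⟨a, ha.symm⟩
    have ha : a ≠ 0 := fun h => hp0 (by simp [h])
    refine hP.ne_top (Ideal.eq_top_of_isUnit_mem _ hp ?_)
    exact (isUnit_iff_ne_zero.2 ha).map MvPolynomial.C
  · have h0 := MvPolynomial.pderiv_ne_zero_of_mem_vars hj
    have h1 := hmin _ ⟨hjP, h0, (Finset.coe_subset.2 (p.vars_pderiv_subset j)).trans hpS⟩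
    exact absurd (MvPolynomial.totalDegree_pderiv_lt h0) (not_lt.2 h1)

/-- Off a proper closed subset of `V(P)`, every dependent set of coordinates has a witness with
nonvanishing partial derivatives. -/
theorem exists_notMem_forall_not_algIndep {n : ℕ} {P : Ideal (MvPolynomial (Fin n) ℂ)}
    (hP : P.IsPrime) :
    ∃ Q ∉ P, ∀ z, MvPolynomial.eval z Q ≠ 0 → ∀ S : Set (Fin n), ¬ AlgIndep P S →
      ∃ p ∈ P, p ≠ 0 ∧ (p.vars : Set (Fin n)) ⊆ S ∧ p.vars.Nonempty ∧
        ∀ j ∈ p.vars, MvPolynomial.eval z (MvPolynomial.pderiv j p) ≠ 0 := by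
  classical
  have h : ∀ S : Set (Fin n), ∃ p : MvPolynomial (Fin n) ℂ, (∀ j ∈ p.vars, p.pderiv j ∉ P) ∧
      (¬ AlgIndep P S → p ∈ P ∧ p ≠ 0 ∧ (p.vars : Set (Fin n)) ⊆ S ∧ p.vars.Nonempty) := by
    intro S
    by_cases hS : AlgIndep P S
    · exact ⟨0, by simp, fun h => absurd hS h⟩
    · obtain ⟨p, h1, h2, h3, h4, h5⟩ := exists_mem_pderiv_notMem_of_not_algIndep hP hS
      exact ⟨p, h5, fun _ => ⟨h1, h2, h3, h4⟩⟩
  choose p hp hpS using h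
  refine ⟨∏ S, ∏ j ∈ (p S).vars, (p S).pderiv j, ?_, fun z hz S hS => ?_⟩
  · intro hmem
    obtain ⟨S, _, hS⟩ := (hP.prod_mem_iff).1 hmem
    obtain ⟨j, hj, hjP⟩ := (hP.prod_mem_iff).1 hS
    exact hp S j hj hjP
  · obtain ⟨h1, h2, h3, h4⟩ := hpS S hS
    refine ⟨p S, h1, h2, h3, h4, fun j hj => ?_⟩
    rw [map_prod, Finset.prod_ne_zero_iff] at hz
    have := hz S (Finset.mem_univ S)
    rw [map_prod, Finset.prod_ne_zero_iff] at this
    exact this j hj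

theorem AlgebraicIndependent.update_sub_smul {K ι : Type} [DecidableEq ι] [Field K] [Algebra ℂ K]
    {z : ι → K} (hz : AlgebraicIndependent ℂ z) (i : ι) (m : K) :
    ∃ r : ℝ, 0 < r ∧ AlgebraicIndependent ℂ (Function.update z i (z i - (r : ℂ) • m)) := by
  have himg : ∀ v, Function.update z i v '' {i}ᶜ = z '' {i}ᶜ := fun v =>
    Set.image_congr fun j hj => Function.update_of_ne hj _ _
  have hrest : ∀ v, (fun j : {j // j ≠ i} => Function.update z i v j)
      = fun j : {j // j ≠ i} => z j := fun v =>
    funext fun j => Function.update_of_ne j.2 _ _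
  obtain ⟨h1, h2⟩ := (AlgebraicIndependent.iff_transcendental_adjoin_image i).1 hz
  by_contra! hne
  have halg : ∀ r : ℝ, 0 < r → IsAlgebraic (Algebra.adjoin ℂ (z '' {i}ᶜ)) (z i - (r : ℂ) • m) := by
    intro r hr
    by_contra htr
    refine hne r hr ((AlgebraicIndependent.iff_transcendental_adjoin_image i).2 ⟨?_, ?_⟩)
    · rw [hrest]; exact h1
    · rw [himg, Function.update_self]; exact htr
  refine h2 ?_
  have h3 := halg 1 one_pos
  have h4 := (h3.add h3).sub (halg 2 two_pos)
  convert h4 using 1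
  simp only [Complex.ofReal_one, one_smul, Complex.ofReal_ofNat, two_smul]
  ring

theorem AlgebraicIndependent.exists_sub_smul {K ι : Type} [Finite ι] [Field K] [Algebra ℂ K]
    {z : ι → K} (hz : AlgebraicIndependent ℂ z) (m : ι → K) :
    ∃ r : ι → ℝ, (∀ i, 0 < r i) ∧ AlgebraicIndependent ℂ fun i => z i - (r i : ℂ) • m i := by
  classical
  have := Fintype.ofFinite ι
  have key : ∀ s : Finset ι, ∃ r : ι → ℝ, (∀ i, 0 < r i) ∧
      AlgebraicIndependent ℂ fun i => if i ∈ s then z i - (r i : ℂ) • m i else z i := by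
    intro s
    induction s using Finset.induction_on with
    | empty => exact ⟨1, fun _ => one_pos, by simpa using hz⟩
    | insert i s hi ih =>
      obtain ⟨r, hr, h⟩ := ih
      obtain ⟨a, ha, h'⟩ := h.update_sub_smul i (m i)
      refine ⟨Function.update r i a, fun j => ?_, ?_⟩
      · by_cases hj : j = i
        · subst hj; simpa using ha
        · simpa [hj] using hr j
      · convert h' using 1
        ext j
        by_cases hj : j = i
        · subst hj; simp [hi]
        · simp [hj]
  simpa using key Finset.univ
theorem exists_linear_forms {c d n : ℕ} (hn : d + c = n) {K : Type} [Field K] [Algebra ℂ K]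
    {x : Fin n → K} {s : Fin d → Fin n} (hs : StrictMono s)
    (hx : AlgebraicIndependent ℂ fun i => x (s i)) :
    ∃ (T : Matrix (Fin d) (Fin n) ℝ) (A₀ : Matrix (Fin c) (Fin n) ℝ), AllMinorsPos A₀ ∧
      (∀ y, T *ᵥ y = 0 → ∃ a, y = a ᵥ* A₀) ∧
      AlgebraicIndependent ℂ fun i => ∑ j, (T i j : ℂ) • x j := by
  obtain ⟨s', hs', π, hπl, hπr⟩ := exists_strictMono_complement hn hs
  set A : Matrix (Fin c) (Fin n) ℝ := Matrix.of fun i j => (j : ℝ) ^ (i : ℕ)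
  have hA : AllMinorsPos A := allMinorsPos_vandermonde c n
  let M := A.submatrix id s'
  have hM : IsUnit M.det := isUnit_iff_ne_zero.2 (hA s' hs').ne'
  let A' := M⁻¹ * A
  have hA' : ∀ a b, A' a (s' b) = (1 : Matrix (Fin c) (Fin c) ℝ) a b := by
    intro a b
    rw [← Matrix.nonsing_inv_mul M hM]
    rfl
  obtain ⟨r, hr, hind⟩ := hx.exists_sub_smul fun i => ∑ a, (A' a (s i) : ℂ) • x (s' a)
  have hsl : ∀ i, π.symm (s i) = Sum.inl i := fun i => by simp [← hπl]
  have hsr : ∀ i, π.symm (s' i) = Sum.inr i := fun i => by simp [← hπr]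
  let T : Matrix (Fin d) (Fin n) ℝ := Matrix.of fun i j =>
    Sum.elim (fun k => if i = k then 1 else 0) (fun a => -(r i * A' a (s i))) (π.symm j)
  let r' : Fin n → ℝ := fun j => Sum.elim r (fun _ => 1) (π.symm j)
  have hr' : ∀ j, 0 < r' j := by
    intro j
    rcases h : π.symm j with i | i <;> simp [r', h, hr]
  refine ⟨T, A * diagonal r', hA.mul_diagonal hr', fun y hy => ?_, ?_⟩
  · have hys : ∀ i, y (s i) = r i * ∑ a, A' a (s i) * y (s' a) := by
      intro i
      have h1 := congrFun hy i
      simp only [Matrix.mulVec, dotProduct, Pi.zero_apply] at h1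
      rw [← Equiv.sum_comp π, Fintype.sum_sum_type] at h1
      simp only [hπl, hπr, T, Matrix.of_apply, hsl, hsr, Sum.elim_inl, Sum.elim_inr, ite_mul,
        one_mul, zero_mul, Finset.sum_ite_eq, Finset.mem_univ, if_true, neg_mul,
        Finset.sum_neg_distrib, mul_assoc, ← Finset.mul_sum] at h1
      linarith
    refine ⟨(y ∘ s') ᵥ* M⁻¹, ?_⟩
    rw [← Matrix.vecMul_vecMul, Matrix.vecMul_vecMul _ M⁻¹ A]
    ext j
    rw [Matrix.vecMul_diagonal]
    change y j = (∑ a, y (s' a) * A' a j) * r' j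
    obtain ⟨k | k, rfl⟩ := π.surjective j
    · rw [hπl, hys]
      simp only [r', hsl, Sum.elim_inl]
      rw [mul_comm]
      simp only [mul_comm]
    · rw [hπr]
      simp [r', hsr, hA', Matrix.one_apply]
  · convert hind using 1
    ext i
    rw [← Equiv.sum_comp π, Fintype.sum_sum_type]
    simp only [hπl, hπr, T, Matrix.of_apply, hsl, hsr, Sum.elim_inl, Sum.elim_inr]
    simp [Finset.smul_sum, smul_smul, sub_eq_add_neg, apply_ite (Complex.ofReal), ite_smul,
      -Complex.coe_smul]

theorem MvPolynomial.hasFDerivAt_eval {m n : ℕ} (p : MvPolynomial (Fin n) ℂ)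
    {φ : (Fin m → ℂ) → Fin n → ℂ} {s₀ : Fin m → ℂ} {Φ : (Fin m → ℂ) →L[ℂ] Fin n → ℂ}
    (hφ : HasFDerivAt φ Φ s₀) :
    HasFDerivAt (fun s => MvPolynomial.eval (φ s) p)
      (∑ j, MvPolynomial.eval (φ s₀) (pderiv j p) • (ContinuousLinearMap.proj j).comp Φ) s₀ := by
  have hj : ∀ j, HasFDerivAt (fun s => φ s j) ((ContinuousLinearMap.proj j).comp Φ) s₀ :=
    fun j => hasFDerivAt_pi'.1 hφ j
  induction p using MvPolynomial.induction_on with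
  | C a =>
    simp only [MvPolynomial.eval_C]
    refine (hasFDerivAt_const (𝕜 := ℂ) a s₀).congr_fderiv ?_
    ext v
    simp
  | add p q hp hq =>
    simp only [map_add]
    refine (hp.fun_add hq).congr_fderiv ?_
    ext v
    simp [add_mul, Finset.sum_add_distrib]
  | mul_X p i hp =>
    simp only [map_mul, MvPolynomial.eval_X]
    refine (hp.mul (hj i)).congr_fderiv ?_
    ext v
    simp [MvPolynomial.pderiv_X, add_mul, Finset.sum_add_distrib, Finset.mul_sum, Pi.single_apply,
      mul_assoc, apply_ite (MvPolynomial.eval (φ s₀))]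

theorem linearIndependent_transpose_iff_algIndep {d n : ℕ} {P : Ideal (MvPolynomial (Fin n) ℂ)}
    {z : Fin n → ℂ} {J : Matrix (Fin d) (Fin n) ℝ} (hJ : ∀ w, w ᵥ* J = 0 → w = 0)
    (hrel : ∀ p ∈ P, ∀ w : Fin d → ℝ,
      ∑ j, MvPolynomial.eval z (MvPolynomial.pderiv j p) * ((w ᵥ* J) j : ℝ) = 0)
    (hdep : ∀ S : Set (Fin n), ¬ AlgIndep P S →
      ∃ p ∈ P, p ≠ 0 ∧ (p.vars : Set (Fin n)) ⊆ S ∧ p.vars.Nonempty ∧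
        ∀ j ∈ p.vars, MvPolynomial.eval z (MvPolynomial.pderiv j p) ≠ 0)
    (hmax : ∀ S : Finset (Fin n), AlgIndep P ↑S → S.card ≤ d) (S : Set (Fin n)) :
    LinearIndependent ℝ (fun i : S => Jᵀ i.1) ↔ AlgIndep P S := by
  classical
  constructor
  · intro hlin
    by_contra hS
    obtain ⟨p, hp, -, hpS, ⟨j, hj⟩, hne⟩ := hdep S hS
    let g : Fin n → ℂ := fun j => MvPolynomial.eval z (MvPolynomial.pderiv j p)
    have hg0 : ∀ j ∉ p.vars, g j = 0 := by
      intro j hj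
      simp [g, MvPolynomial.pderiv_eq_zero_of_notMem_vars hj]
    have hreal : ∀ L : ℂ →ₗ[ℝ] ℝ, L (g j) = 0 := by
      intro L
      have h1 : ∑ k : S, L (g k) • Jᵀ k.1 = 0 := by
        rw [Finset.sum_set_coe S (f := fun k => L (g k) • Jᵀ k), Finset.sum_subset
          (Finset.subset_univ _) (fun k _ hk => by
            rw [hg0 k fun h => hk (Set.mem_toFinset.2 (hpS h)), map_zero, zero_smul])]
        ext i
        have h2 := congrArg L (hrel p hp (Pi.single i 1))
        rw [map_sum, map_zero] at h2
        rw [Finset.sum_apply, Pi.zero_apply, ← h2]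
        refine Finset.sum_congr rfl fun k _ => ?_
        rw [mul_comm, ← Complex.real_smul, map_smul]
        simp [mul_comm, g]
      exact Fintype.linearIndependent_iff.1 hlin _ h1 ⟨j, hpS hj⟩
    exact hne j hj (Complex.ext (hreal Complex.reLm) (hreal Complex.imLm))
  · intro hS
    obtain ⟨S', hSS', hS'⟩ := (Set.toFinite {S : Set (Fin n) | AlgIndep P S}).exists_le_maximal hS
    have hinj : ∀ w : Fin d → ℝ, (∀ j ∈ S', (w ᵥ* J) j = 0) → w = 0 := by
      intro w hw
      refine hJ w (funext fun j => ?_)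
      by_cases hj : j ∈ S'
      · exact hw j hj
      have hins : ¬ AlgIndep P (insert j S') := fun h =>
        hj (hS'.le_of_ge h (Set.subset_insert j S') (Set.mem_insert j S'))
      obtain ⟨p, hp, hp0, hpS, -, hne⟩ := hdep _ hins
      have hjp : j ∈ p.vars := by
        by_contra hjp
        refine hp0 (hS'.prop p hp fun k hk => (hpS hk).resolve_left ?_)
        rintro rfl
        exact hjp hk
      have h1 := hrel p hp w
      rw [Finset.sum_eq_single j] at h1
      · simpa [hne j hjp] using h1
      · intro k _ hkj
        by_cases hk : k ∈ p.vars
        · rw [hw k ((hpS hk).resolve_left hkj)]; simp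
        · rw [MvPolynomial.pderiv_eq_zero_of_notMem_vars hk]; simp
      · simp
    have hrows : LinearIndependent ℝ (J.submatrix id ((↑) : S' → Fin n)).row := by
      rw [← Matrix.vecMul_injective_iff]
      intro a b hab
      rw [← sub_eq_zero]
      refine hinj _ fun j hj => ?_
      rw [Matrix.sub_vecMul, Pi.sub_apply, sub_eq_zero]
      exact congrFun hab ⟨j, hj⟩
    have hrank := hrows.rank_matrix
    have hcard : Fintype.card S' ≤ d := by
      rw [← Set.toFinset_card]
      exact hmax _ (by rw [Set.coe_toFinset]; exact hS'.prop)
    have hcols : LinearIndependent ℝ fun i : S' => Jᵀ i.1 := by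
      rw [linearIndependent_iff_card_le_finrank_span]
      refine hcard.trans ?_
      rw [Matrix.rank_eq_finrank_span_cols, Fintype.card_fin] at hrank
      exact hrank.ge
    exact hcols.comp (Set.inclusion hSS') (Set.inclusion_injective hSS')

theorem linearIndependent_transpose_scale_iff {d n : ℕ} (J : Matrix (Fin d) (Fin n) ℝ)
    {u : Fin d → ℝ} {v : Fin n → ℝ} (hu : ∀ i, u i ≠ 0) (hv : ∀ j, v j ≠ 0) (S : Set (Fin n)) :
    LinearIndependent ℝ (fun i : S => (diagonal u * J * diagonal v)ᵀ i.1) ↔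
      LinearIndependent ℝ (fun i : S => Jᵀ i.1) := by
  have hinj : LinearMap.ker (Matrix.mulVecLin (diagonal u)) = ⊥ := by
    rw [LinearMap.ker_eq_bot']
    intro y hy
    ext i
    have := congrFun hy i
    simpa [Matrix.mulVec_diagonal, hu i] using this
  have hscale : (fun i : S => (diagonal u * J * diagonal v)ᵀ i.1)
      = (fun i : S => Units.mk0 (v i) (hv i)) •
        (Matrix.mulVecLin (diagonal u) ∘ fun i : S => Jᵀ i.1) := by
    ext i k
    simp [Matrix.mul_diagonal, Matrix.diagonal_mul, Matrix.mulVec_diagonal, Units.smul_def,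
      mul_comm]
  rw [← LinearMap.linearIndependent_iff (v := fun i : S => Jᵀ i.1) _ hinj, hscale]
  exact LinearIndependent.units_smul_iff _ _

/-- If `X = V(P)` is a real irreducible variety of dimension `d`
(`1 ≤ d ≤ n-1`) that is positively hyperbolic of codimension `n - d`, then its algebraic
matroid is a positroid. -/
theorem stmt10 {n d : ℕ} (hd1 : 1 ≤ d) (hd2 : d ≤ n - 1)
    (P : Ideal (MvPolynomial (Fin n) ℂ)) (hP : P.IsPrime)
    (hreal : ∃ G : Set (MvPolynomial (Fin n) ℂ), P = Ideal.span G ∧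
      ∀ g ∈ G, ∀ m, (MvPolynomial.coeff m g).im = 0)
    (X : Set (Fin n → ℂ))
    (hX : X = {z : Fin n → ℂ | ∀ p ∈ P, MvPolynomial.eval z p = 0})
    (hdmax : (∃ S : Finset (Fin n), AlgIndep P ↑S ∧ S.card = d) ∧
      ∀ S : Finset (Fin n), AlgIndep P ↑S → S.card ≤ d)
    (hhyp : PosHyperbolic (n - d) X) :
    ∃ B : Matrix (Fin d) (Fin n) ℝ, B.rank = d ∧ AllMinorsNonneg B ∧
      ∀ S : Set (Fin n),
        (LinearIndependent ℝ (fun i : S => B.transpose i.1) ↔ AlgIndep P S) := by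
  classical
  obtain ⟨⟨S₀, hS₀, hcard⟩, hmax⟩ := hdmax
  have hn : d + (n - d) = n := by omega
  obtain ⟨K, _, _, x, hx, hker⟩ := hP.exists_generic_point
  have hind : ∀ S, AlgIndep P S ↔ AlgebraicIndepOn ℂ x S := algIndep_iff_algebraicIndepOn hker
  have hS₀max : Maximal (AlgebraicIndepOn ℂ x) (S₀ : Set (Fin n)) := by
    refine ⟨(hind _).1 hS₀, fun S hS hle => ?_⟩
    have h1 := hmax S.toFinset (by rw [Set.coe_toFinset]; exact (hind S).2 hS)
    have h2 : S₀ ⊆ S.toFinset := fun i hi => Set.mem_toFinset.2 (hle hi)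
    have h3 := Finset.eq_of_subset_of_card_le h2 (hcard ▸ h1)
    rw [h3, Set.coe_toFinset]
  have htrdeg := (isTranscendenceBasis_of_maximal hx hS₀max).cardinalMk_eq_trdeg
  let s := S₀.orderEmbOfFin hcard
  have hxs : AlgebraicIndependent ℂ fun i => x (s i) :=
    AlgebraicIndependent.comp hS₀max.prop
      (fun i => (⟨s i, S₀.orderEmbOfFin_mem hcard i⟩ : (S₀ : Set (Fin n))))
      fun i j hij => s.injective (congrArg Subtype.val hij)
  obtain ⟨T, A₀, hA₀, hT, hTx⟩ := exists_linear_forms hn s.strictMono hxs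
  let l : Fin d → MvPolynomial (Fin n) ℂ := fun i =>
    ∑ j, MvPolynomial.C (T i j : ℂ) * MvPolynomial.X j
  have hl : IsTranscendenceBasis ℂ fun i => MvPolynomial.aeval x (l i) := by
    have hlx : (fun i => MvPolynomial.aeval x (l i)) = fun i => ∑ j, (T i j : ℂ) • x j := by
      ext i
      simp [l, Algebra.smul_def]
    rw [hlx]
    refine hTx.isTranscendenceBasis_of_trdeg_le_of_finite ?_
    rw [← htrdeg]
    simp [hcard]
  obtain ⟨Q, hQP, hQ⟩ := exists_notMem_forall_not_algIndep hP
  obtain ⟨D, hD, hsec⟩ := exists_local_section x hx l hl Q fun h => hQP ((hker Q).1 h)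
  obtain ⟨r₀, hr₀⟩ : ∃ r₀ : Fin d → ℝ, MvPolynomial.eval (fun i => (r₀ i : ℂ)) D ≠ 0 := by
    by_contra! h
    refine hD (MvPolynomial.funext_set (fun _ => Set.range Complex.ofReal)
      (fun _ => Set.infinite_range_of_injective Complex.ofReal_injective) fun z hz => ?_)
    choose r hr using fun i => hz i (Set.mem_univ i)
    rw [map_zero, ← h r]
    congr 2
    ext i
    exact (hr i).symm
  obtain ⟨φ, hφ, hφQ, hφX⟩ := hsec _ hr₀
  obtain ⟨J, hJφ, hTJ, hJ⟩ := hhyp.exists_real_jacobian (Nat.sub_le n d) hA₀ hT hφ (by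
    filter_upwards [hφX] with z hz
    rw [hX]
    refine ⟨fun p hp => hz.1 p ((hker p).2 hp), fun i => ?_⟩
    simpa [l] using hz.2 i)
  have hA := allMinorsPos_vandermonde (n - d) n
  obtain ⟨ε, hε, hsign⟩ := TransverseToScalings.exists_sign hn hA
    (fun r hr => hJ _ (hA.mul_diagonal hr)) (alternatingVandermonde_transverse hn)
  have hε0 : ε ≠ 0 := by rcases hε with rfl | rfl <;> norm_num
  let u : Fin d → ℝ := fun i => if i = ⟨0, hd1⟩ then ε else 1
  let v : Fin n → ℝ := fun j => (-1) ^ (j : ℕ)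
  have hu : ∀ i, u i ≠ 0 := fun i => by
    simp only [u]; split_ifs <;> simp [hε0]
  have hv : ∀ j, v j ≠ 0 := fun j => by simp [v]
  have hJ0 : ∀ w, w ᵥ* J = 0 → w = 0 := fun w hw => by
    rw [← hTJ w, hw, Matrix.mulVec_zero]
  refine ⟨diagonal u * J * diagonal v, ?_, fun σ hσ => ?_, fun S => ?_⟩
  · rw [Matrix.rank_mul_eq_left_of_isUnit_det _ _ (by
        rw [det_diagonal]; exact isUnit_iff_ne_zero.2 (Finset.prod_ne_zero_iff.2 fun j _ => hv j)),
      Matrix.rank_mul_eq_right_of_isUnit_det _ _ (by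
        rw [det_diagonal]; exact isUnit_iff_ne_zero.2 (Finset.prod_ne_zero_iff.2 fun i _ => hu i))]
    have hrows : LinearIndependent ℝ J.row := by
      rw [← Matrix.vecMul_injective_iff]
      intro a b hab
      rw [← sub_eq_zero]
      refine hJ0 _ ?_
      rw [Matrix.sub_vecMul, sub_eq_zero]
      exact hab
    simpa using hrows.rank_matrix
  · have hsub : (diagonal u * J * diagonal v).submatrix id σ
        = diagonal u * J.submatrix id σ * diagonal (v ∘ σ) := by
      ext i j
      simp [Matrix.mul_diagonal, Matrix.diagonal_mul]
    have hprod : ∏ i, u i = ε := by simp [u]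
    rw [hsub, det_mul, det_mul, det_diagonal, det_diagonal, hprod]
    have h1 := hsign σ hσ
    have h2 := alternatingVandermonde_sign hσ
    have h3 := mul_nonneg h1 h2.le
    have h4 : 0 < ((alternatingVandermonde d n).submatrix id σ).det ^ 2 :=
      sq_pos_of_ne_zero (right_ne_zero_of_mul h2.ne')
    refine nonneg_of_mul_nonneg_left (le_of_le_of_eq h3 ?_) h4
    simp only [v, Function.comp_apply]
    ring
  · rw [linearIndependent_transpose_scale_iff J hu hv S]
    refine linearIndependent_transpose_iff_algIndep (z := φ fun i => (r₀ i : ℂ)) hJ0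
      (fun p hp w => ?_) (fun S hS => hQ _ hφQ S hS) hmax S
    have h1 := MvPolynomial.hasFDerivAt_eval p hφ.hasFDerivAt
    have h2 := h1.unique ((hasFDerivAt_const (0 : ℂ) _).congr_of_eventuallyEq (by
      filter_upwards [hφX] with z hz
      exact hz.1 p ((hker p).2 hp)))
    have h3 := congrArg (fun L => L fun i => (w i : ℂ)) h2
    simpa [hJφ] using h3
end

section
/- Let α, β ∈ ℕ^n with α ≠ β, let a, b ∈ ℂ ∖ {0}, and let f = a·x^α + b·x^β ∈ ℂ[x_1, …, x_n]. (i) If f is stable, then β − α ∈ {±e_i ± e_j : i, j ∈ [n]} ∪ {±e_i : i ∈ [n]} (here i = j is allowed, so ±2e_i is included). (ii) If f is stable and a, b are real and positive, then β − α ∈ {e_i − e_j : i, j ∈ [n], i ≠ j} ∪ {±e_i : i ∈ [n]}. (iii) Conversely, if β − α ∈ {±e_i ± e_j : i, j ∈ [n]} ∪ {±e_i : i ∈ [n]}, then there exists b ∈ {+1, −1} such that x^α + b·x^β is stable. -/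
/-- A polynomial `f ∈ ℂ[x₁,…,xₙ]` is stable if it has no zero all of whose coordinates have
positive imaginary part. -/
def IsStable {n : ℕ} (f : MvPolynomial (Fin n) ℂ) : Prop :=
  ∀ z : Fin n → ℂ, (∀ i, 0 < (z i).im) → MvPolynomial.eval z f ≠ 0

/-- The `i`-th standard basis vector of `ℤⁿ`. -/
def stdZ {n : ℕ} (i : Fin n) : Fin n → ℤ := fun j => if j = i then 1 else 0

lemma eval_binomial {n : ℕ} (α β : Fin n →₀ ℕ) (a b : ℂ) (z : Fin n → ℂ) (hz : ∀ k, z k ≠ 0) :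
    MvPolynomial.eval z (MvPolynomial.monomial α a + MvPolynomial.monomial β b) =
      (∏ k, z k ^ α k) * (a + b * ∏ k, z k ^ ((β k : ℤ) - (α k : ℤ))) := by
  have h : ∏ k, z k ^ β k = (∏ k, z k ^ α k) * ∏ k, z k ^ ((β k : ℤ) - (α k : ℤ)) := by
    rw [← Finset.prod_mul_distrib]
    refine Finset.prod_congr rfl fun k _ => ?_
    rw [← zpow_natCast (z k) (α k), ← zpow_add₀ (hz k), ← zpow_natCast]
    congr 1
    ring
  rw [map_add, MvPolynomial.eval_monomial, MvPolynomial.eval_monomial,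
    Finsupp.prod_fintype _ _ (by simp), Finsupp.prod_fintype _ _ (by simp), h]
  ring

lemma ne_zero_of_im_pos {z : ℂ} (hz : 0 < z.im) : z ≠ 0 := by
  rintro rfl
  simp at hz

lemma prod_zpow_smul_stdZ {n : ℕ} (z : Fin n → ℂ) (i : Fin n) (s : ℤ) :
    ∏ k, z k ^ (s • stdZ i) k = z i ^ s := by
  rw [Finset.prod_eq_single i]
  · simp [stdZ]
  · intro k _ hk
    simp [stdZ, hk]
  · simp

lemma IsStable.ne_of_abs_lt {n : ℕ} {α β : Fin n →₀ ℕ} (hne : α ≠ β) {a b : ℂ} (ha : a ≠ 0)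
    (hb : b ≠ 0) (h : IsStable (MvPolynomial.monomial α a + MvPolynomial.monomial β b))
    (t : ℝ) (ht : |t| < Real.pi / 2) (m : ℤ) :
    t * (∑ k, |(β k : ℤ) - (α k : ℤ)| : ℤ) + Real.pi / 2 * (∑ k, ((β k : ℤ) - (α k : ℤ)) : ℤ) ≠
      (-a / b).arg + m * (2 * Real.pi) := by
  intro heq
  set d : Fin n → ℤ := fun k => (β k : ℤ) - (α k : ℤ) with hd
  have hd0 : ∃ k, d k ≠ 0 := by
    by_contra! hc
    apply hne
    ext k
    have := hc k
    simp only [hd] at this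
    lia
  set Q : ℝ := ∑ k, (d k : ℝ) ^ 2 with hQ
  have hQpos : 0 < Q := by
    obtain ⟨k, hk⟩ := hd0
    exact Finset.sum_pos' (fun _ _ => sq_nonneg _) ⟨k, Finset.mem_univ _, by positivity⟩
  set w : ℂ := -a / b with hw
  have hw0 : w ≠ 0 := div_ne_zero (neg_ne_zero.mpr ha) hb
  let ρ : Fin n → ℝ := fun k => d k * Real.log ‖w‖ / Q
  let θ : Fin n → ℝ := fun k => Real.pi / 2 + t * (d k).sign
  let z : Fin n → ℂ := fun k => Complex.exp (⟨ρ k, θ k⟩ : ℂ)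
  have hθ : ∀ k, 0 < θ k ∧ θ k < Real.pi := by
    intro k
    rw [abs_lt] at ht
    have hpi := Real.pi_pos
    rcases Int.sign_trichotomy (d k) with hs | hs | hs <;>
      simp only [θ, hs] <;> push_cast <;> constructor <;> linarith
  have hzim : ∀ k, 0 < (z k).im := by
    intro k
    simp only [z, Complex.exp_im]
    exact mul_pos (Real.exp_pos _) (Real.sin_pos_of_pos_of_lt_pi (hθ k).1 (hθ k).2)
  have hsumρ : ∑ k, (d k : ℝ) * ρ k = Real.log ‖w‖ := by
    have : ∀ k, (d k : ℝ) * ρ k = (d k : ℝ) ^ 2 * (Real.log ‖w‖ / Q) := fun k => by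
      simp only [ρ]; ring
    simp_rw [this]
    rw [← Finset.sum_mul, ← hQ]
    field_simp
  have hsumθ : ∑ k, (d k : ℝ) * θ k = w.arg + m * (2 * Real.pi) := by
    rw [← heq]
    push_cast
    rw [Finset.mul_sum, Finset.mul_sum, ← Finset.sum_add_distrib]
    refine Finset.sum_congr rfl fun k _ => ?_
    have : (|(d k : ℝ)|) = d k * (d k).sign := by
      rw [← Int.cast_abs, ← Int.cast_mul, Int.mul_sign_self, Int.abs_eq_natAbs]
    have h2 : (d k : ℝ) = (β k : ℝ) - (α k : ℝ) := by simp [hd]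
    rw [h2] at this
    rw [this, h2]
    simp only [θ]
    ring
  have hprod : ∏ k, z k ^ d k = w := by
    have h1 : ∀ k, z k ^ d k = Complex.exp ((d k : ℂ) * (⟨ρ k, θ k⟩ : ℂ)) := fun k => by
      rw [Complex.exp_int_mul]
    simp_rw [h1]
    rw [← Complex.exp_sum]
    have h2 : ∑ k, (d k : ℂ) * (⟨ρ k, θ k⟩ : ℂ) =
        Complex.log w + m * (2 * Real.pi * Complex.I) := by
      apply Complex.ext
      · rw [Complex.re_sum]
        simpa [Complex.log_re] using hsumρ
      · rw [Complex.im_sum]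
        simpa [Complex.log_im] using hsumθ
    rw [h2, Complex.exp_add, Complex.exp_log hw0, Complex.exp_int_mul_two_pi_mul_I, mul_one]
  apply h z hzim
  rw [eval_binomial _ _ _ _ _ fun k => ne_zero_of_im_pos (hzim k)]
  change _ * (a + b * ∏ k, z k ^ d k) = 0
  rw [hprod, hw]
  field_simp
  ring

lemma exists_sum_abs_sub_smul_stdZ {n : ℕ} {d : Fin n → ℤ} (hd : d ≠ 0) :
    ∃ i : Fin n, ∃ s : ℤ, (s = 1 ∨ s = -1) ∧
      ∑ k, |(d - s • stdZ i) k| = ∑ k, |d k| - 1 := by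
  obtain ⟨i, hi⟩ := Function.ne_iff.mp hd
  have key : ∀ s : ℤ, |d i - s| = |d i| - 1 → ∑ k, |(d - s • stdZ i) k| = ∑ k, |d k| - 1 := by
    intro s hs
    rw [← Finset.add_sum_erase _ _ (Finset.mem_univ i),
      ← Finset.add_sum_erase _ (fun k => |d k|) (Finset.mem_univ i)]
    have : ∀ k ∈ Finset.univ.erase i, |(d - s • stdZ i) k| = |d k| := fun k hk => by
      simp [stdZ, Finset.ne_of_mem_erase hk]
    rw [Finset.sum_congr rfl this]
    have : (d - s • stdZ i) i = d i - s := by simp [stdZ]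
    rw [this, hs]
    ring
  rcases lt_or_gt_of_ne hi with hlt | hlt
  · refine ⟨i, -1, Or.inr rfl, key _ ?_⟩
    simp only [Pi.zero_apply] at hlt
    rw [abs_of_neg hlt, abs_of_nonpos (by lia)]
    ring
  · refine ⟨i, 1, Or.inl rfl, key _ ?_⟩
    simp only [Pi.zero_apply] at hlt
    rw [abs_of_pos hlt, abs_of_nonneg (by lia)]

lemma eq_smul_stdZ_of_sum_abs_le_two {n : ℕ} {d : Fin n → ℤ} (hd : d ≠ 0)
    (h : ∑ k, |d k| ≤ 2) :
    (∃ i j : Fin n, ∃ s t : ℤ, (s = 1 ∨ s = -1) ∧ (t = 1 ∨ t = -1) ∧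
        d = s • stdZ i + t • stdZ j) ∨
      (∃ i : Fin n, ∃ s : ℤ, (s = 1 ∨ s = -1) ∧ d = s • stdZ i) := by
  obtain ⟨i, s, hs, hi⟩ := exists_sum_abs_sub_smul_stdZ hd
  by_cases h1 : d - s • stdZ i = 0
  · exact Or.inr ⟨i, s, hs, sub_eq_zero.mp h1⟩
  obtain ⟨j, t, ht, hj⟩ := exists_sum_abs_sub_smul_stdZ h1
  have h2 : ∑ k, |(d - s • stdZ i - t • stdZ j) k| = 0 :=
    le_antisymm (by lia) (Finset.sum_nonneg fun _ _ => abs_nonneg _)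
  rw [Finset.sum_eq_zero_iff_of_nonneg fun _ _ => abs_nonneg _] at h2
  refine Or.inl ⟨i, j, s, t, hs, ht, ?_⟩
  have h3 : d - s • stdZ i - t • stdZ j = 0 :=
    funext fun k => abs_eq_zero.mp (h2 k (Finset.mem_univ k))
  rw [sub_sub] at h3
  exact sub_eq_zero.mp h3

lemma IsStable.sum_abs_le_two {n : ℕ} {α β : Fin n →₀ ℕ} (hne : α ≠ β) {a b : ℂ} (ha : a ≠ 0)
    (hb : b ≠ 0) (h : IsStable (MvPolynomial.monomial α a + MvPolynomial.monomial β b)) :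
    ∑ k, |(β k : ℤ) - (α k : ℤ)| ≤ 2 := by
  by_contra! hS
  set S : ℤ := ∑ k, |(β k : ℤ) - (α k : ℤ)| with hSdef
  have hS3 : (3 : ℝ) ≤ S := by exact_mod_cast hS
  have hpi := Real.pi_pos
  obtain ⟨m, hm, -⟩ := existsUnique_add_zsmul_mem_Ioc (Real.two_pi_pos)
    ((-a / b).arg - Real.pi / 2 * (∑ k, ((β k : ℤ) - (α k : ℤ)) : ℤ)) (-Real.pi)
  rw [zsmul_eq_mul] at hm
  set y := (-a / b).arg - Real.pi / 2 * (∑ k, ((β k : ℤ) - (α k : ℤ)) : ℤ) + m * (2 * Real.pi)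
    with hy
  refine h.ne_of_abs_lt hne ha hb (y / S) ?_ m ?_
  · have hy' : |y| ≤ Real.pi := abs_le.mpr ⟨hm.1.le, by linarith [hm.2]⟩
    rw [abs_div, abs_of_pos (by linarith : (0 : ℝ) < S), div_lt_iff₀ (by linarith)]
    nlinarith
  · rw [← hSdef, div_mul_cancel₀ _ (by linarith), hy]
    ring

lemma IsStable.sum_ne_of_pos {n : ℕ} {α β : Fin n →₀ ℕ} (hne : α ≠ β) {a b : ℂ}
    (h : IsStable (MvPolynomial.monomial α a + MvPolynomial.monomial β b))
    (ha : a.im = 0) (hb : b.im = 0) (ha' : 0 < a.re) (hb' : 0 < b.re) {s : ℤ}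
    (hs : s = 1 ∨ s = -1) : ∑ k, ((β k : ℤ) - (α k : ℤ)) ≠ 2 * s := by
  intro hsum
  have harg : (-a / b).arg = Real.pi := by
    have e : -a / b = ((-(a.re / b.re) : ℝ) : ℂ) := by
      conv_lhs => rw [← Complex.re_add_im a, ← Complex.re_add_im b, ha, hb]
      push_cast
      ring
    rw [e, Complex.arg_ofReal_of_neg (neg_neg_of_pos (div_pos ha' hb'))]
  have ha0 : a ≠ 0 := by rintro rfl; simp at ha'
  have hb0 : b ≠ 0 := by rintro rfl; simp at hb'
  have key := h.ne_of_abs_lt hne ha0 hb0 0 (by simpa using Real.pi_pos)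
  rw [harg, hsum] at key
  rcases hs with rfl | rfl
  · exact key 0 (by push_cast; ring)
  · exact key (-1) (by push_cast; ring)

lemma sum_smul_stdZ {n : ℕ} (s : ℤ) (i : Fin n) : ∑ k, (s • stdZ i) k = s := by
  simp [stdZ]

lemma isStable_binomial_of_prod_ne {n : ℕ} {α β : Fin n →₀ ℕ} {b : ℂ}
    (h : ∀ z : Fin n → ℂ, (∀ i, 0 < (z i).im) →
      1 + b * ∏ k, z k ^ ((β k : ℤ) - (α k : ℤ)) ≠ 0) :
    IsStable (MvPolynomial.monomial α 1 + MvPolynomial.monomial β b) := by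
  intro z hz
  have hz0 : ∀ k, z k ≠ 0 := fun k => ne_zero_of_im_pos (hz k)
  rw [eval_binomial _ _ _ _ _ hz0]
  exact mul_ne_zero (Finset.prod_ne_zero_iff.mpr fun k _ => pow_ne_zero _ (hz0 k)) (h z hz)

lemma mul_ne_one_of_im_pos {z w : ℂ} (hz : 0 < z.im) (hw : 0 < w.im) : z * w ≠ 1 := by
  intro h
  rw [eq_inv_of_mul_eq_one_right h, Complex.inv_im] at hw
  exact hw.not_ge (div_nonpos_of_nonpos_of_nonneg (by linarith) (Complex.normSq_nonneg z))

lemma ne_neg_of_im_pos {z w : ℂ} (hz : 0 < z.im) (hw : 0 < w.im) : z ≠ -w := by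
  rintro rfl
  simp only [Complex.neg_im] at hz
  linarith

lemma exists_isStable_of_eq_add {n : ℕ} {α β : Fin n →₀ ℕ} {i j : Fin n} {s t : ℤ}
    (hs : s = 1 ∨ s = -1) (ht : t = 1 ∨ t = -1)
    (hd : (fun k => (β k : ℤ) - (α k : ℤ)) = s • stdZ i + t • stdZ j) :
    ∃ b' : ℂ, (b' = 1 ∨ b' = -1) ∧
      IsStable (MvPolynomial.monomial α 1 + MvPolynomial.monomial β b') := by
  have hprod : ∀ z : Fin n → ℂ, (∀ i, 0 < (z i).im) →
      ∏ k, z k ^ ((β k : ℤ) - (α k : ℤ)) = z i ^ s * z j ^ t := fun z hz => by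
    rw [← prod_zpow_smul_stdZ, ← prod_zpow_smul_stdZ, ← Finset.prod_mul_distrib]
    refine Finset.prod_congr rfl fun k _ => ?_
    rw [← zpow_add₀ (ne_zero_of_im_pos (hz k)), congrFun hd k, Pi.add_apply]
  rcases eq_or_ne s t with rfl | hst
  · refine ⟨-1, Or.inr rfl, isStable_binomial_of_prod_ne fun z hz h => ?_⟩
    rw [hprod z hz, ← mul_zpow] at h
    apply mul_ne_one_of_im_pos (hz i) (hz j)
    rcases hs with rfl | rfl
    · rw [zpow_one] at h
      linear_combination -h
    · rw [zpow_neg_one] at h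
      rw [← inv_eq_one]
      linear_combination -h
  · refine ⟨1, Or.inl rfl, isStable_binomial_of_prod_ne fun z hz h => ?_⟩
    rw [hprod z hz] at h
    have hi := ne_zero_of_im_pos (hz i)
    have hj := ne_zero_of_im_pos (hz j)
    apply ne_neg_of_im_pos (hz i) (hz j)
    rcases hs with rfl | rfl <;> rcases ht with rfl | rfl
    · exact absurd rfl hst
    · rw [zpow_one, zpow_neg_one] at h
      field_simp at h
      linear_combination h
    · rw [zpow_one, zpow_neg_one] at h
      field_simp at h
      linear_combination h
    · exact absurd rfl hst

lemma isStable_of_eq_smul_stdZ {n : ℕ} {α β : Fin n →₀ ℕ} {i : Fin n} {s : ℤ}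
    (hs : s = 1 ∨ s = -1) (hd : (fun k => (β k : ℤ) - (α k : ℤ)) = s • stdZ i) :
    IsStable (MvPolynomial.monomial α 1 + MvPolynomial.monomial β 1) := by
  refine isStable_binomial_of_prod_ne fun z hz h => ?_
  have hprod : ∏ k, z k ^ ((β k : ℤ) - (α k : ℤ)) = z i ^ s := by
    rw [← prod_zpow_smul_stdZ]
    exact Finset.prod_congr rfl fun k _ => by rw [congrFun hd k]
  have hi := ne_zero_of_im_pos (hz i)
  have hzi : z i = -1 := by
    rw [hprod] at h
    rcases hs with rfl | rfl
    · rw [zpow_one] at h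
      linear_combination h
    · rw [zpow_neg_one] at h
      field_simp at h
      linear_combination h
  have := hz i
  rw [hzi] at this
  simp at this

/-- For a binomial `f = a·x^α + b·x^β` with `a, b ≠ 0` and `α ≠ β`:
(i) if `f` is stable then `β - α ∈ {±eᵢ ± eⱼ} ∪ {±eᵢ}`; (ii) if moreover `a, b` are real
and positive then `β - α ∈ {eᵢ - eⱼ : i ≠ j} ∪ {±eᵢ}`; (iii) conversely, if
`β - α ∈ {±eᵢ ± eⱼ} ∪ {±eᵢ}` then `x^α + b'·x^β` is stable for some `b' ∈ {±1}`. -/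
theorem stmt11 {n : ℕ} (α β : Fin n →₀ ℕ) (hne : α ≠ β) (a b : ℂ) (ha : a ≠ 0) (hb : b ≠ 0) :
    (IsStable (MvPolynomial.monomial α a + MvPolynomial.monomial β b) →
      ((∃ i j : Fin n, ∃ s t : ℤ, (s = 1 ∨ s = -1) ∧ (t = 1 ∨ t = -1) ∧
          (fun k => (β k : ℤ) - (α k : ℤ)) = s • stdZ i + t • stdZ j) ∨
       (∃ i : Fin n, ∃ s : ℤ, (s = 1 ∨ s = -1) ∧
          (fun k => (β k : ℤ) - (α k : ℤ)) = s • stdZ i))) ∧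
    (IsStable (MvPolynomial.monomial α a + MvPolynomial.monomial β b) →
      a.im = 0 → b.im = 0 → 0 < a.re → 0 < b.re →
      ((∃ i j : Fin n, i ≠ j ∧
          (fun k => (β k : ℤ) - (α k : ℤ)) = stdZ i - stdZ j) ∨
       (∃ i : Fin n, ∃ s : ℤ, (s = 1 ∨ s = -1) ∧
          (fun k => (β k : ℤ) - (α k : ℤ)) = s • stdZ i))) ∧
    (((∃ i j : Fin n, ∃ s t : ℤ, (s = 1 ∨ s = -1) ∧ (t = 1 ∨ t = -1) ∧
          (fun k => (β k : ℤ) - (α k : ℤ)) = s • stdZ i + t • stdZ j) ∨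
      (∃ i : Fin n, ∃ s : ℤ, (s = 1 ∨ s = -1) ∧
          (fun k => (β k : ℤ) - (α k : ℤ)) = s • stdZ i)) →
      ∃ b' : ℂ, (b' = 1 ∨ b' = -1) ∧
        IsStable (MvPolynomial.monomial α 1 + MvPolynomial.monomial β b')) := by
  have hd0 : (fun k => (β k : ℤ) - (α k : ℤ)) ≠ 0 := by
    intro h0
    apply hne
    ext k
    have := congrFun h0 k
    simp only [Pi.zero_apply] at this
    lia
  refine ⟨fun h => eq_smul_stdZ_of_sum_abs_le_two hd0 (h.sum_abs_le_two hne ha hb),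
    fun h ha1 hb1 ha2 hb2 => ?_, ?_⟩
  · rcases eq_smul_stdZ_of_sum_abs_le_two hd0 (h.sum_abs_le_two hne ha hb) with
      ⟨i, j, s, t, hs, ht, hd⟩ | h1
    · left
      rcases eq_or_ne s t with rfl | hst
      · refine absurd ?_ (h.sum_ne_of_pos hne ha1 hb1 ha2 hb2 hs)
        rw [Finset.sum_congr rfl fun k _ => congrFun hd k]
        simp_rw [Pi.add_apply]
        rw [Finset.sum_add_distrib, sum_smul_stdZ, sum_smul_stdZ]
        ring
      · rcases hs with rfl | rfl <;> rcases ht with rfl | rfl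
        · exact absurd rfl hst
        · refine ⟨i, j, ?_, by rw [hd]; simp [sub_eq_add_neg]⟩
          rintro rfl
          exact hd0 (by rw [hd]; simp)
        · refine ⟨j, i, ?_, by rw [hd]; simp [sub_eq_add_neg, add_comm]⟩
          rintro rfl
          exact hd0 (by rw [hd]; simp)
        · exact absurd rfl hst
    · exact Or.inr h1
  · rintro (⟨i, j, s, t, hs, ht, hd⟩ | ⟨i, s, hs, hd⟩)
    · exact exists_isStable_of_eq_add hs ht hd
    · exact ⟨1, Or.inl rfl, isStable_of_eq_smul_stdZ hs hd⟩
end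

section
/- Let A be a d × n integer matrix of rank d with 1 ≤ d ≤ n−1, with columns a_1, …, a_n ∈ ℤ^d. For λ ∈ (ℂ^*)^n let X_{λ,A} ⊆ ℂ^n denote the Zariski closure of the set {(λ_1 t^{a_1}, …, λ_n t^{a_n}) : t ∈ (ℂ^*)^d}, where t^{a_i} = Π_k t_k^{(a_i)_k}; concretely, X_{λ,A} = {x ∈ ℂ^n : p(x) = 0 for every polynomial p ∈ ℂ[x_1, …, x_n] vanishing at (λ_1 t^{a_1}, …, λ_n t^{a_n}) for all t ∈ (ℂ^*)^d}. The following are equivalent: (1) there exists λ ∈ (ℂ^*)^n such that X_{λ,A} is positively hyperbolic of codimension n−d; (2) there exists λ ∈ {+1, −1}^n such that X_{λ,A} is positively hyperbolic of codimension n−d; (3) there exists an invertible d × d matrix g with rational entries such that every column of gA lies in {0} ∪ {±e_1, …, ±e_d} and the supports of the rows of gA (the sets {i ∈ [n] : (gA)_{k,i} ≠ 0} for k = 1, …, d) form a non-crossing partition of a subset of [n]. -/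
open Matrix

/-- A family of subsets of `[n] = Fin n` forms a non-crossing partition of a subset of `[n]`:
the sets are pairwise disjoint and no two of them cross cyclically... here stated in the
linear form: there are no `a < b < c < d` with `a, c` in one set and `b, d` in another. -/
def NonCrossingFamily {n : ℕ} {ι : Type} (S : ι → Set (Fin n)) : Prop :=
  (Pairwise fun k l => Disjoint (S k) (S l)) ∧
  ¬ ∃ (a b c d : Fin n) (k l : ι), k ≠ l ∧ a < b ∧ b < c ∧ c < d ∧
      a ∈ S k ∧ c ∈ S k ∧ b ∈ S l ∧ d ∈ S l

/-- The affine toric variety `X_{λ,A} ⊆ ℂⁿ`: the Zariski closure of the image of the monomial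
map `t ↦ (λ₁ t^{a₁}, …, λₙ t^{aₙ})` on `(ℂ*)^d`, described as the common zero set of all
polynomials vanishing on that image. -/
def toricSet {d n : ℕ} (lam : Fin n → ℂ) (A : Matrix (Fin d) (Fin n) ℤ) : Set (Fin n → ℂ) :=
  {x : Fin n → ℂ | ∀ p : MvPolynomial (Fin n) ℂ,
    (∀ t : Fin d → ℂ, (∀ k, t k ≠ 0) →
      MvPolynomial.eval (fun i => lam i * ∏ k, t k ^ A k i) p = 0) →
    MvPolynomial.eval x p = 0}

open scoped Topology

lemma eq_zero_of_mem_positiveSubspace {c n : ℕ} {L : Submodule ℝ (Fin n → ℝ)}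
    (hL : IsPositiveSubspace c L) {v : Fin n → ℝ} (hv : v ∈ L) (s : Fin (c + 1) → Fin n)
    (hs : StrictMono s) (h : ∀ j : Fin (c + 1), 0 ≤ (-1) ^ (j : ℕ) * v (s j)) : v = 0 := by
  obtain ⟨A, -, rfl, hA⟩ := hL
  obtain ⟨w, hw⟩ := (Submodule.mem_span_range_iff_exists_fun ℝ).1 hv
  have hwA : ∀ i, ∑ r, w r * A r i = v i := fun i => by
    simpa [Finset.sum_apply] using congrFun hw i
  let M : Matrix (Fin (c + 1)) (Fin (c + 1)) ℝ :=
    Matrix.of (Fin.cons (fun j => v (s j)) fun r j => A r (s j))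
  have hM : M.det = 0 := by
    apply Matrix.exists_vecMul_eq_zero_iff.1
    refine ⟨Fin.cons (-1) w, fun h0 => by simpa using congrFun h0 0, ?_⟩
    ext j
    simp [Matrix.vecMul, dotProduct, Fin.sum_univ_succ, M, hwA]
  have hpos : ∀ j : Fin (c + 1), 0 < (A.submatrix id (s ∘ j.succAbove)).det := fun j =>
    hA _ (hs.comp (Fin.strictMono_succAbove j))
  have hsum : ∑ j : Fin (c + 1),
      (-1) ^ (j : ℕ) * v (s j) * (A.submatrix id (s ∘ j.succAbove)).det = 0 := by
    rw [← hM, Matrix.det_succ_row_zero]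
    rfl
  have hzero : ∀ j, v (s j) = 0 := fun j => by
    have := (Finset.sum_eq_zero_iff_of_nonneg fun j _ => mul_nonneg (h j) (hpos j).le).1 hsum j
      (Finset.mem_univ j)
    simpa [(hpos j).ne'] using this
  have hw0 : w = 0 := by
    refine Matrix.eq_zero_of_vecMul_eq_zero (hpos 0).ne' ?_
    ext j
    simp only [Matrix.vecMul, dotProduct, Matrix.submatrix_apply, id, Function.comp_apply, hwA,
      hzero, Pi.zero_apply]
  ext i
  simp [← hwA, hw0]

/-- The matrix `q ^ ((i - j) ^ 2)`, which is totally positive for small `q > 0`. -/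
def gaussMatrix (n : ℕ) (q : ℝ) : Matrix (Fin n) (Fin n) ℝ :=
  Matrix.of fun i j => q ^ ((((i : ℕ) : ℤ) - ((j : ℕ) : ℤ)).natAbs ^ 2)

lemma gaussMatrix_zero (n : ℕ) : gaussMatrix n 0 = 1 := by
  ext i j
  rcases eq_or_ne i j with rfl | h
  · simp [gaussMatrix]
  · have : (((i : ℕ) : ℤ) - ((j : ℕ) : ℤ)).natAbs ≠ 0 := by
      intro h0
      apply h
      ext
      omega
    simp [gaussMatrix, Matrix.one_apply_ne h, this]

lemma continuous_gaussMatrix (n : ℕ) : Continuous (gaussMatrix n) :=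
  continuous_matrix fun i j => by simpa [gaussMatrix] using continuous_pow _

lemma sum_sq_sub_lt_of_perm_ne_one {c n : ℕ} {I J : Fin c → Fin n} (hI : StrictMono I)
    (hJ : StrictMono J) {σ : Equiv.Perm (Fin c)} (hσ : σ ≠ 1) :
    ∑ i, (((I i : ℕ) : ℤ) - ((J i : ℕ) : ℤ)).natAbs ^ 2 <
      ∑ i, (((I (σ i) : ℕ) : ℤ) - ((J i : ℕ) : ℤ)).natAbs ^ 2 := by
  zify
  simp only [sq_abs]
  have hmono : Monovary (fun i => ((I i : ℕ) : ℤ)) (fun i => ((J i : ℕ) : ℤ)) := by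
    intro i j hij
    have : J i < J j := by simpa using hij
    have h2 : I i ≤ I j := (hI (hJ.lt_iff_lt.1 this)).le
    exact Int.ofNat_le.2 h2
  have hlt := (hmono.sum_comp_perm_mul_lt_sum_mul_iff (σ := σ)).2 (by
    intro hm
    apply hσ
    have hσm : StrictMono σ := by
      refine Monotone.strictMono_of_injective ?_ σ.injective
      refine monotone_iff_forall_lt.2 fun i j hij => ?_
      have := hm (i := i) (j := j) (by simpa using hJ hij)
      simpa [hI.le_iff_le] using this
    have h1 : hσm.orderIsoOfSurjective σ σ.surjective = OrderIso.refl _ := Subsingleton.elim _ _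
    exact Equiv.ext fun i => DFunLike.congr_fun h1 i)
  have hsq : ∑ i, ((I (σ i) : ℕ) : ℤ) ^ 2 = ∑ i, ((I i : ℕ) : ℤ) ^ 2 :=
    Equiv.sum_comp σ fun i => ((I i : ℕ) : ℤ) ^ 2
  simp only [sub_sq, Finset.sum_add_distrib, Finset.sum_sub_distrib, hsq, mul_assoc,
    ← Finset.mul_sum]
  linarith

lemma eventually_det_gaussMatrix_pos (c n : ℕ) :
    ∀ᶠ q in 𝓝[>] (0 : ℝ), ∀ I J : Fin c → Fin n, StrictMono I → StrictMono J →
      0 < ((gaussMatrix n q).submatrix I J).det := by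
  refine Filter.eventually_all.2 fun I => Filter.eventually_all.2 fun J =>
    Filter.eventually_imp_distrib_left.2 fun hI => Filter.eventually_imp_distrib_left.2 fun hJ => ?_
  let E : Equiv.Perm (Fin c) → ℕ := fun σ =>
    ∑ i, (((I (σ i) : ℕ) : ℤ) - ((J i : ℕ) : ℤ)).natAbs ^ 2
  have hE : ∀ σ, σ ≠ 1 → E 1 < E σ := fun σ hσ => sum_sq_sub_lt_of_perm_ne_one hI hJ hσ
  let F : ℝ → ℝ := fun q => ∑ σ : Equiv.Perm (Fin c), (Equiv.Perm.sign σ : ℤ) * q ^ (E σ - E 1)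
  have hF : Continuous F := by fun_prop
  have hF0 : F 0 = 1 := by
    simp only [F]
    rw [Finset.sum_eq_single 1]
    · simp
    · intro σ _ hσ
      rw [zero_pow (by have := hE σ hσ; omega), mul_zero]
    · simp
  have hev : ∀ᶠ q in 𝓝[>] (0 : ℝ), 0 < F q :=
    (hF.tendsto 0 |>.mono_left nhdsWithin_le_nhds).eventually (by
      rw [hF0]; exact lt_mem_nhds one_pos)
  filter_upwards [hev, self_mem_nhdsWithin] with q hq hq0
  have : ((gaussMatrix n q).submatrix I J).det = q ^ E 1 * F q := by
    rw [Matrix.det_apply', Finset.mul_sum]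
    refine Finset.sum_congr rfl fun σ _ => ?_
    have h1 : E 1 ≤ E σ := by
      rcases eq_or_ne σ 1 with rfl | h
      · rfl
      · exact (hE σ h).le
    rw [mul_left_comm, ← pow_add, Nat.add_sub_cancel' h1]
    simp [gaussMatrix, E, Finset.prod_pow_eq_pow_sum]
  rw [this]
  exact mul_pos (pow_pos hq0 _) hq

lemma exists_positiveSubspace_of_strictMono {c n : ℕ} (m : Fin c → Fin n) (hm : StrictMono m)
    (hcn : c < n) (v : Fin n → ℝ)
    (hv : ∀ j, j ∉ Set.range m →
      0 < (-1) ^ (Finset.univ.filter fun r => m r < j).card * v j) :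
    ∃ L, IsPositiveSubspace (c + 1) L ∧ v ∈ L := by
  classical
  let w : ℝ → Fin n → ℝ := fun q => v ᵥ* (gaussMatrix n q).adjugate
  have hw : Continuous w := Continuous.matrix_vecMul continuous_const
    (continuous_gaussMatrix n).matrix_adjugate
  have hw0 : w 0 = v := by simp [w, gaussMatrix_zero]
  have hwpos : ∀ᶠ q in 𝓝[>] (0 : ℝ), ∀ j, j ∉ Set.range m →
      0 < (-1) ^ (Finset.univ.filter fun r => m r < j).card * w q j := by
    refine Filter.eventually_all.2 fun j => Filter.eventually_imp_distrib_left.2 fun hj => ?_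
    have hc : Continuous fun q =>
        (-1) ^ (Finset.univ.filter fun r => m r < j).card * w q j := by fun_prop
    refine (hc.tendsto 0 |>.mono_left nhdsWithin_le_nhds).eventually (lt_mem_nhds ?_)
    rw [hw0]
    exact hv j hj
  have hdet : ∀ᶠ q in 𝓝[>] (0 : ℝ), 0 < (gaussMatrix n q).det := by
    refine ((continuous_gaussMatrix n).matrix_det.tendsto 0
      |>.mono_left nhdsWithin_le_nhds).eventually (lt_mem_nhds ?_)
    simp [gaussMatrix_zero]
  obtain ⟨q, hq1, hq2, hq3⟩ :=
    (hwpos.and (hdet.and (eventually_det_gaussMatrix_pos (c + 1) n))).exists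
  set T := gaussMatrix n q
  have hwT : w q ᵥ* T = T.det • v := by
    simp [w, T, Matrix.vecMul_vecMul, Matrix.adjugate_mul, Matrix.vecMul_smul]
  let P : Matrix (Fin (c + 1)) (Fin n) ℝ := Matrix.of (Fin.cons (w q ᵥ* T) fun r => T (m r))
  have hexp : ∀ J : Fin (c + 1) → Fin n, (P.submatrix id J).det =
      ∑ j, w q j * (T.submatrix (Fin.cons j m : Fin (c + 1) → Fin n) J).det := by
    intro J
    simp only [Matrix.det_succ_row_zero, Finset.mul_sum]
    rw [Finset.sum_comm]
    refine Finset.sum_congr rfl fun p _ => ?_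
    have h0 : (P.submatrix id J) 0 p = ∑ j, w q j * T j (J p) := rfl
    rw [h0, Finset.mul_sum, Finset.sum_mul]
    refine Finset.sum_congr rfl fun j _ => ?_
    have h1 : (P.submatrix id J).submatrix Fin.succ p.succAbove =
      (T.submatrix (Fin.cons j m : Fin (c + 1) → Fin n) J).submatrix Fin.succ p.succAbove := rfl
    rw [h1]
    simp only [Matrix.submatrix_apply, Fin.cons_zero]
    ring
  have hcons : ∀ J : Fin (c + 1) → Fin n, StrictMono J → ∀ j, j ∉ Set.range m →
      0 < w q j * (T.submatrix (Fin.cons j m : Fin (c + 1) → Fin n) J).det := by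
    intro J hJ j hj
    have hcard : (Finset.univ.filter fun r => m r < j).card < c + 1 :=
      Nat.lt_succ_of_le ((Finset.card_filter_le _ _).trans (by simp))
    set p : Fin (c + 1) := ⟨(Finset.univ.filter fun r => m r < j).card, hcard⟩ with hp
    have hlt : ∀ r : Fin c, m r < j ↔ (r : ℕ) < p := by
      have hlow : ∀ r : Fin c, m r < j → (r : ℕ) < p := by
        intro r hr
        have : (Finset.Iic r) ⊆ Finset.univ.filter fun r => m r < j := by
          intro r' hr'
          simpa using (hm.monotone (Finset.mem_Iic.1 hr')).trans_lt hr
        have := Finset.card_le_card this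
        simp only [Fin.card_Iic] at this
        exact this
      refine fun r => ⟨hlow r, fun hr => ?_⟩
      by_contra hr'
      have : (Finset.univ.filter fun r => m r < j) ⊆ Finset.Iio r := by
        intro r' hr''
        have h2 : m r' < j := by simpa using hr''
        exact Finset.mem_Iio.2 (hm.lt_iff_lt.1 (h2.trans_le (not_lt.1 hr')))
      have := Finset.card_le_card this
      simp only [Fin.card_Iio] at this
      exact absurd hr (not_lt.2 this)
    have hins : StrictMono (p.insertNth j m : Fin (c + 1) → Fin n) := by
      refine (Fin.strictMono_insertNth_iff _ _ _).2
        ⟨hm, fun r hr => (hlt r).2 hr, fun r hr => ?_⟩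
      refine lt_of_le_of_ne (not_lt.1 fun h => ?_) fun h => hj ⟨r, h.symm⟩
      exact absurd ((hlt r).1 h) (not_lt.2 hr)
    have hperm : (Fin.cons j m : Fin (c + 1) → Fin n) =
        (p.insertNth j m : Fin (c + 1) → Fin n) ∘ p.cycleRange.symm :=
      (Fin.insertNth_comp_cycleRange_symm p j m).symm
    have hdet : (T.submatrix (Fin.cons j m : Fin (c + 1) → Fin n) J).det =
        (-1) ^ (p : ℕ) * (T.submatrix (p.insertNth j m : Fin (c + 1) → Fin n) J).det := by
      rw [hperm]
      have := Matrix.det_permute p.cycleRange.symm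
        (T.submatrix (p.insertNth j m : Fin (c + 1) → Fin n) J)
      rw [Matrix.submatrix_submatrix] at this
      simpa using this
    rw [hdet, ← mul_assoc, mul_comm (w q j)]
    exact mul_pos (hq1 j hj) (hq3 _ _ hins hJ)
  have hP : AllMinorsPos P := by
    intro J hJ
    rw [hexp]
    have hz : ∀ j ∈ Set.range m,
        w q j * (T.submatrix (Fin.cons j m : Fin (c + 1) → Fin n) J).det = 0 := by
      rintro _ ⟨r, rfl⟩
      rw [Matrix.det_zero_of_row_eq (Fin.succ_ne_zero r).symm (by ext; simp), mul_zero]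
    obtain ⟨j, hj⟩ : ∃ j, j ∉ Set.range m := by
      by_contra! hall
      have := Fintype.card_le_of_surjective m hall
      simp at this
      omega
    refine Finset.sum_pos' (fun i _ => ?_) ⟨j, Finset.mem_univ _, hcons J hJ j hj⟩
    by_cases hi : i ∈ Set.range m
    · exact (hz i hi).ge
    · exact (hcons J hJ i hi).le
  refine ⟨_, ⟨P, ?_, rfl, hP⟩, ?_⟩
  · have hJ : StrictMono (Fin.castLE hcn : Fin (c + 1) → Fin n) := Fin.strictMono_castLE hcn
    have hli : LinearIndependent ℝ P.row := by
      refine Matrix.vecMul_injective_iff.1 fun x y hxy => ?_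
      refine sub_eq_zero.1 (Matrix.eq_zero_of_vecMul_eq_zero (hP _ hJ).ne' ?_)
      ext r
      have := congrFun hxy (Fin.castLE hcn r)
      rw [Matrix.sub_vecMul]
      exact sub_eq_zero.2 this
    simpa using hli.rank_matrix
  · have : v = T.det⁻¹ • P 0 := by
      change v = T.det⁻¹ • (w q ᵥ* T)
      rw [hwT, smul_smul, inv_mul_cancel₀ hq2.ne', one_smul]
    rw [this]
    exact Submodule.smul_mem _ _ (Submodule.subset_span ⟨0, rfl⟩)

lemma PosHyperbolic.not_forall_sign {c n : ℕ} {X : Set (Fin n → ℂ)}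
    (hX : PosHyperbolic (c + 1) X) (hcn : c < n) {x : Fin n → ℂ} (hx : x ∈ X)
    (M : Finset (Fin n)) (hM : M.card = c) (δ : ℝ) :
    ¬ ∀ i, i ∉ M → 0 < (-1) ^ (M.filter (· < i)).card * (δ * (x i).im) := by
  intro h
  have hrange : ∀ i, i ∈ Set.range (M.orderEmbOfFin hM) ↔ i ∈ M := by simp
  obtain ⟨i, hi⟩ : ∃ i, i ∉ M := by
    by_contra! hall
    rw [Finset.eq_univ_of_forall hall, Finset.card_univ, Fintype.card_fin] at hM
    omega
  have hne : δ * (x i).im ≠ 0 := fun h0 => by simpa [h0] using h i hi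
  obtain ⟨L, hL, hv⟩ := exists_positiveSubspace_of_strictMono (M.orderEmbOfFin hM)
    (M.orderEmbOfFin hM).strictMono hcn (δ • imPart x) (fun j hj => by
      have hcard : (Finset.univ.filter fun r => M.orderEmbOfFin hM r < j).card =
          (M.filter (· < j)).card := by
        rw [← Finset.card_map (M.orderEmbOfFin hM).toEmbedding]
        congr 1
        ext i
        simp only [Finset.mem_map, Finset.mem_filter, Finset.mem_univ, true_and,
          RelEmbedding.coe_toEmbedding, ← hrange, Set.mem_range]
        constructor
        · rintro ⟨r, hr, rfl⟩
          exact ⟨⟨r, rfl⟩, hr⟩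
        · rintro ⟨⟨r, rfl⟩, hr⟩
          exact ⟨r, hr, rfl⟩
      rw [hcard]
      exact h j (by rwa [← hrange]))
  refine hX L hL x hx ⟨?_, fun h0 => hne ?_⟩
  · have hδ : δ ≠ 0 := left_ne_zero_of_mul hne
    simpa [smul_smul, hδ] using L.smul_mem δ⁻¹ hv
  · have := congrFun h0 i
    simp only [imPart, Pi.zero_apply] at this
    rw [this, mul_zero]

section SignChanges

/-- The number of changes among the first `m + 1` terms of a sequence. -/
def changeCount {α : Type*} [DecidableEq α] (u : ℕ → α) (m : ℕ) : ℕ :=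
  ((Finset.range m).filter fun l => u l ≠ u (l + 1)).card

lemma changeCount_succ {α : Type*} [DecidableEq α] (u : ℕ → α) (m : ℕ) :
    changeCount u (m + 1) = changeCount u m + if u m ≠ u (m + 1) then 1 else 0 := by
  rw [changeCount, Finset.range_add_one, Finset.filter_insert]
  split_ifs <;> simp [changeCount]

lemma changeCount_mono {α : Type*} [DecidableEq α] (u : ℕ → α) : Monotone (changeCount u) :=
  monotone_nat_of_le_succ fun m => by rw [changeCount_succ]; omega

lemma eq_neg_one_pow_changeCount_mul (u : ℕ → ℤˣ) (m : ℕ) :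
    u m = (-1) ^ changeCount u m * u 0 := by
  induction m with
  | zero => simp [changeCount]
  | succ m ih =>
    rw [changeCount_succ]
    split_ifs with h
    · rw [pow_succ, mul_assoc, mul_left_comm, ← ih, neg_one_mul]
      exact (Int.units_ne_iff_eq_neg.1 h.symm)
    · rw [add_zero, ← ih]
      exact (not_not.1 h).symm

lemma exists_changeCount_eq {α : Type*} [DecidableEq α] (u : ℕ → α) (m c : ℕ)
    (h : c ≤ changeCount u m) : ∃ i ≤ m, changeCount u i = c := by
  induction m with
  | zero => exact ⟨0, le_rfl, by simp only [changeCount, Finset.range_zero, Finset.filter_empty,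
      Finset.card_empty] at h ⊢; omega⟩
  | succ m ih =>
    by_cases hm : c ≤ changeCount u m
    · obtain ⟨i, hi, h'⟩ := ih hm
      exact ⟨i, hi.trans m.le_succ, h'⟩
    · refine ⟨m + 1, le_rfl, ?_⟩
      rw [changeCount_succ] at h ⊢
      split_ifs at h ⊢ <;> omega

lemma changeCount_neg_one_pow_mul (u : ℕ → ℤˣ) (m : ℕ) :
    changeCount (fun i => (-1) ^ i * u i) m + changeCount u m = m := by
  induction m with
  | zero => simp [changeCount]
  | succ m ih =>
    rw [changeCount_succ, changeCount_succ]
    have : ((-1) ^ m * u m ≠ (-1) ^ (m + 1) * u (m + 1)) ↔ u m = u (m + 1) := by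
      rw [pow_succ, mul_assoc, Ne, mul_right_inj, neg_one_mul, ← Ne, Int.units_ne_iff_eq_neg,
        neg_neg]
    simp only [this]
    by_cases h : u m = u (m + 1) <;> simp [h] at ih ⊢ <;> omega

variable {α : Type*} [DecidableEq α]

/-- The number of distinct values among the first `m + 1` terms of a sequence. -/
def valueCount (f : ℕ → α) (m : ℕ) : ℕ := ((Finset.range (m + 1)).image f).card

lemma valueCount_succ (f : ℕ → α) (m : ℕ) :
    valueCount f (m + 1) = valueCount f m + if ∃ l ≤ m, f l = f (m + 1) then 0 else 1 := by
  rw [valueCount, Finset.range_add_one, Finset.image_insert]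
  split_ifs with h
  · rw [Finset.insert_eq_of_mem]
    · rfl
    · obtain ⟨l, hl, h⟩ := h
      exact Finset.mem_image.2 ⟨l, by simp; omega, h⟩
  · rw [Finset.card_insert_of_notMem]
    · rfl
    · simp only [Finset.mem_image, Finset.mem_range, not_exists, not_and]
      exact fun l hl h' => h ⟨l, by omega, h'⟩

/-- If `f` is a non-crossing labelling and signs are constant along each label up to the parity
of the number of labels seen so far, then a sign change costs a new label. -/
lemma changeCount_add_valueCount_le (f : ℕ → α)
    (hf : ∀ a b c e, a < b → b < c → c < e → f a = f c → f b = f e → f a = f b)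
    (σ : α → ℤˣ) (i : ℕ) : ∀ j ≤ i,
    (∀ l, j < l → l ≤ i → f l = f j ∨ ∀ l' ≤ j, f l' ≠ f l) →
    changeCount (fun l => (-1) ^ valueCount f l * σ (f l)) i + valueCount f j ≤
      changeCount (fun l => (-1) ^ valueCount f l * σ (f l)) j + valueCount f i := by
  set u : ℕ → ℤˣ := fun l => (-1) ^ valueCount f l * σ (f l) with hu
  induction i using Nat.strong_induction_on with
  | _ i ih =>
  intro j hji hj
  rcases hji.eq_or_lt with rfl | hlt
  · exact le_rfl
  obtain ⟨i, rfl⟩ : ∃ i', i = i' + 1 := ⟨i - 1, by omega⟩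
  by_cases hold : ∃ l ≤ i, f l = f (i + 1)
  · have hN : valueCount f (i + 1) = valueCount f i := by rw [valueCount_succ, if_pos hold]; rfl
    let l := Nat.findGreatest (fun l => f l = f (i + 1)) i
    obtain ⟨l₀, hl₀, hl₀'⟩ := hold
    have hfl : f l = f (i + 1) := Nat.findGreatest_spec (P := fun l => f l = f (i + 1)) hl₀ hl₀'
    have hli : l ≤ i := Nat.findGreatest_le i
    have hmax : ∀ q, l < q → q ≤ i → f q ≠ f (i + 1) := fun q h1 h2 =>
      Nat.findGreatest_is_greatest h1 h2
    have hjl : j ≤ l := by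
      rcases hj (i + 1) hlt le_rfl with h | h
      · exact Nat.le_findGreatest (by omega) h.symm
      · by_contra hlj
        exact h l (by omega) hfl
    have h1 := ih l (by omega) j hjl fun q hq1 hq2 => hj q hq1 (by omega)
    have h2 := ih i (by omega) l hli fun q hq1 hq2 => by
      refine Or.inr fun l' hl' hq => ?_
      have hne := hmax q hq1 hq2
      rcases hl'.eq_or_lt with rfl | hl'
      · exact hne (hq.symm.trans hfl)
      · exact hne ((hf l' l q (i + 1) hl' hq1 (by omega) hq hfl ▸ hq).symm.trans hfl)
    have h3 := changeCount_succ u i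
    have hpar : (-1 : ℤˣ) ^ (changeCount u (i + 1) + valueCount f l) =
        (-1) ^ (changeCount u l + valueCount f (i + 1)) := by
      have e1 := eq_neg_one_pow_changeCount_mul u (i + 1)
      have e2 := eq_neg_one_pow_changeCount_mul u l
      simp only [hu] at e1 e2
      rw [← hu] at e1 e2
      rw [hfl] at e2
      have e3 : ∀ a b c d s t : ℤˣ, a * s = b * t → c * s = d * t → b * c = d * a := by decide
      rw [pow_add, pow_add]
      exact e3 _ _ _ _ _ _ e1 e2
    rw [Int.units_pow_eq_pow_mod_two, Int.units_pow_eq_pow_mod_two _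
      (changeCount u l + valueCount f (i + 1))] at hpar
    have hmod : (changeCount u (i + 1) + valueCount f l) % 2 =
        (changeCount u l + valueCount f (i + 1)) % 2 := by
      rcases Nat.mod_two_eq_zero_or_one (changeCount u (i + 1) + valueCount f l) with h | h <;>
      rcases Nat.mod_two_eq_zero_or_one (changeCount u l + valueCount f (i + 1)) with h' | h' <;>
      simp [h, h'] at hpar ⊢
    split_ifs at h3 <;> omega
  · have hN : valueCount f (i + 1) = valueCount f i + 1 := by rw [valueCount_succ, if_neg hold]
    have h1 := ih i (by omega) j (by omega) fun q hq1 hq2 => hj q hq1 (by omega)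
    have h3 := changeCount_succ u i
    split_ifs at h3 <;> omega

lemma le_changeCount_of_nonCrossing [Fintype α] (f : ℕ → α)
    (hf : ∀ a b c e, a < b → b < c → c < e → f a = f c → f b = f e → f a = f b)
    (σ : α → ℤˣ) (m : ℕ) :
    m + 1 ≤ changeCount (fun l => (-1) ^ l * ((-1) ^ valueCount f l * σ (f l))) m +
      Fintype.card α := by
  have h1 := changeCount_add_valueCount_le f hf σ m 0 (Nat.zero_le m) fun l _ _ => by
    by_cases h : f l = f 0
    · exact Or.inl h
    · refine Or.inr fun l' hl' => ?_
      obtain rfl : l' = 0 := by omega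
      exact fun h' => h h'.symm
  have h2 := changeCount_neg_one_pow_mul (fun l => (-1) ^ valueCount f l * σ (f l)) m
  have h3 : valueCount f 0 = 1 := by simp [valueCount]
  have h4 : valueCount f m ≤ Fintype.card α := Finset.card_le_univ _
  have h5 : changeCount (fun l => (-1) ^ valueCount f l * σ (f l)) 0 = 0 := by simp [changeCount]
  omega

end SignChanges

lemma exists_alternating_of_nonCrossing {c d n : ℕ} (hn : n = d + (c + 1)) (f : Fin n → Fin d)
    (hf : ∀ a b c e, a < b → b < c → c < e → f a = f c → f b = f e → f a = f b) :
    ∃ ε : Fin n → ℤˣ, ∀ σ : Fin d → ℤˣ, ∃ s : Fin (c + 2) → Fin n, StrictMono s ∧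
      ∃ δ : ℤˣ, ∀ j, ε (s j) * σ (f (s j)) = (-1) ^ (j : ℕ) * δ := by
  let r : ℕ → Fin n := fun i => ⟨min i (n - 1), by omega⟩
  have hr : Monotone r := fun i j hij => by
    simp only [r, Fin.mk_le_mk]
    omega
  have hri : ∀ i : Fin n, r i = i := fun i => by
    ext
    simp only [r]
    omega
  let F : ℕ → Fin d := f ∘ r
  have hF : ∀ a b c e, a < b → b < c → c < e → F a = F c → F b = F e → F a = F b := by
    intro a b c e hab hbc hce h1 h2
    by_contra h3
    refine h3 (hf _ (r b) (r c) (r e) ?_ ?_ ?_ h1 h2)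
    · exact lt_of_le_of_ne (hr hab.le) fun h => h3 (congrArg f h)
    · exact lt_of_le_of_ne (hr hbc.le) fun h => h3 (h1.trans (congrArg f h).symm)
    · exact lt_of_le_of_ne (hr hce.le) fun h => h3 (h1.trans ((congrArg f h).trans h2.symm))
  refine ⟨fun i => (-1) ^ (i : ℕ) * (-1) ^ valueCount F i, fun σ => ?_⟩
  set w : ℕ → ℤˣ := fun l => (-1) ^ l * ((-1) ^ valueCount F l * σ (F l)) with hw
  have hle := le_changeCount_of_nonCrossing F hF σ (n - 1)
  rw [← hw, Fintype.card_fin] at hle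
  have hex : ∀ j : Fin (c + 2), ∃ i ≤ n - 1, changeCount w i = j := fun j =>
    exists_changeCount_eq w (n - 1) j (by have := j.2; omega)
  choose s hs hsj using hex
  refine ⟨fun j => ⟨s j, by have := hs j; omega⟩, fun i j hij => ?_, w 0, fun j => ?_⟩
  · refine Fin.mk_lt_mk.2 (lt_of_not_ge fun h => ?_)
    have := changeCount_mono w h
    rw [hsj, hsj] at this
    exact absurd hij (not_lt.2 (Fin.le_def.2 this))
  · rw [← hsj j, ← eq_neg_one_pow_changeCount_mul]
    simp only [hw, F, Function.comp_apply]
    rw [hri ⟨s j, _⟩, mul_assoc]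

lemma posHyperbolic_of_alternating {c d n : ℕ} (f : Fin n → Fin d) (ε : Fin n → ℤˣ)
    (hε : ∀ σ : Fin d → ℤˣ, ∃ s : Fin (c + 1) → Fin n, StrictMono s ∧
      ∃ δ : ℤˣ, ∀ j, ε (s j) * σ (f (s j)) = (-1) ^ (j : ℕ) * δ)
    (X : Set (Fin n → ℂ))
    (hX : ∀ x ∈ X, ∀ i j, f i = f j →
      0 ≤ ((ε i : ℤ) * (x i).im) * ((ε j : ℤ) * (x j).im)) :
    PosHyperbolic c X := by
  classical
  rintro L hL x hx ⟨hv, hne⟩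
  let σ : Fin d → ℤˣ := fun k => if ∃ i, f i = k ∧ ((ε i : ℤ) : ℝ) * (x i).im < 0 then -1 else 1
  have hσ : ∀ i, 0 ≤ ((σ (f i) : ℤ) : ℝ) * ((ε i : ℤ) * (x i).im) := by
    intro i
    simp only [σ]
    split_ifs with h
    · obtain ⟨j, hj, hlt⟩ := h
      have := hX x hx j i hj
      push_cast
      nlinarith
    · push Not at h
      simpa using h i rfl
  obtain ⟨s, hs, δ, hδ⟩ := hε σ
  have hunit : ∀ a : ℤˣ, ((a : ℤ) : ℝ) * (a : ℤ) = 1 := fun a => by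
    have : ((a * a : ℤˣ) : ℤ) = 1 := by simp
    exact_mod_cast this
  have h0 : (((δ : ℤ) : ℝ) • imPart x) = 0 := by
    refine eq_zero_of_mem_positiveSubspace hL (L.smul_mem _ hv) s hs fun j => ?_
    have h1 : ((ε (s j) * σ (f (s j)) : ℤˣ) : ℤ) = (-1) ^ (j : ℕ) * δ := by
      rw [hδ]
      simp
    have h2 : ((ε (s j) : ℤ) : ℝ) * (σ (f (s j)) : ℤ) = (-1) ^ (j : ℕ) * (δ : ℤ) := by
      exact_mod_cast h1
    have := hσ (s j)
    rw [Pi.smul_apply, smul_eq_mul, ← mul_assoc, ← h2]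
    simp only [imPart]
    linarith
  apply hne
  have := congrArg (fun y => ((δ : ℤ) : ℝ) • y) h0
  simpa [smul_smul, hunit] using this

section Toric

variable {d n : ℕ} {lam : Fin n → ℂ} {A : Matrix (Fin d) (Fin n) ℤ} {x : Fin n → ℂ}

lemma toricSet_apply_eq_of_col_eq_zero (hx : x ∈ toricSet lam A) {i : Fin n}
    (h : ∀ k, A k i = 0) : x i = lam i := by
  have := hx (MvPolynomial.X i - MvPolynomial.C (lam i)) fun t _ => by simp [h]
  simpa [sub_eq_zero] using this

lemma toricSet_mul_eq_mul_of_col_eq (hx : x ∈ toricSet lam A) {i j : Fin n}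
    (h : ∀ k, A k i = A k j) : lam j * x i = lam i * x j := by
  have := hx (MvPolynomial.C (lam j) * MvPolynomial.X i - MvPolynomial.C (lam i) * MvPolynomial.X j)
    fun t _ => by
      simp only [map_sub, map_mul, MvPolynomial.eval_C, MvPolynomial.eval_X, h]
      ring
  simpa [sub_eq_zero] using this

lemma toricSet_mul_eq_mul_of_col_eq_neg (hx : x ∈ toricSet lam A) {i j : Fin n}
    (h : ∀ k, A k i = -A k j) : x i * x j = lam i * lam j := by
  have := hx (MvPolynomial.X i * MvPolynomial.X j - MvPolynomial.C (lam i * lam j))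
    fun t ht => by
      have h1 : (∏ k, t k ^ A k i) * ∏ k, t k ^ A k j = 1 := by
        rw [← Finset.prod_mul_distrib]
        refine Finset.prod_eq_one fun k _ => ?_
        rw [h, _root_.zpow_neg, inv_mul_cancel₀ (zpow_ne_zero _ (ht k))]
      simp only [map_sub, map_mul, MvPolynomial.eval_C, MvPolynomial.eval_X]
      linear_combination lam i * lam j * h1
  simpa [sub_eq_zero] using this

end Toric

lemma exists_nonCrossing_extension {d n : ℕ} (hd : 1 ≤ d) (p : Fin n → Prop) (f₀ : Fin n → Fin d)
    (hf₀ : ∀ a b c e, p a → p b → p c → p e → a < b → b < c → c < e → f₀ a = f₀ c →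
      f₀ b = f₀ e → f₀ a = f₀ b) :
    ∃ f : Fin n → Fin d, (∀ i, p i → f i = f₀ i) ∧
      ∀ a b c e, a < b → b < c → c < e → f a = f c → f b = f e → f a = f b := by
  classical
  by_cases hp : ∃ i, p i
  · obtain ⟨i₀, hi₀⟩ := hp
    let S : Finset (Fin n) := Finset.univ.filter p
    have hS : S.Nonempty := ⟨i₀, by simpa [S] using hi₀⟩
    let r : Fin n → Fin n := fun i =>
      if h : (S.filter (· ≤ i)).Nonempty then (S.filter (· ≤ i)).max' h else S.min' hS
    have hr : Monotone r := by
      intro i j hij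
      simp only [r]
      split_ifs with h1 h2 h2
      · exact Finset.max'_subset _ fun q hq => by
          simp only [Finset.mem_filter] at hq ⊢
          exact ⟨hq.1, hq.2.trans hij⟩
      · obtain ⟨q, hq⟩ := h1
        simp only [Finset.mem_filter] at hq
        exact absurd ⟨q, by simpa using ⟨hq.1, hq.2.trans hij⟩⟩ h2
      · exact Finset.min'_le _ _ (Finset.mem_filter.1 (Finset.max'_mem _ h2)).1
      · exact le_rfl
    have hpr : ∀ i, p (r i) := by
      intro i
      have : r i ∈ S := by
        simp only [r]
        split_ifs with h
        · exact (Finset.mem_filter.1 (Finset.max'_mem _ h)).1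
        · exact Finset.min'_mem _ _
      simpa [S] using this
    have hri : ∀ i, p i → r i = i := by
      intro i hi
      have hmem : i ∈ S.filter (· ≤ i) := by simpa [S] using hi
      simp only [r]
      rw [dif_pos ⟨i, hmem⟩]
      have hmax := Finset.max'_mem (S.filter (· ≤ i)) ⟨i, hmem⟩
      exact le_antisymm (Finset.mem_filter.1 hmax).2 (Finset.le_max' _ _ hmem)
    refine ⟨f₀ ∘ r, fun i hi => by simp [hri i hi], fun a b c e hab hbc hce h1 h2 => ?_⟩
    by_contra h3
    refine h3 (hf₀ _ (r b) (r c) (r e) (hpr _) (hpr _) (hpr _) (hpr _) ?_ ?_ ?_ h1 h2)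
    · exact lt_of_le_of_ne (hr hab.le) fun h => h3 (congrArg f₀ h)
    · exact lt_of_le_of_ne (hr hbc.le) fun h => h3 (h1.trans (congrArg f₀ h).symm)
    · exact lt_of_le_of_ne (hr hce.le) fun h => h3 (h1.trans ((congrArg f₀ h).trans h2.symm))
  · push Not at hp
    exact ⟨fun _ => ⟨0, hd⟩, fun i hi => absurd hi (hp i), fun _ _ _ _ _ _ _ _ _ => rfl⟩

lemma exists_posHyperbolic_toricSet {c d n : ℕ} (hd : 1 ≤ d) (hn : n = d + (c + 1))
    (A : Matrix (Fin d) (Fin n) ℤ) (g : Matrix (Fin d) (Fin d) ℚ) (hg : g.det ≠ 0)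
    (B : Matrix (Fin d) (Fin n) ℚ) (hB : B = g * A.map ((↑) : ℤ → ℚ))
    (hcol : ∀ i : Fin n, (∀ k, B k i = 0) ∨
      ∃ k₀ : Fin d, (∀ k, k ≠ k₀ → B k i = 0) ∧ (B k₀ i = 1 ∨ B k₀ i = -1))
    (hnc : NonCrossingFamily (fun k : Fin d => {i : Fin n | B k i ≠ 0})) :
    ∃ lam : Fin n → ℂ, (∀ i, lam i = 1 ∨ lam i = -1) ∧
      PosHyperbolic (c + 1) (toricSet lam A) := by
  classical
  have hcolA : ∀ (i j : Fin n) (z : ℤ), (∀ k, B k i = z * B k j) → ∀ k, A k i = z * A k j := by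
    intro i j z h k
    have h0 : g *ᵥ (fun k => (A k i : ℚ) - z * A k j) = 0 := by
      ext k
      have := h k
      simp only [hB, Matrix.mul_apply, Matrix.map_apply, Finset.mul_sum] at this
      simp only [Matrix.mulVec, dotProduct, mul_sub, Finset.sum_sub_distrib, this, Pi.zero_apply,
        sub_eq_zero]
      exact Finset.sum_congr rfl fun _ _ => by ring
    have := congrFun (Matrix.eq_zero_of_mulVec_eq_zero hg h0) k
    simp only [Pi.zero_apply, sub_eq_zero] at this
    exact_mod_cast this
  let p : Fin n → Prop := fun i => ∃ k, B k i ≠ 0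
  let f₀ : Fin n → Fin d := fun i => if h : ∃ k, B k i ≠ 0 then h.choose else ⟨0, hd⟩
  have hf₀ : ∀ i, p i → B (f₀ i) i ≠ 0 := by
    intro i hi
    simp only [f₀]
    rw [dif_pos hi]
    exact hi.choose_spec
  obtain ⟨f, hff₀, hf⟩ := exists_nonCrossing_extension hd p f₀ (by
    intro a b c e ha hb hc he hab hbc hce h1 h2
    by_contra h3
    exact hnc.2 ⟨a, b, c, e, f₀ a, f₀ b, h3, hab, hbc, hce, hf₀ a ha, by rw [h1]; exact hf₀ c hc,
      hf₀ b hb, by rw [h2]; exact hf₀ e he⟩)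
  have hfB : ∀ i, p i → (∀ k, k ≠ f i → B k i = 0) ∧ (B (f i) i = 1 ∨ B (f i) i = -1) := by
    intro i hi
    rcases hcol i with h | ⟨k₀, hk, hk₀⟩
    · exact absurd (h _) (hf₀ i hi)
    · have : f i = k₀ := by
        by_contra hne
        exact hf₀ i hi (hff₀ i hi ▸ hk _ hne)
      rw [this]
      exact ⟨hk, hk₀⟩
  obtain ⟨ε, hε⟩ := exists_alternating_of_nonCrossing hn f hf
  let η : Fin n → ℤˣ := fun i => if B (f i) i = -1 then -1 else 1
  let lam : Fin n → ℂ := fun i => ((ε i * η i : ℤˣ) : ℤ)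
  refine ⟨lam, fun i => ?_, posHyperbolic_of_alternating f ε hε _ fun x hx i j hij => ?_⟩
  · rcases Int.units_eq_one_or (ε i * η i) with h | h <;>
    simp only [lam, h] <;> simp
  · have hzero : ∀ i, ¬ p i → (x i).im = 0 := by
      intro i hi
      have hi' : ∀ k, B k i = 0 := by simpa [p] using hi
      rw [toricSet_apply_eq_of_col_eq_zero hx fun k => by
        simpa using hcolA i i 0 (fun k => by simp [hi']) k]
      simp [lam]
    by_cases hi : p i
    swap
    · simp [hzero i hi]
    by_cases hj : p j
    swap
    · simp [hzero j hj]
    obtain ⟨hi0, hi1⟩ := hfB i hi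
    obtain ⟨hj0, hj1⟩ := hfB j hj
    have hBz : ∀ z : ℤ, B (f i) i = z * B (f j) j → ∀ k, B k i = z * B k j := by
      intro z hz k
      by_cases hk : k = f i
      · rw [hk, hz, hij]
      · rw [hi0 k hk, hj0 k (hij ▸ hk), mul_zero]
    by_cases hsame : B (f i) i = B (f j) j
    · have hA := hcolA i j 1 (hBz 1 (by simpa using hsame))
      have hrel := toricSet_mul_eq_mul_of_col_eq hx (i := i) (j := j) fun k => by simpa using hA k
      have hη : η i = η j := by simp [η, hsame]
      simp only [lam, hη] at hrel
      have him := congrArg Complex.im hrel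
      rcases Int.units_eq_one_or (ε i) with h1 | h1 <;>
      rcases Int.units_eq_one_or (ε j) with h2 | h2 <;>
      rcases Int.units_eq_one_or (η j) with h3 | h3 <;>
      simp [h1, h2, h3] at him ⊢ <;>
      first
      | rw [him]; nlinarith [mul_self_nonneg (x j).im]
      | rw [← him]; nlinarith [mul_self_nonneg (x i).im]
    · have hopp : B (f i) i = ((-1 : ℤ) : ℚ) * B (f j) j := by
        rcases hi1 with h1 | h1 <;> rcases hj1 with h2 | h2 <;> simp [h1, h2] at hsame ⊢
      have hA := hcolA i j (-1) (hBz _ hopp)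
      have hrel := toricSet_mul_eq_mul_of_col_eq_neg hx (i := i) (j := j) fun k => by simpa using hA k
      have hη : η i * η j = -1 := by
        rcases hi1 with h1 | h1 <;> rcases hj1 with h2 | h2 <;> simp [h1, h2, η] at hsame ⊢
        all_goals norm_num
      have hlam : lam i * lam j = ((-(ε i * ε j : ℤˣ) : ℤ) : ℂ) := by
        simp only [lam]
        rw [← Int.cast_mul, ← Units.val_mul, mul_mul_mul_comm, hη]
        simp
      rw [hlam] at hrel
      have him := congrArg Complex.im hrel
      have hre := congrArg Complex.re hrel
      have key : 0 ≤ ((x i).im * (x j).re) ^ 2 + ((x i).im * (x j).im) ^ 2 := by positivity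
      rcases Int.units_eq_one_or (ε i) with h1 | h1 <;>
      rcases Int.units_eq_one_or (ε j) with h2 | h2 <;>
      simp [h1, h2] at him hre ⊢ <;> linear_combination
        key + (x i).im * (x j).re * him - (x i).im * (x j).im * hre

lemma mem_closure_setOf_pos_mul_sin {s y : ℝ} (hs : s ≠ 0) (h : 0 ≤ s * Real.sin y) :
    y ∈ closure {z | 0 < s * Real.sin z} := by
  rcases h.lt_or_eq with h | h
  · exact subset_closure h
  have h0 : Real.sin y = 0 := by
    rcases mul_eq_zero.1 h.symm with h | h
    · exact absurd h hs
    · exact h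
  have hc : s * Real.cos y ≠ 0 := by
    refine mul_ne_zero hs fun hc => ?_
    have := Real.sin_sq_add_cos_sq y
    simp [h0, hc] at this
  have hcont : Continuous fun ε : ℝ => if 0 < s * Real.cos y then y + ε else y - ε := by
    split_ifs <;> fun_prop
  have htend : Filter.Tendsto (fun ε : ℝ => if 0 < s * Real.cos y then y + ε else y - ε)
      (𝓝[>] 0) (𝓝 y) := by
    have := (hcont.tendsto 0).mono_left (nhdsWithin_le_nhds (s := Set.Ioi 0))
    simpa using this
  refine mem_closure_of_tendsto htend ?_
  have hpi : Set.Ioo (0 : ℝ) Real.pi ∈ 𝓝[>] (0 : ℝ) := Ioo_mem_nhdsGT Real.pi_pos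
  filter_upwards [hpi] with ε hε
  have hsin := Real.sin_pos_of_pos_of_lt_pi hε.1 hε.2
  change 0 < s * Real.sin (if 0 < s * Real.cos y then y + ε else y - ε)
  split_ifs with hpos
  · rw [Real.sin_add, h0, zero_mul, zero_add, ← mul_assoc]
    exact mul_pos hpos hsin
  · rw [Real.sin_sub, h0, zero_mul, zero_sub, mul_neg, ← mul_assoc, ← neg_mul]
    exact mul_pos (neg_pos.2 (lt_of_le_of_ne (not_lt.1 hpos) hc)) hsin

lemma nonneg_of_forall_pos_mul_sin {ι : Type*} {s : ι → ℝ} (hs : ∀ l, s l ≠ 0)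
    {F : (ι → ℝ) → ℝ} (hF : Continuous F)
    (h : ∀ y : ι → ℝ, (∀ l, 0 < s l * Real.sin (y l)) → 0 ≤ F y) {y : ι → ℝ}
    (hy : ∀ l, 0 ≤ s l * Real.sin (y l)) : 0 ≤ F y := by
  have hmem : y ∈ closure (Set.pi Set.univ fun l => {z : ℝ | 0 < s l * Real.sin z}) := by
    rw [closure_pi_set]
    exact Set.mem_univ_pi.2 fun l => mem_closure_setOf_pos_mul_sin (hs l) (hy l)
  have hsub : (Set.pi Set.univ fun l => {z : ℝ | 0 < s l * Real.sin z}) ⊆ {y | 0 ≤ F y} :=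
    fun z hz => h z fun l => Set.mem_univ_pi.1 hz l
  exact closure_minimal hsub (isClosed_le continuous_const hF) hmem

/-- A linear phase whose sine keeps a constant weak sign on the boxes where the signs of the
sines of the coordinates are prescribed is, up to a multiple of `π`, zero or plus or minus a
coordinate. -/
lemma eq_zero_or_single_of_sin_sign {d : ℕ} (q s : Fin d → ℝ) (β ς : ℝ)
    (hs : ∀ l, s l = 1 ∨ s l = -1) (hς : ς ≠ 0)
    (hpos : ∀ y : Fin d → ℝ, (∀ l, 0 < s l * Real.sin (y l)) →
      0 ≤ ς * Real.sin (β + ∑ l, q l * y l))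
    (hneg : ∀ y : Fin d → ℝ, (∀ l, s l * Real.sin (y l) < 0) →
      ς * Real.sin (β + ∑ l, q l * y l) ≤ 0) :
    Real.sin β = 0 ∧ ((∀ l, q l = 0) ∨
      ∃ l, (∀ k, k ≠ l → q k = 0) ∧ (q l = 1 ∨ q l = -1)) := by
  have hs0 : ∀ l, s l ≠ 0 := fun l => by rcases hs l with h | h <;> simp [h]
  have hcont : Continuous fun y : Fin d → ℝ => ς * Real.sin (β + ∑ l, q l * y l) := by fun_prop
  have hpos' : ∀ y : Fin d → ℝ, (∀ l, 0 ≤ s l * Real.sin (y l)) →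
      0 ≤ ς * Real.sin (β + ∑ l, q l * y l) := by
    exact fun y hy => nonneg_of_forall_pos_mul_sin hs0 hcont hpos hy
  have hneg' : ∀ y : Fin d → ℝ, (∀ l, s l * Real.sin (y l) ≤ 0) →
      ς * Real.sin (β + ∑ l, q l * y l) ≤ 0 := by
    intro y hy
    refine neg_nonneg.1 (nonneg_of_forall_pos_mul_sin (fun l => neg_ne_zero.2 (hs0 l))
      hcont.neg (fun z hz => neg_nonneg.2 (hneg z fun l => ?_)) fun l => ?_)
    · simpa using hz l
    · simpa using hy l
  have hβ : Real.sin β = 0 := by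
    have h1 := hpos' 0 (by simp)
    have h2 := hneg' 0 (by simp)
    simpa [hς] using le_antisymm h2 h1
  have hcos : Real.cos β ≠ 0 := fun hc => by
    have := Real.sin_sq_add_cos_sq β
    simp [hβ, hc] at this
  have hsum : ∀ (l : Fin d) (t : ℝ), ∑ k, q k * (Pi.single l t : Fin d → ℝ) k = q l * t := by
    intro l t
    rw [Finset.sum_eq_single l] <;> simp +contextual
  have hsin : ∀ z, Real.sin (β + z) = Real.cos β * Real.sin z := fun z => by
    rw [Real.sin_add, hβ, zero_mul, zero_add]
  have hsingle : ∀ l t, 0 ≤ s l * Real.sin t →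
      0 ≤ ς * (Real.cos β * Real.sin (q l * t)) := by
    intro l t ht
    have := hpos' (Pi.single l t) fun k => by
      rcases eq_or_ne k l with rfl | hk
      · simpa using ht
      · simp [hk]
    rwa [hsum, hsin] at this
  have hqint : ∀ l, ∃ m : ℤ, q l = m := by
    intro l
    have h0 : ∀ k, s k * Real.sin ((Pi.single l Real.pi : Fin d → ℝ) k) = 0 := fun k => by
      rcases eq_or_ne k l with rfl | hk
      · simp
      · simp [hk]
    have h1 := hpos' (Pi.single l Real.pi) fun k => (h0 k).ge
    have h2 := hneg' (Pi.single l Real.pi) fun k => (h0 k).le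
    have h3 := le_antisymm h2 h1
    rw [hsum, hsin] at h3
    have h4 : Real.sin (q l * Real.pi) = 0 := by simpa [hς, hcos] using h3
    obtain ⟨m, hm⟩ := Real.sin_eq_zero_iff.1 h4
    exact ⟨m, (mul_right_cancel₀ Real.pi_ne_zero hm).symm⟩
  have hssin : ∀ l t, 0 ≤ t → t ≤ Real.pi → 0 ≤ s l * Real.sin (s l * t) := by
    intro l t h0 h1
    have := Real.sin_nonneg_of_nonneg_of_le_pi h0 h1
    rcases hs l with h | h <;> simpa [h] using this
  have hval : ∀ l, q l = 0 ∨ q l = 1 ∨ q l = -1 := by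
    intro l
    obtain ⟨m, hm⟩ := hqint l
    by_contra! hne
    have hm2 : (2 : ℝ) ≤ |q l| := by
      rw [hm]
      have h2 : 2 ≤ |m| := by
        by_contra hlt
        have h3 : m = 0 ∨ m = 1 ∨ m = -1 := by
          rw [not_le, abs_lt] at hlt
          omega
        rcases h3 with h | h | h <;> simp [hm, h] at hne
      exact_mod_cast h2
    have hq0 : 0 < |q l| := by linarith
    set t := Real.pi / (2 * |q l|) with ht
    have htq : |q l| * t = Real.pi / 2 := by rw [ht]; field_simp
    have ht0 : 0 ≤ t := by have := Real.pi_pos; positivity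
    have ht1 : 3 * t ≤ Real.pi := by nlinarith [Real.pi_pos]
    have h1 := hsingle l (s l * t) (hssin l t ht0 (by linarith))
    have h3 := hsingle l (s l * (3 * t)) (hssin l _ (by linarith) ht1)
    have hX : Real.sin (q l * (s l * t)) ^ 2 = 1 := by
      have : q l * (s l * t) = Real.pi / 2 ∨ q l * (s l * t) = -(Real.pi / 2) := by
        rcases abs_choice (q l) with h | h <;> rw [h] at htq <;> rcases hs l with h' | h' <;>
          rw [h']
        · left; linarith
        · right; linarith
        · right; linarith
        · left; linarith
      rcases this with h | h <;> simp [h]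
    rw [show q l * (s l * (3 * t)) = 3 * (q l * (s l * t)) by ring, Real.sin_three_mul] at h3
    set X := Real.sin (q l * (s l * t))
    have h4 : 3 * X - 4 * X ^ 3 = -X := by linear_combination -4 * X * hX
    rw [h4] at h3
    have h5 : ς * (Real.cos β * X) = 0 := by linarith
    have h6 : X = 0 := by simpa [hς, hcos] using h5
    simp [h6] at hX
  refine ⟨hβ, ?_⟩
  by_cases hall : ∀ l, q l = 0
  · exact Or.inl hall
  push Not at hall
  obtain ⟨l, hl⟩ := hall
  have hl' : q l = 1 ∨ q l = -1 := by simpa [hl] using hval l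
  refine Or.inr ⟨l, fun k hk => ?_, hl'⟩
  by_contra hqk
  have hk' : q k = 1 ∨ q k = -1 := by simpa [hqk] using hval k
  have hsk := hssin k (Real.pi / 2) (by positivity) (by linarith [Real.pi_pos])
  have h1 := hsingle k (s k * (Real.pi / 2)) hsk
  have h2 := hpos' (Pi.single k (s k * (Real.pi / 2)) + Pi.single l Real.pi) fun i => by
    rcases eq_or_ne i k with rfl | hik
    · simpa [hk] using hsk
    · rcases eq_or_ne i l with rfl | hil
      · simp [hik]
      · simp [hik, hil]
  have h3 : ∑ i, q i * (Pi.single k (s k * (Real.pi / 2)) + Pi.single l Real.pi : Fin d → ℝ) i =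
      q k * (s k * (Real.pi / 2)) + q l * Real.pi := by
    simp only [Pi.add_apply, mul_add, Finset.sum_add_distrib, hsum]
  rw [h3, hsin] at h2
  have h4 : ∀ z, Real.sin (z + q l * Real.pi) = -Real.sin z := fun z => by
    rcases hl' with h | h
    · rw [h, one_mul, Real.sin_add_pi]
    · rw [h, neg_one_mul, ← sub_eq_add_neg, Real.sin_sub_pi]
  rw [h4] at h2
  have h5 : ς * (Real.cos β * Real.sin (q k * (s k * (Real.pi / 2)))) = 0 := by linarith
  have h6 : Real.sin (q k * (s k * (Real.pi / 2))) = 0 := by simpa [hς, hcos] using h5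
  rcases hk' with h | h <;> rcases hs k with h' | h' <;> simp [h, h'] at h6

lemma exists_mem_toricSet_im_eq {d n : ℕ} (lam : Fin n → ℂ) (A : Matrix (Fin d) (Fin n) ℤ)
    (g : Matrix (Fin d) (Fin d) ℚ) (I : Fin d → Fin n)
    (hI : ∀ k l, (g * A.map ((↑) : ℤ → ℚ)) k (I l) = if k = l then 1 else 0) :
    ∃ β : Fin n → ℝ, (∀ l, β (I l) = 0) ∧ ∀ y : Fin d → ℝ, ∃ x ∈ toricSet lam A, ∀ i,
      (x i).im = ‖lam i‖ *
        Real.sin (β i + ∑ l, (((g * A.map ((↑) : ℤ → ℚ)) l i : ℚ) : ℝ) * y l) := by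
  set B := g * A.map ((↑) : ℤ → ℚ) with hB
  refine ⟨fun i => (lam i).arg - ∑ l, ((B l i : ℚ) : ℝ) * (lam (I l)).arg, fun l => ?_,
    fun y => ?_⟩
  · simp only [hI]
    rw [Finset.sum_eq_single l (fun k _ hk => by simp [hk]) (by simp)]
    simp
  · let φ : Fin d → ℝ := fun k => ∑ l, (y l - (lam (I l)).arg) * ((g l k : ℚ) : ℝ)
    have hφ : ∀ i, ∑ k, (A k i : ℝ) * φ k =
        ∑ l, ((B l i : ℚ) : ℝ) * (y l - (lam (I l)).arg) := by
      intro i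
      simp only [φ, hB, Matrix.mul_apply, Matrix.map_apply, Finset.mul_sum, Rat.cast_sum,
        Finset.sum_mul]
      rw [Finset.sum_comm]
      refine Finset.sum_congr rfl fun _ _ => Finset.sum_congr rfl fun _ _ => ?_
      push_cast
      ring
    refine ⟨fun i => lam i * ∏ k, Complex.exp (φ k * Complex.I) ^ A k i,
      fun p hp => hp _ fun k => Complex.exp_ne_zero _, fun i => ?_⟩
    have h1 : ∏ k, Complex.exp (φ k * Complex.I) ^ A k i =
        Complex.exp (((∑ k, (A k i : ℝ) * φ k : ℝ) : ℂ) * Complex.I) := by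
      rw [Complex.ofReal_sum, Finset.sum_mul, Complex.exp_sum]
      refine Finset.prod_congr rfl fun k _ => ?_
      rw [← Complex.exp_int_mul]
      push_cast
      ring_nf
    have h2 : lam i * Complex.exp (((∑ k, (A k i : ℝ) * φ k : ℝ) : ℂ) * Complex.I) =
        (‖lam i‖ : ℂ) *
          Complex.exp ((((lam i).arg + ∑ k, (A k i : ℝ) * φ k : ℝ) : ℂ) * Complex.I) := by
      conv_lhs => rw [← Complex.norm_mul_exp_arg_mul_I (lam i)]
      rw [mul_assoc, ← Complex.exp_add, ← add_mul, Complex.ofReal_add]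
    simp only
    rw [h1, h2, Complex.im_ofReal_mul, Complex.exp_ofReal_mul_I_im, hφ]
    simp only [mul_sub, Finset.sum_sub_distrib]
    ring_nf

lemma exists_mul_submatrix_eq_one {d n : ℕ} (A : Matrix (Fin d) (Fin n) ℚ) (hA : A.rank = d) :
    ∃ (g : Matrix (Fin d) (Fin d) ℚ) (I : Fin d → Fin n), g.det ≠ 0 ∧
      ∀ k l, (g * A) k (I l) = if k = l then 1 else 0 := by
  rw [Matrix.rank_eq_finrank_span_cols] at hA
  obtain ⟨f, hf, -, hli⟩ := Submodule.exists_fun_fin_finrank_span_eq ℚ (Set.range A.col)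
  choose I hI using hf
  have hli' : LinearIndependent ℚ (A.submatrix id (I ∘ finCongr hA.symm)).col := by
    have h : (A.submatrix id (I ∘ finCongr hA.symm)).col = f ∘ finCongr hA.symm :=
      funext fun k => hI _
    rw [h]
    exact hli.comp _ (finCongr hA.symm).injective
  have hdet := (Matrix.isUnit_iff_isUnit_det _).1 (Matrix.linearIndependent_cols_iff_isUnit.1 hli')
  refine ⟨(A.submatrix id (I ∘ finCongr hA.symm))⁻¹, I ∘ finCongr hA.symm,
    (Matrix.isUnit_nonsing_inv_det _ hdet).ne_zero, fun k l => ?_⟩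
  rw [← Matrix.one_apply, ← Matrix.nonsing_inv_mul _ hdet]
  rfl

/-- No phase vector `y` makes the entries `sin (β i + ∑ l, B l i * y l)` outside a set of `c`
indices, up to a global factor, positive after the sign twist prescribed by that set. -/
def SineObstruction {d n : ℕ} (c : ℕ) (β : Fin n → ℝ) (B : Matrix (Fin d) (Fin n) ℝ) : Prop :=
  ∀ (M : Finset (Fin n)), M.card = c → ∀ (δ : ℝ) (y : Fin d → ℝ),
    ¬ ∀ i, i ∉ M → 0 < (-1) ^ (M.filter (· < i)).card * (δ * Real.sin (β i + ∑ l, B l i * y l))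

lemma card_compl_insert_image {c d n : ℕ} (hn : n = d + (c + 1)) {r : Fin d → Fin n}
    (hr : Function.Injective r) {j : Fin n} (hj : ∀ m, r m ≠ j) :
    (insert j (Finset.univ.image r))ᶜ.card = c := by
  rw [Finset.card_compl, Finset.card_insert_of_notMem (by simpa using hj),
    Finset.card_image_of_injective _ hr, Finset.card_univ, Fintype.card_fin, Fintype.card_fin]
  omega

lemma SineObstruction.column {c d n : ℕ} (hn : n = d + (c + 1)) {β : Fin n → ℝ}
    {B : Matrix (Fin d) (Fin n) ℝ} (H : SineObstruction c β B) {I : Fin d → Fin n}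
    (hI : ∀ k l, B k (I l) = if k = l then 1 else 0) (hβ : ∀ l, β (I l) = 0) (j : Fin n) :
    Real.sin (β j) = 0 ∧ ((∀ l, B l j = 0) ∨
      ∃ l, (∀ k, k ≠ l → B k j = 0) ∧ (B l j = 1 ∨ B l j = -1)) := by
  by_cases hj : ∃ l, I l = j
  · obtain ⟨l, rfl⟩ := hj
    exact ⟨by simp [hβ], Or.inr ⟨l, fun k hk => by simp [hI, hk], by simp [hI]⟩⟩
  push Not at hj
  have hinj : Function.Injective I := fun k l h => by
    by_contra hkl
    have h1 := hI k k
    rw [h, hI] at h1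
    simp [hkl] at h1
  have hM := card_compl_insert_image hn hinj hj
  set M := (insert j (Finset.univ.image I))ᶜ with hMdef
  have hsum : ∀ l (y : Fin d → ℝ), ∑ k, B k (I l) * y k = y l := by simp [hI]
  have key : ∀ (δ : ℝ) (y : Fin d → ℝ),
      (∀ l, 0 < (-1) ^ (M.filter (· < I l)).card * (δ * Real.sin (y l))) →
      (-1) ^ (M.filter (· < j)).card * (δ * Real.sin (β j + ∑ l, B l j * y l)) ≤ 0 := by
    intro δ y hy
    by_contra! hlt
    refine H M hM δ y fun i hi => ?_
    have hi' : i = j ∨ ∃ l, I l = i := by simpa [hMdef, or_iff_not_imp_left] using hi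
    rcases hi' with rfl | ⟨l, rfl⟩
    · exact hlt
    · rw [hβ, hsum, zero_add]
      exact hy l
  refine eq_zero_or_single_of_sin_sign (fun l => B l j)
    (fun l => (-1) ^ (M.filter (· < I l)).card) (β j) (-(-1) ^ (M.filter (· < j)).card)
    (fun l => neg_one_pow_eq_or ℝ _) (by simp) (fun y hy => ?_) fun y hy => ?_
  · have := key 1 y fun l => by simpa using hy l
    linarith
  · have := key (-1) y fun l => by
      have := hy l
      linarith
    linarith

lemma SineObstruction.mul_neg {c d n : ℕ} (hn : n = d + (c + 1)) {β : Fin n → ℝ}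
    {B : Matrix (Fin d) (Fin n) ℝ} (H : SineObstruction c β B)
    (hsin : ∀ i, Real.sin (β i) = 0)
    (hB : ∀ i l, B l i ≠ 0 → (∀ k, k ≠ l → B k i = 0) ∧ (B l i = 1 ∨ B l i = -1))
    {r : Fin d → Fin n} (hr : ∀ m, B m (r m) ≠ 0) {k : Fin d} {j : Fin n} (hjk : j ≠ r k)
    (hj : B k j ≠ 0) {M : Finset (Fin n)} (hM : M = (insert j (Finset.univ.image r))ᶜ) :
    ((-1) ^ (M.filter (· < r k)).card * (Real.cos (β (r k)) * B k (r k))) *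
      ((-1) ^ (M.filter (· < j)).card * (Real.cos (β j) * B k j)) < 0 := by
  have huniq : ∀ i l m, B l i ≠ 0 → B m i ≠ 0 → m = l := fun i l m hl hm => by
    by_contra h
    exact hm ((hB i l hl).1 m h)
  have hinj : Function.Injective r := fun k l h => huniq (r k) l k (h ▸ hr l) (hr k)
  have hjr : ∀ m, r m ≠ j := fun m h => by
    obtain rfl := huniq j k m hj (h ▸ hr m)
    exact hjk h.symm
  have hcard := card_compl_insert_image hn hinj hjr
  rw [← hM] at hcard
  have hcos : ∀ i, Real.cos (β i) ≠ 0 := fun i hc => by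
    have := Real.sin_sq_add_cos_sq (β i)
    simp [hsin, hc] at this
  set κ : Fin d → Fin n → ℝ := fun m i =>
    (-1) ^ (M.filter (· < i)).card * (Real.cos (β i) * B m i) with hκ
  have hκ0 : ∀ m i, B m i ≠ 0 → κ m i ≠ 0 := fun m i h =>
    mul_ne_zero (by simp) (mul_ne_zero (hcos i) h)
  change κ k (r k) * κ k j < 0
  by_contra! hge
  have hpos := lt_of_le_of_ne hge (mul_ne_zero (hκ0 _ _ (hr k)) (hκ0 _ _ hj)).symm
  set y : Fin d → ℝ := fun m => if 0 < κ m (r m) then Real.pi / 2 else -(Real.pi / 2) with hy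
  have hval : ∀ m i, B m i ≠ 0 → (-1) ^ (M.filter (· < i)).card *
      (1 * Real.sin (β i + ∑ l, B l i * y l)) = κ m i * Real.sin (y m) := by
    intro m i hm
    obtain ⟨h0, h1⟩ := hB i m hm
    rw [Finset.sum_eq_single m (fun l _ hl => by simp [h0 l hl]) (by simp), Real.sin_add, hsin]
    rcases h1 with h | h <;> simp [hκ, h] <;> ring
  have hym : ∀ m, 0 < κ m (r m) * Real.sin (y m) := by
    intro m
    by_cases h : 0 < κ m (r m)
    · simp [hy, h]
    · simpa [hy, h] using lt_of_le_of_ne (not_lt.1 h) (hκ0 _ _ (hr m))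
  refine H M hcard 1 y fun i hi => ?_
  have hi' : i = j ∨ ∃ l, r l = i := by simpa [hM, or_iff_not_imp_left] using hi
  rcases hi' with rfl | ⟨l, rfl⟩
  · rw [hval k i hj]
    have h1 := mul_pos hpos (hym k)
    have h2 : κ k (r k) * κ k i * (κ k (r k) * Real.sin (y k)) =
      κ k (r k) ^ 2 * (κ k i * Real.sin (y k)) := by ring
    rw [h2] at h1
    exact pos_of_mul_pos_right h1 (sq_nonneg _)
  · rw [hval l _ (hr l)]
    exact hym l

lemma SineObstruction.nonCrossingFamily {c d n : ℕ} (hn : n = d + (c + 1)) {β : Fin n → ℝ}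
    {B : Matrix (Fin d) (Fin n) ℝ} (H : SineObstruction c β B)
    (hsin : ∀ i, Real.sin (β i) = 0)
    (hB : ∀ i l, B l i ≠ 0 → (∀ k, k ≠ l → B k i = 0) ∧ (B l i = 1 ∨ B l i = -1))
    {I : Fin d → Fin n} (hI : ∀ m, B m (I m) ≠ 0) :
    NonCrossingFamily (fun k : Fin d => {i : Fin n | B k i ≠ 0}) := by
  refine ⟨fun k l hkl => Set.disjoint_left.2 fun i hk hl => hl ((hB i k hk).1 l hkl.symm), ?_⟩
  rintro ⟨a, b, j, e, k, l, hkl, hab, hbj, hje, ha, hj, hb, he⟩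
  have huniq : ∀ i l m, B l i ≠ 0 → B m i ≠ 0 → m = l := fun i l m hl hm => by
    by_contra h
    exact hm ((hB i l hl).1 m h)
  let r : Fin n → Fin d → Fin n := fun z => Function.update (Function.update I k a) l z
  have hrk : ∀ z, r z k = a := fun z => by simp [r, hkl]
  have hrl : ∀ z, r z l = z := fun z => by simp [r]
  have hro : ∀ z w m, m ≠ l → r z m = r w m := fun z w m hm => by simp [r, hm]
  have hr : ∀ z, B l z ≠ 0 → ∀ m, B m (r z m) ≠ 0 := by
    intro z hz m
    rcases eq_or_ne m l with rfl | hml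
    · rwa [hrl]
    rcases eq_or_ne m k with rfl | hmk
    · rwa [hrk]
    · simpa [r, hml, hmk] using hI m
  let M : Fin n → Finset (Fin n) := fun z => (insert j (Finset.univ.image (r z)))ᶜ
  have hmem : ∀ z i, i ∈ M z ↔ i ≠ j ∧ ∀ m, r z m ≠ i := fun z i => by simp [M]
  have hbM : b ∉ M b := fun h => ((hmem b b).1 h).2 l (hrl b)
  have hother : ∀ i, i ≠ b → i ≠ e → (i ∈ M e ↔ i ∈ M b) := by
    intro i hib hie
    rw [hmem, hmem]
    refine and_congr_right fun _ => forall_congr' fun m => ?_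
    rcases eq_or_ne m l with rfl | hml
    · simp [hrl, hib.symm, hie.symm]
    · rw [hro e b m hml]
  have hbe : b ∈ M e := by
    refine (hmem e b).2 ⟨hbj.ne, fun m hm => ?_⟩
    rcases eq_or_ne m l with rfl | hml
    · rw [hrl] at hm
      exact (hbj.trans hje).ne' hm
    · rw [hro e b m hml] at hm
      exact hml (huniq b l m hb (hm ▸ hr b hb m))
  have hfa : (M e).filter (· < a) = (M b).filter (· < a) := by
    ext i
    simp only [Finset.mem_filter]
    refine and_congr_left fun hi => hother i (hi.trans hab).ne
      (hi.trans (hab.trans (hbj.trans hje))).ne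
  have hfj : (M e).filter (· < j) = insert b ((M b).filter (· < j)) := by
    ext i
    rcases eq_or_ne i b with rfl | hib
    · simp [hbe, hbj]
    · simp only [Finset.mem_filter, Finset.mem_insert, hib, false_or]
      exact and_congr_left fun hi => hother i hib (hi.trans hje).ne
  have h1 := H.mul_neg hn hsin hB (hr b hb) (k := k) (by rw [hrk]; exact (hab.trans hbj).ne')
    hj (M := M b) rfl
  have h2 := H.mul_neg hn hsin hB (hr e he) (k := k) (by rw [hrk]; exact (hab.trans hbj).ne')
    hj (M := M e) rfl
  rw [hrk] at h1 h2
  rw [hfa, hfj, Finset.card_insert_of_notMem (by simp [hbM]), pow_succ] at h2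
  linarith

lemma PosHyperbolic.exists_normal_form {c d n : ℕ} (hn : n = d + (c + 1)) {lam : Fin n → ℂ}
    (hlam : ∀ i, lam i ≠ 0) {A : Matrix (Fin d) (Fin n) ℤ}
    (hA : (A.map ((↑) : ℤ → ℚ)).rank = d) (hX : PosHyperbolic (c + 1) (toricSet lam A)) :
    ∃ g : Matrix (Fin d) (Fin d) ℚ, g.det ≠ 0 ∧
      ∃ B : Matrix (Fin d) (Fin n) ℚ, B = g * A.map ((↑) : ℤ → ℚ) ∧
        (∀ i : Fin n, (∀ k, B k i = 0) ∨
          ∃ k₀ : Fin d, (∀ k, k ≠ k₀ → B k i = 0) ∧ (B k₀ i = 1 ∨ B k₀ i = -1)) ∧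
        NonCrossingFamily (fun k : Fin d => {i : Fin n | B k i ≠ 0}) := by
  obtain ⟨g, I, hg, hI⟩ := exists_mul_submatrix_eq_one _ hA
  obtain ⟨β, hβ, hx⟩ := exists_mem_toricSet_im_eq lam A g I hI
  refine ⟨g, hg, _, rfl, ?_⟩
  set B := g * A.map ((↑) : ℤ → ℚ)
  have H : SineObstruction c β (B.map ((↑) : ℚ → ℝ)) := by
    intro M hM δ y h
    obtain ⟨x, hxm, hxi⟩ := hx y
    refine hX.not_forall_sign (by omega) hxm M hM δ fun i hi => ?_
    have h1 := mul_pos (norm_pos_iff.2 (hlam i)) (h i hi)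
    rw [hxi]
    simp only [Matrix.map_apply] at h1
    linarith
  have hI' : ∀ k l, B.map ((↑) : ℚ → ℝ) k (I l) = if k = l then 1 else 0 := by
    intro k l
    rw [Matrix.map_apply, hI]
    split_ifs <;> simp
  have hcolR := H.column hn hI' hβ
  have hcol : ∀ i : Fin n, (∀ k, B k i = 0) ∨
      ∃ k₀ : Fin d, (∀ k, k ≠ k₀ → B k i = 0) ∧ (B k₀ i = 1 ∨ B k₀ i = -1) := by
    intro i
    have := (hcolR i).2
    simp only [Matrix.map_apply] at this
    exact_mod_cast this
  have hB : ∀ i l, B.map ((↑) : ℚ → ℝ) l i ≠ 0 →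
      (∀ k, k ≠ l → B.map ((↑) : ℚ → ℝ) k i = 0) ∧
        (B.map ((↑) : ℚ → ℝ) l i = 1 ∨ B.map ((↑) : ℚ → ℝ) l i = -1) := by
    intro i l hl
    rcases (hcolR i).2 with h | ⟨m, h0, h1⟩
    · exact absurd (h l) hl
    · obtain rfl : l = m := by
        by_contra hlm
        exact hl (h0 l hlm)
      exact ⟨h0, h1⟩
  refine ⟨hcol, ?_⟩
  have := H.nonCrossingFamily hn (fun i => (hcolR i).1) hB (I := I) fun m => by rw [hI']; simp
  simpa using this

/-- For a `d × n` integer matrix `A` of rank `d` (`1 ≤ d ≤ n-1`), the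
following are equivalent: (1) `X_{λ,A}` is positively hyperbolic of codimension `n-d` for
some `λ ∈ (ℂ*)ⁿ`; (2) the same with `λ ∈ {±1}ⁿ`; (3) after an invertible rational row
operation `g`, every column of `gA` lies in `{0} ∪ {±e₁,…,±e_d}` and the supports of the
rows of `gA` form a non-crossing partition of a subset of `[n]`. -/
theorem stmt12 {d n : ℕ} (hd1 : 1 ≤ d) (hd2 : d ≤ n - 1)
    (A : Matrix (Fin d) (Fin n) ℤ) (hrank : (A.map ((↑) : ℤ → ℚ)).rank = d) :
    ((∃ lam : Fin n → ℂ, (∀ i, lam i ≠ 0) ∧ PosHyperbolic (n - d) (toricSet lam A)) ↔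
      (∃ lam : Fin n → ℂ, (∀ i, lam i = 1 ∨ lam i = -1) ∧
        PosHyperbolic (n - d) (toricSet lam A))) ∧
    ((∃ lam : Fin n → ℂ, (∀ i, lam i ≠ 0) ∧ PosHyperbolic (n - d) (toricSet lam A)) ↔
      (∃ g : Matrix (Fin d) (Fin d) ℚ, g.det ≠ 0 ∧
        ∃ B : Matrix (Fin d) (Fin n) ℚ, B = g * A.map ((↑) : ℤ → ℚ) ∧
          (∀ i : Fin n, (∀ k, B k i = 0) ∨
            ∃ k₀ : Fin d, (∀ k, k ≠ k₀ → B k i = 0) ∧ (B k₀ i = 1 ∨ B k₀ i = -1)) ∧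
          NonCrossingFamily (fun k : Fin d => {i : Fin n | B k i ≠ 0}))) := by
  obtain ⟨c, hc⟩ : ∃ c, n = d + (c + 1) := ⟨n - d - 1, by omega⟩
  have hnd : n - d = c + 1 := by omega
  rw [hnd]
  have h13 : (∃ lam : Fin n → ℂ, (∀ i, lam i ≠ 0) ∧ PosHyperbolic (c + 1) (toricSet lam A)) →
      ∃ g : Matrix (Fin d) (Fin d) ℚ, g.det ≠ 0 ∧
        ∃ B : Matrix (Fin d) (Fin n) ℚ, B = g * A.map ((↑) : ℤ → ℚ) ∧
          (∀ i : Fin n, (∀ k, B k i = 0) ∨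
            ∃ k₀ : Fin d, (∀ k, k ≠ k₀ → B k i = 0) ∧ (B k₀ i = 1 ∨ B k₀ i = -1)) ∧
          NonCrossingFamily (fun k : Fin d => {i : Fin n | B k i ≠ 0}) :=
    fun ⟨_, hlam, hX⟩ => hX.exists_normal_form hc hlam hrank
  have h21 : (∃ lam : Fin n → ℂ, (∀ i, lam i = 1 ∨ lam i = -1) ∧
      PosHyperbolic (c + 1) (toricSet lam A)) →
      ∃ lam : Fin n → ℂ, (∀ i, lam i ≠ 0) ∧ PosHyperbolic (c + 1) (toricSet lam A) :=
    fun ⟨lam, hlam, hX⟩ => ⟨lam, fun i => by rcases hlam i with h | h <;> simp [h], hX⟩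
  have h32 := fun h => h13 h |>.elim fun g ⟨hg, B, hB, hcol, hnc⟩ =>
    exists_posHyperbolic_toricSet hd1 hc A g hg B hB hcol hnc
  exact ⟨⟨h32, h21⟩, h13, fun ⟨g, hg, B, hB, hcol, hnc⟩ =>
    h21 (exists_posHyperbolic_toricSet hd1 hc A g hg B hB hcol hnc)⟩
end

section
/- Let f ∈ ℂ[x_1, …, x_n] be a nonzero homogeneous stable polynomial. Then the support of f equals the set of lattice points of its Newton polytope: supp(f) = Newt(f) ∩ ℤ^n. That is, every integer point in the convex hull of the exponent vectors of f is itself the exponent vector of a monomial appearing in f. -/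
/-- The Newton polytope of a polynomial: the convex hull of its exponent vectors in `ℝⁿ`. -/
def newt {n : ℕ} (f : MvPolynomial (Fin n) ℂ) : Set (Fin n → ℝ) :=
  convexHull ℝ ((fun m : Fin n →₀ ℕ => fun i => (m i : ℝ)) '' ↑f.support)

open MvPolynomial

theorem MvPolynomial.IsHomogeneous.eval_smul_eq_pow_mul {σ : Type*} {d : ℕ} {f : MvPolynomial σ ℂ}
    (hf : f.IsHomogeneous d) (c : ℂ) (z : σ → ℂ) : eval (c • z) f = c ^ d * eval z f := by
  rw [eval_eq, eval_eq, Finset.mul_sum]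
  refine Finset.sum_congr rfl fun m hm => ?_
  simp only [Pi.smul_apply, smul_eq_mul, mul_pow, Finset.prod_mul_distrib,
    Finset.prod_pow_eq_pow_sum]
  have : ∑ i ∈ m.support, m i = d := by
    rw [← Finsupp.degree_apply, Finsupp.degree_eq_weight_one]
    exact hf (mem_support_iff.mp hm)
  rw [this]; ring

/-- If all roots of `p` are negative reals, then on `[0, ∞)` the ratio `p(t) / p(0)` is positive and
at most `exp (t * p'(0) / p(0))`. -/
theorem Polynomial.exists_eval_le_exp_of_roots_neg (p : Polynomial ℂ) (h0 : p.eval 0 ≠ 0)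
    (hr : ∀ ρ ∈ p.roots, ∃ a : ℝ, a < 0 ∧ ρ = a) :
    ∃ S : ℝ, 0 ≤ S ∧ p.derivative.eval 0 = p.eval 0 * S ∧
      ∀ t : ℝ, 0 ≤ t → ∃ P : ℝ, 0 < P ∧ P ≤ Real.exp (t * S) ∧ p.eval (t : ℂ) = p.eval 0 * P := by
  have hs := IsAlgClosed.splits p
  have key : ∀ m : Multiset ℂ, (∀ ρ ∈ m, ∃ a : ℝ, a < 0 ∧ ρ = a) →
      ∃ S : ℝ, 0 ≤ S ∧ (m.map fun z => 1 / (0 - z)).sum = (S : ℂ) ∧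
      ∀ t : ℝ, 0 ≤ t → ∃ P : ℝ, 0 < P ∧ P ≤ Real.exp (t * S) ∧
        (m.map fun z => (t : ℂ) - z).prod = (m.map fun z => 0 - z).prod * P := by
    intro m
    induction m using Multiset.induction with
    | empty => exact fun _ => ⟨0, le_rfl, by simp, fun t _ => ⟨1, by simp⟩⟩
    | cons ρ m ih =>
      intro h
      obtain ⟨S, hS, hsum, hP⟩ := ih fun z hz => h z (Multiset.mem_cons_of_mem hz)
      obtain ⟨a, ha, rfl⟩ := h ρ (Multiset.mem_cons_self _ _)
      have hb : 0 < 1 / (0 - a) := by apply one_div_pos.mpr; linarith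
      refine ⟨1 / (0 - a) + S, by positivity, ?_, fun t ht => ?_⟩
      · rw [Multiset.map_cons, Multiset.sum_cons, hsum]
        push_cast
        rfl
      obtain ⟨P, hP0, hPe, hPt⟩ := hP t ht
      refine ⟨(t * (1 / (0 - a)) + 1) * P, by positivity, ?_, ?_⟩
      · rw [mul_add, Real.exp_add]
        exact mul_le_mul (Real.add_one_le_exp _) hPe hP0.le (Real.exp_pos _).le
      · have ha' : (a : ℂ) ≠ 0 := by exact_mod_cast ha.ne
        simp only [Multiset.map_cons, Multiset.prod_cons, hPt]
        push_cast
        have : (0 - (a : ℂ)) ≠ 0 := by simpa using ha'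
        field_simp
        ring
  obtain ⟨S, hS, hsum, hP⟩ := key p.roots hr
  refine ⟨S, hS, by rw [hs.eval_derivative_eq_eval_mul_sum h0, hsum], fun t ht => ?_⟩
  obtain ⟨P, hP0, hPe, hPt⟩ := hP t ht
  refine ⟨P, hP0, hPe, ?_⟩
  rw [hs.eval_eq_prod_roots, hPt, hs.eval_eq_prod_roots 0, mul_assoc]

/-- If all roots of a nonconstant `p` lie in the open lower half-plane, then its derivative does not
vanish at `0`. -/
theorem Polynomial.eval_zero_derivative_ne_zero_of_roots_im_neg (p : Polynomial ℂ)
    (h0 : p.eval 0 ≠ 0) (hd : p.natDegree ≠ 0) (hr : ∀ ρ ∈ p.roots, ρ.im < 0) :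
    p.derivative.eval 0 ≠ 0 := by
  have hs := IsAlgClosed.splits p
  rw [hs.eval_derivative_eq_eval_mul_sum h0]
  refine mul_ne_zero h0 fun h => ?_
  have key : ∀ m : Multiset ℂ, (∀ ρ ∈ m, ρ.im < 0) →
      (m.map fun z => 1 / (0 - z)).sum.im ≤ 0 ∧
        (m ≠ 0 → (m.map fun z => 1 / (0 - z)).sum.im < 0) := by
    intro m
    induction m using Multiset.induction with
    | empty => simp
    | cons ρ m ih =>
      intro h
      have h1 := (ih fun z hz => h z (Multiset.mem_cons_of_mem hz)).1
      have h2 := h ρ (Multiset.mem_cons_self _ _)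
      have h3 : (1 / (0 - ρ)).im < 0 := by
        have hρ : ρ ≠ 0 := by rintro rfl; simp at h2
        have := Complex.normSq_pos.mpr hρ
        simp only [zero_sub, one_div, Complex.inv_im, Complex.neg_im, neg_neg, Complex.normSq_neg]
        exact div_neg_of_neg_of_pos h2 this
      rw [Multiset.map_cons, Multiset.sum_cons, Complex.add_im]
      exact ⟨by linarith, fun _ => by linarith⟩
  have hne : p.roots ≠ 0 := by
    intro h
    rw [hs.natDegree_eq_card_roots, h] at hd
    simp at hd
  have := (key _ hr).2 hne
  rw [h] at this
  simp at this

/-- The directional derivative `∑ i, e i * ∂f/∂xᵢ`. -/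
noncomputable def MvPolynomial.dirDeriv {σ : Type*} [Fintype σ] (e : σ → ℂ) (f : MvPolynomial σ ℂ) :
    MvPolynomial σ ℂ := ∑ i, C (e i) * pderiv i f

/-- The univariate polynomial `t ↦ f (z + t e)`. -/
noncomputable def MvPolynomial.restrictLine {σ : Type*} (z e : σ → ℂ) (f : MvPolynomial σ ℂ) :
    Polynomial ℂ := aeval (fun i => Polynomial.C (z i) + Polynomial.C (e i) * Polynomial.X) f

theorem MvPolynomial.eval_restrictLine {σ : Type*} (z e : σ → ℂ) (f : MvPolynomial σ ℂ) (t : ℂ) :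
    (restrictLine z e f).eval t = eval (z + t • e) f := by
  unfold restrictLine
  induction f using MvPolynomial.induction_on with
  | C a => simp
  | add p q hp hq => simp [hp, hq]
  | mul_X p i hp => simp [hp, mul_comm t]

theorem MvPolynomial.eval_zero_derivative_restrictLine {σ : Type*} [Fintype σ] (z e : σ → ℂ)
    (f : MvPolynomial σ ℂ) :
    (restrictLine z e f).derivative.eval 0 = eval z (dirDeriv e f) := by
  classical
  unfold dirDeriv
  induction f using MvPolynomial.induction_on with
  | C a => simp [restrictLine]
  | add p q hp hq =>
    simp only [restrictLine, map_add, Polynomial.eval_add, mul_add,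
      Finset.sum_add_distrib] at *
    rw [hp, hq]
  | mul_X p i hp =>
    have h := eval_restrictLine z e p 0
    simp only [restrictLine, zero_smul, add_zero] at *
    simp only [map_mul, map_add, aeval_X, Polynomial.derivative_mul, Polynomial.eval_add,
      Polynomial.eval_mul, hp, h, map_sum, Derivation.leibniz, smul_eq_mul, mul_add,
      Finset.sum_add_distrib, Finset.sum_mul, pderiv_X, Pi.single_apply]
    simp [mul_comm, mul_left_comm, add_comm]

theorem MvPolynomial.IsHomogeneous.dirDeriv {σ : Type*} [Fintype σ] {d : ℕ} {f : MvPolynomial σ ℂ}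
    (hf : f.IsHomogeneous (d + 1)) (e : σ → ℂ) : (dirDeriv e f).IsHomogeneous d :=
  IsHomogeneous.sum _ _ _ fun i _ => (hf.pderiv (i := i)).C_mul (e i)

section PosStable

variable {n d : ℕ} {f : MvPolynomial (Fin n) ℂ}

theorem IsStable.eval_ofReal_ne_zero (hs : IsStable f) (hf : f.IsHomogeneous d) {x : Fin n → ℝ}
    (hx : ∀ i, 0 < x i) : eval (fun i => (x i : ℂ)) f ≠ 0 := by
  have h := hs (Complex.I • fun i => (x i : ℂ)) (by simpa using hx)
  rw [hf.eval_smul_eq_pow_mul] at h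
  exact right_ne_zero_of_mul h

theorem IsStable.roots_restrictLine_neg (hs : IsStable f) (hf : f.IsHomogeneous d)
    {x e : Fin n → ℝ} (hx : ∀ i, 0 < x i) (he : ∀ i, 0 < e i) (ρ : ℂ)
    (hρ : ρ ∈ (restrictLine (fun i => (x i : ℂ)) (fun i => (e i : ℂ)) f).roots) :
    ∃ a : ℝ, a < 0 ∧ ρ = a := by
  have h0 := (Polynomial.mem_roots'.mp hρ).2
  rw [Polynomial.IsRoot, eval_restrictLine] at h0
  rcases lt_trichotomy ρ.im 0 with h | h | h
  · have h1 := hf.eval_smul_eq_pow_mul (-1) ((fun i => (x i : ℂ)) + ρ • fun i => (e i : ℂ))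
    rw [h0, mul_zero] at h1
    refine absurd h1 (hs _ fun i => ?_)
    have := mul_neg_of_neg_of_pos h (he i)
    simpa using this
  · obtain ⟨a, rfl⟩ : ∃ a : ℝ, ρ = a := ⟨ρ.re, Complex.ext (by simp) (by simpa using h)⟩
    refine ⟨a, not_le.mp fun ha => ?_, rfl⟩
    refine hs.eval_ofReal_ne_zero hf (x := x + a • e) (fun i => ?_) ?_
    · have := mul_nonneg ha (he i).le
      simpa using add_pos_of_pos_of_nonneg (hx i) this
    · convert h0 using 3
      ext i
      simp
  · refine absurd h0 (hs _ fun i => ?_)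
    simpa using mul_pos h (he i)

theorem IsStable.exists_eval_add_le_exp (hs : IsStable f) (hf : f.IsHomogeneous d)
    {x e : Fin n → ℝ} (hx : ∀ i, 0 < x i) (he : ∀ i, 0 < e i) :
    ∃ S : ℝ, 0 ≤ S ∧ eval (fun i => (x i : ℂ)) (dirDeriv (fun i => (e i : ℂ)) f) =
        eval (fun i => (x i : ℂ)) f * S ∧
      ∀ t : ℝ, 0 ≤ t → ∃ P : ℝ, 0 < P ∧ P ≤ Real.exp (t * S) ∧
        eval (fun i => ((x i + t * e i : ℝ) : ℂ)) f = eval (fun i => (x i : ℂ)) f * P := by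
  have h := Polynomial.exists_eval_le_exp_of_roots_neg
    (restrictLine (fun i => (x i : ℂ)) (fun i => (e i : ℂ)) f)
    (by simpa [eval_restrictLine] using hs.eval_ofReal_ne_zero hf hx)
    (hs.roots_restrictLine_neg hf hx he)
  simp only [eval_zero_derivative_restrictLine, eval_restrictLine, zero_smul, add_zero] at h
  obtain ⟨S, hS, hSx, hP⟩ := h
  refine ⟨S, hS, hSx, fun t ht => ?_⟩
  obtain ⟨P, hP0, hPe, hPx⟩ := hP t ht
  refine ⟨P, hP0, hPe, hPx ▸ ?_⟩
  congr 2
  ext i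
  simp

theorem IsStable.dirDeriv (hs : IsStable f) (hf : f.IsHomogeneous (d + 1))
    {e : Fin n → ℝ} (he : ∀ i, 0 < e i) : IsStable (dirDeriv (fun i => (e i : ℂ)) f) := by
  intro z hz
  rw [← eval_zero_derivative_restrictLine]
  have h0 : (restrictLine z (fun i => (e i : ℂ)) f).eval 0 ≠ 0 := by
    simpa [eval_restrictLine] using hs z hz
  refine Polynomial.eval_zero_derivative_ne_zero_of_roots_im_neg _ h0 (fun hd => ?_) fun ρ hρ => ?_
  · refine hs.eval_ofReal_ne_zero hf he ?_
    obtain ⟨c, hc⟩ := Polynomial.natDegree_eq_zero.mp hd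
    have h1 : ∀ t : ℝ, 0 < t →
        eval ((t : ℂ) • z + fun i => (e i : ℂ)) f = (t : ℂ) ^ (d + 1) * c := by
      intro t ht
      have ht' : (t : ℂ) ≠ 0 := by exact_mod_cast ht.ne'
      have h2 := eval_restrictLine z (fun i => (e i : ℂ)) f (t : ℂ)⁻¹
      rw [← hc, Polynomial.eval_C] at h2
      rw [h2, ← hf.eval_smul_eq_pow_mul, smul_add, smul_smul, mul_inv_cancel₀ ht', one_smul]
    have hl : Continuous fun t : ℝ => eval ((t : ℂ) • z + fun i => (e i : ℂ)) f := by
      refine (MvPolynomial.continuous_eval f).comp ?_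
      fun_prop
    have hr : Continuous fun t : ℝ => (t : ℂ) ^ (d + 1) * c := by fun_prop
    have h3 := (hl.tendsto 0).mono_left (nhdsWithin_le_nhds (s := Set.Ioi 0))
    have h4 := (hr.tendsto 0).mono_left (nhdsWithin_le_nhds (s := Set.Ioi 0))
    have h5 := tendsto_nhds_unique_of_eventuallyEq h3 h4
      (Filter.eventually_of_mem self_mem_nhdsWithin fun t ht => h1 t ht)
    simpa using h5
  · have h1 := (Polynomial.mem_roots'.mp hρ).2
    rw [Polynomial.IsRoot, eval_restrictLine] at h1
    by_contra! him
    refine hs _ (fun i => ?_) h1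
    have := add_pos_of_pos_of_nonneg (hz i) (mul_nonneg him (he i).le)
    simpa using this

/-- Homogeneous stable polynomials of degree `d` that are positive on the positive orthant. -/
structure IsPosStable (d : ℕ) (f : MvPolynomial (Fin n) ℂ) : Prop where
  isHomogeneous : f.IsHomogeneous d
  isStable : IsStable f
  eval_pos : ∀ x : Fin n → ℝ, (∀ i, 0 < x i) → ∃ r : ℝ, 0 < r ∧ eval (fun i => (x i : ℂ)) f = r

theorem IsPosStable.dirDeriv (hf : IsPosStable (d + 1) f) {e : Fin n → ℝ} (he : ∀ i, 0 < e i) :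
    IsPosStable d (dirDeriv (fun i => (e i : ℂ)) f) where
  isHomogeneous := hf.isHomogeneous.dirDeriv _
  isStable := hf.isStable.dirDeriv hf.isHomogeneous he
  eval_pos x hx := by
    obtain ⟨r, hr, hrx⟩ := hf.eval_pos x hx
    obtain ⟨S, hS, hSx, -⟩ := hf.isStable.exists_eval_add_le_exp hf.isHomogeneous hx he
    have hne := (hf.isStable.dirDeriv hf.isHomogeneous he).eval_ofReal_ne_zero
      (hf.isHomogeneous.dirDeriv _) hx
    refine ⟨r * S, mul_pos hr (hS.lt_of_ne' ?_), by rw [hSx, hrx]; push_cast; rfl⟩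
    rintro rfl
    simp [hSx] at hne

/-- A monomial lower bound of a positive stable polynomial passes to directional derivatives. -/
theorem IsPosStable.le_dirDeriv (hf : IsPosStable (d + 1) f) {e : Fin n → ℝ} (he : ∀ i, 0 < e i)
    {i : Fin n} (hi : 1 ≤ e i) {m : Fin n →₀ ℕ} {c : ℝ} (hc : 0 ≤ c)
    (hb : ∀ x : Fin n → ℝ, (∀ j, 0 < x j) →
      c * ∏ j, x j ^ (m + Finsupp.single i 1 : Fin n →₀ ℕ) j ≤ (eval (fun j => (x j : ℂ)) f).re)
    {x : Fin n → ℝ} (hx : ∀ j, 0 < x j) :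
    c / Real.exp 1 * ∏ j, x j ^ m j ≤
      (eval (fun j => (x j : ℂ)) (MvPolynomial.dirDeriv (fun j => (e j : ℂ)) f)).re := by
  obtain ⟨r, hr, hrx⟩ := hf.eval_pos x hx
  obtain ⟨q, hq, hqx⟩ := (hf.dirDeriv he).eval_pos x hx
  obtain ⟨S, hS, hSx, hP⟩ := hf.isStable.exists_eval_add_le_exp hf.isHomogeneous hx he
  have hqS : q = r * S := by
    rw [hqx, hrx] at hSx
    exact_mod_cast hSx
  have hS0 : 0 < S := pos_of_mul_pos_right (hqS ▸ hq) hr.le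
  obtain ⟨P, hP0, hPe, hPx⟩ := hP S⁻¹ (by positivity)
  rw [inv_mul_cancel₀ hS0.ne'] at hPe
  have hy : ∀ j, x j ≤ x j + S⁻¹ * e j := fun j => by
    have := he j
    have : 0 < S⁻¹ * e j := by positivity
    linarith
  have h1 := hb (fun j => x j + S⁻¹ * e j) fun j => (hx j).trans_le (hy j)
  rw [hPx, hrx, ← Complex.ofReal_mul, Complex.ofReal_re] at h1
  have h2 : S⁻¹ * ∏ j, x j ^ m j ≤
      ∏ j, (x j + S⁻¹ * e j) ^ (m + Finsupp.single i 1 : Fin n →₀ ℕ) j := by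
    have h3 : ∏ j, (x j + S⁻¹ * e j) ^ (Finsupp.single i 1 : Fin n →₀ ℕ) j = x i + S⁻¹ * e i := by
      rw [Finset.prod_eq_single i] <;> simp +contextual [eq_comm]
    simp only [Finsupp.add_apply, pow_add, Finset.prod_mul_distrib, h3]
    rw [mul_comm]
    refine mul_le_mul ?_ ?_ (by positivity) ?_
    · exact Finset.prod_le_prod (fun j _ => pow_nonneg (hx j).le _)
        fun j _ => pow_le_pow_left₀ (hx j).le (hy j) _
    · have := mul_le_mul_of_nonneg_left hi (inv_pos.mpr hS0).le
      have := hx i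
      linarith
    · exact Finset.prod_nonneg fun j _ => pow_nonneg ((hx j).le.trans (hy j)) _
  have h4 := (mul_le_mul_of_nonneg_left h2 hc).trans h1
  have h5 := h4.trans (mul_le_mul_of_nonneg_left hPe hr.le)
  rw [hqx, Complex.ofReal_re, hqS, div_mul_eq_mul_div, div_le_iff₀ (Real.exp_pos _)]
  calc c * ∏ j, x j ^ m j = c * (S⁻¹ * ∏ j, x j ^ m j) * S := by field_simp
    _ ≤ r * Real.exp 1 * S := mul_le_mul_of_nonneg_right h5 hS
    _ = _ := by ring

theorem MvPolynomial.coeff_dirDeriv_ite_add (f : MvPolynomial (Fin n) ℂ) (m : Fin n →₀ ℕ)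
    (i : Fin n) (ε : ℝ) :
    coeff m (dirDeriv (fun j => (((if j = i then 1 else 0) + ε : ℝ) : ℂ)) f) =
      coeff m (pderiv i f) + ε * ∑ j, coeff m (pderiv j f) := by
  simp [dirDeriv, coeff_sum, coeff_C_mul, add_mul, Finset.sum_add_distrib, Finset.mul_sum,
    apply_ite]

theorem Finsupp.exists_eq_add_single_of_degree_eq_succ {σ : Type*} {m : σ →₀ ℕ} {d : ℕ}
    (hm : m.degree = d + 1) :
    ∃ m' i, m = m' + Finsupp.single i 1 ∧ m'.degree = d := by
  obtain ⟨i, hi⟩ : ∃ i, m i ≠ 0 := by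
    by_contra! h
    obtain rfl : m = 0 := Finsupp.ext h
    simp at hm
  have h : m = m - Finsupp.single i 1 + Finsupp.single i 1 :=
    (tsub_add_cancel_of_le (by simpa using Nat.one_le_iff_ne_zero.mpr hi)).symm
  rw [h] at hm
  exact ⟨_, i, h, by simpa using hm⟩

/-- A monomial lower bound on the positive orthant bounds the corresponding coefficient below. -/
theorem IsPosStable.exists_forall_le_coeff (n d : ℕ) :
    ∃ κ : ℝ, 0 < κ ∧ ∀ (f : MvPolynomial (Fin n) ℂ), IsPosStable d f → ∀ m : Fin n →₀ ℕ,
      m.degree = d → ∀ c : ℝ, 0 ≤ c →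
      (∀ x : Fin n → ℝ, (∀ j, 0 < x j) →
        c * ∏ j, x j ^ m j ≤ (eval (fun j => (x j : ℂ)) f).re) →
      κ * c ≤ (coeff m f).re := by
  induction d with
  | zero =>
    refine ⟨1, one_pos, fun f hf m hm c hc hb => ?_⟩
    obtain rfl : m = 0 := (Finsupp.degree_eq_zero_iff m).mp hm
    have h0 := (totalDegree_zero_iff_isHomogeneous (p := f)).mpr hf.isHomogeneous
    rw [totalDegree_eq_zero_iff_eq_C] at h0
    have h1 := hb (fun _ => 1) fun _ => one_pos
    rw [h0] at h1
    simpa using h1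
  | succ d ih =>
    obtain ⟨κ, hκ, ih⟩ := ih
    refine ⟨κ / (Real.exp 1 * (d + 1)), by positivity, fun f hf m hm c hc hb => ?_⟩
    obtain ⟨m, i, rfl, hm'⟩ := Finsupp.exists_eq_add_single_of_degree_eq_succ hm
    have hε : ∀ ε : ℝ, 0 < ε → κ * (c / Real.exp 1) ≤
        (coeff m (pderiv i f)).re + ε * ∑ j, (coeff m (pderiv j f)).re := by
      intro ε hε
      have he : ∀ j, 0 < (if j = i then 1 else 0) + ε := fun j => by split_ifs <;> positivity
      have h := ih _ (hf.dirDeriv he) m hm' (c / Real.exp 1) (by positivity)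
        fun x hx => hf.le_dirDeriv he (i := i) (by simpa using hε.le) hc hb hx
      refine h.trans_eq ?_
      rw [coeff_dirDeriv_ite_add, Complex.add_re, Complex.re_ofReal_mul, Complex.re_sum]
    have hlim : κ * (c / Real.exp 1) ≤ (coeff m (pderiv i f)).re := by
      have ht : Continuous fun ε : ℝ =>
        (coeff m (pderiv i f)).re + ε * ∑ j, (coeff m (pderiv j f)).re := by fun_prop
      have := ge_of_tendsto ((ht.tendsto 0).mono_left (nhdsWithin_le_nhds (s := Set.Ioi 0)))
        (Filter.eventually_of_mem self_mem_nhdsWithin fun ε h => hε ε h)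
      simpa using this
    have hco : (coeff m (pderiv i f)).re =
        (coeff (m + Finsupp.single i 1) f).re * (m i + 1 : ℝ) := by
      rw [coeff_pderiv]
      simp
    rw [hco] at hlim
    have hmi : (m i : ℝ) ≤ d := by exact_mod_cast hm' ▸ Finsupp.le_degree i m
    have hnn : 0 ≤ (coeff (m + Finsupp.single i 1) f).re :=
      nonneg_of_mul_nonneg_left (le_trans (by positivity) hlim) (by positivity)
    have h2 := hlim.trans (mul_le_mul_of_nonneg_left (show (m i + 1 : ℝ) ≤ d + 1 by linarith) hnn)
    calc κ / (Real.exp 1 * (d + 1)) * c = κ * (c / Real.exp 1) / (d + 1) := by field_simp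
      _ ≤ _ := by rwa [div_le_iff₀ (by positivity)]

theorem IsPosStable.coeff_re_nonneg (hf : IsPosStable d f) (m : Fin n →₀ ℕ) :
    0 ≤ (coeff m f).re := by
  by_cases hm : m.degree = d
  · obtain ⟨κ, -, h⟩ := IsPosStable.exists_forall_le_coeff n d
    refine (h f hf m hm 0 le_rfl fun x hx => ?_).trans_eq' (by simp)
    obtain ⟨r, hr, hrx⟩ := hf.eval_pos x hx
    simpa [hrx] using hr.le
  · rw [hf.isHomogeneous.coeff_eq_zero hm, Complex.zero_re]

theorem IsPosStable.coeff_im_eq_zero (hf : IsPosStable d f) (m : Fin n →₀ ℕ) :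
    (coeff m f).im = 0 := by
  by_cases hm : m.degree = d
  swap
  · rw [hf.isHomogeneous.coeff_eq_zero hm, Complex.zero_im]
  induction d generalizing f m with
  | zero =>
    obtain rfl : m = 0 := (Finsupp.degree_eq_zero_iff m).mp hm
    have h0 := (totalDegree_zero_iff_isHomogeneous (p := f)).mpr hf.isHomogeneous
    rw [totalDegree_eq_zero_iff_eq_C] at h0
    obtain ⟨r, -, hr⟩ := hf.eval_pos (fun _ => 1) fun _ => one_pos
    rw [h0, eval_C] at hr
    simp [hr]
  | succ d ih =>
    obtain ⟨m, i, rfl, hm'⟩ := Finsupp.exists_eq_add_single_of_degree_eq_succ hm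
    have h : ∀ ε : ℝ, 0 < ε →
        (coeff m (pderiv i f)).im + ε * (∑ j, coeff m (pderiv j f)).im = 0 := by
      intro ε hε
      have he : ∀ j, 0 < (if j = i then 1 else 0) + ε := fun j => by split_ifs <;> positivity
      have h := ih (hf.dirDeriv he) m hm'
      rwa [coeff_dirDeriv_ite_add, Complex.add_im, Complex.im_ofReal_mul] at h
    have h0 : (coeff m (pderiv i f)).im = 0 := by
      linarith [h 1 one_pos, h 2 two_pos]
    have hc : ((m i : ℂ) + 1) = ((m i + 1 : ℝ) : ℂ) := by push_cast; rfl
    rw [coeff_pderiv, hc, Complex.im_mul_ofReal] at h0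
    exact (mul_eq_zero.mp h0).resolve_right (by positivity)

/-- After normalization, a homogeneous stable polynomial is positive on the positive orthant. -/
theorem IsStable.isPosStable (hs : IsStable f) (hf : f.IsHomogeneous d) :
    IsPosStable d (C (eval (fun _ => 1) f)⁻¹ * f) := by
  have h1 : eval (fun _ => 1) f ≠ 0 := by
    simpa using hs.eval_ofReal_ne_zero hf (x := fun _ => 1) fun _ => one_pos
  refine ⟨hf.C_mul _, fun z hz => by simpa [h1] using hs z hz, fun x hx => ?_⟩
  obtain ⟨l, hl, hlx⟩ : ∃ l : ℝ, 0 < l ∧ ∀ i, 1 < l * x i := by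
    refine ⟨1 + ∑ i, (x i)⁻¹, ?_, fun i => ?_⟩
    · exact add_pos_of_pos_of_nonneg one_pos (Finset.sum_nonneg fun i _ => (inv_pos.mpr (hx i)).le)
    · have := Finset.single_le_sum (f := fun i => (x i)⁻¹) (fun i _ => (inv_pos.mpr (hx i)).le)
        (Finset.mem_univ i)
      rw [← div_lt_iff₀ (hx i), one_div]
      linarith
  obtain ⟨S, -, -, hP⟩ := hs.exists_eval_add_le_exp hf (x := fun _ => 1)
    (e := fun i => l * x i - 1) (fun _ => one_pos) fun i => sub_pos.mpr (hlx i)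
  obtain ⟨P, hP0, -, hPx⟩ := hP 1 zero_le_one
  have hl' : (l : ℂ) ^ d ≠ 0 := pow_ne_zero _ (by exact_mod_cast hl.ne')
  have h2 := hf.eval_smul_eq_pow_mul (l : ℂ) fun i => (x i : ℂ)
  have h3 : ((l : ℂ) • fun i => (x i : ℂ)) = fun i => ((1 + 1 * (l * x i - 1) : ℝ) : ℂ) := by
    ext i
    simp
  rw [h3, hPx] at h2
  refine ⟨P / l ^ d, by positivity, ?_⟩
  simp only [Complex.ofReal_one] at h2
  simp only [map_mul, eval_C]
  push_cast
  field_simp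
  linear_combination -h2

theorem IsPosStable.coeff_ne_zero_of_mem_convexHull (hf : IsPosStable d f) {m : Fin n →₀ ℕ}
    (hd : m.degree = d) (hm : (fun i => (m i : ℝ)) ∈
      convexHull ℝ ((fun m : Fin n →₀ ℕ => fun i => (m i : ℝ)) '' (f.support : Set (Fin n →₀ ℕ)))) :
    coeff m f ≠ 0 := by
  have hre : ∀ b ∈ f.support, 0 < (coeff b f).re := by
    refine fun b hb => (hf.coeff_re_nonneg b).lt_of_ne' fun h => ?_
    exact mem_support_iff.mp hb (Complex.ext h (hf.coeff_im_eq_zero b))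
  obtain ⟨c, hc, hcb⟩ : ∃ c : ℝ, 0 < c ∧ ∀ b ∈ f.support, c ≤ (coeff b f).re := by
    rcases f.support.eq_empty_or_nonempty with h | h
    · exact ⟨1, one_pos, by simp [h]⟩
    · obtain ⟨b, hb, hmin⟩ := f.support.exists_min_image (fun b => (coeff b f).re) h
      exact ⟨_, hre b hb, hmin⟩
  obtain ⟨κ, hκ, h⟩ := IsPosStable.exists_forall_le_coeff n d
  have hpos := h f hf m hd c hc.le fun x hx => ?_
  · intro h0
    rw [h0, Complex.zero_re] at hpos
    exact (mul_pos hκ hc).not_ge hpos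
  have hL : ConvexOn ℝ Set.univ fun y : Fin n → ℝ => ∑ i, y i * Real.log (x i) :=
    (∑ i, (LinearMap.proj i : (Fin n → ℝ) →ₗ[ℝ] ℝ).smulRight (Real.log (x i))).convexOn convex_univ
      |>.congr fun y _ => by simp
  obtain ⟨_, ⟨b, hb, rfl⟩, hle⟩ := hL.exists_ge_of_mem_convexHull (Set.subset_univ _) hm
  have hprod : ∀ b : Fin n →₀ ℕ,
      ∏ j, x j ^ b j = Real.exp (∑ j, (b j : ℝ) * Real.log (x j)) := fun b => by
    rw [Real.exp_sum]
    refine Finset.prod_congr rfl fun j _ => ?_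
    rw [Real.exp_nat_mul, Real.exp_log (hx j)]
  have hxb : ∏ j, x j ^ m j ≤ ∏ j, x j ^ b j := by
    rw [hprod, hprod]
    exact Real.exp_le_exp.mpr hle
  have heval : (eval (fun j => (x j : ℂ)) f).re =
      ∑ b ∈ f.support, (coeff b f).re * ∏ j, x j ^ b j := by
    rw [eval_eq', Complex.re_sum]
    refine Finset.sum_congr rfl fun b _ => ?_
    rw [← Complex.re_mul_ofReal]
    push_cast
    rfl
  have hpb : ∀ b : Fin n →₀ ℕ, 0 ≤ ∏ j, x j ^ b j := fun b =>
    Finset.prod_nonneg fun j _ => pow_nonneg (hx j).le _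
  rw [heval]
  calc c * ∏ j, x j ^ m j ≤ (coeff b f).re * ∏ j, x j ^ b j :=
        mul_le_mul (hcb b hb) hxb (hpb m) (hre b hb).le
    _ ≤ _ := Finset.single_le_sum (f := fun b => (coeff b f).re * ∏ j, x j ^ b j)
        (fun b hb => mul_nonneg (hre b hb).le (hpb b)) hb

theorem MvPolynomial.IsHomogeneous.mem_convexHull_support (hf : f.IsHomogeneous d)
    {y : Fin n → ℝ} (hy : y ∈
      convexHull ℝ ((fun m : Fin n →₀ ℕ => fun i => (m i : ℝ)) '' (f.support : Set (Fin n →₀ ℕ)))) :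
    (∀ i, 0 ≤ y i) ∧ ∑ i, y i = d := by
  have hconv : Convex ℝ {y : Fin n → ℝ | (∀ i, 0 ≤ y i) ∧ ∑ i, y i = d} := by
    rintro u ⟨hu, hus⟩ v ⟨hv, hvs⟩ a b ha hb hab
    refine ⟨fun i => ?_, ?_⟩
    · have := hu i
      have := hv i
      simp only [Pi.add_apply, Pi.smul_apply, smul_eq_mul]
      positivity
    · simp only [Pi.add_apply, Pi.smul_apply, smul_eq_mul, Finset.sum_add_distrib,
        ← Finset.mul_sum, hus, hvs]
      rw [← add_mul, hab, one_mul]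
  refine convexHull_min ?_ hconv hy
  rintro _ ⟨m, hm, rfl⟩
  refine ⟨fun i => Nat.cast_nonneg _, ?_⟩
  have h : m.degree = d := by
    rw [Finsupp.degree_eq_weight_one]
    exact hf (mem_support_iff.mp hm)
  rw [Finsupp.degree_eq_sum] at h
  show ∑ i, (m i : ℝ) = d
  exact_mod_cast h

end PosStable

/-- The support of a nonzero homogeneous stable polynomial is exactly the
set of lattice points of its Newton polytope. -/
theorem stmt14 {n dgr : ℕ} (f : MvPolynomial (Fin n) ℂ) (hf0 : f ≠ 0)
    (hhom : f.IsHomogeneous dgr) (hstab : IsStable f) :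
    (fun m : Fin n →₀ ℕ => fun i => (m i : ℝ)) '' ↑f.support =
      {x : Fin n → ℝ | x ∈ newt f ∧ ∀ i, ∃ z : ℤ, x i = (z : ℝ)} := by
  refine Set.Subset.antisymm ?_ ?_
  · rintro _ ⟨m, hm, rfl⟩
    exact ⟨subset_convexHull ℝ _ ⟨m, hm, rfl⟩, fun i => ⟨m i, by simp⟩⟩
  · rintro x ⟨hx, hz⟩
    choose z hz using hz
    obtain ⟨hnn, hsum⟩ := hhom.mem_convexHull_support hx
    have hm : x = fun i =>
        ((Finsupp.equivFunOnFinite.symm fun i => (z i).toNat : Fin n →₀ ℕ) i : ℝ) := by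
      ext i
      have h0 : 0 ≤ z i := by
        have := hnn i
        rw [hz] at this
        exact_mod_cast this
      rw [hz, Finsupp.coe_equivFunOnFinite_symm]
      exact_mod_cast (Int.toNat_of_nonneg h0).symm
    generalize (Finsupp.equivFunOnFinite.symm fun i => (z i).toNat : Fin n →₀ ℕ) = m at hm
    subst hm
    have h1 : eval (fun _ => 1) f ≠ 0 := by
      simpa using hstab.eval_ofReal_ne_zero hhom (x := fun _ => 1) fun _ => one_pos
    have hsupp : (C (eval (fun _ => 1) f)⁻¹ * f).support = f.support := by
      ext b
      simp [h1]
    have hd : m.degree = dgr := by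
      rw [Finsupp.degree_eq_sum]
      replace hsum : ∑ i, (m i : ℝ) = dgr := hsum
      exact_mod_cast hsum
    have hne := (hstab.isPosStable hhom).coeff_ne_zero_of_mem_convexHull hd (by rwa [hsupp])
    rw [← mem_support_iff, hsupp] at hne
    exact ⟨m, hne, rfl⟩
end
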